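/- For every integer n ≥ 2 there exist constants C > 0 and c > 0, depending only on n, such that for every prime power q and every symmetric generating set S of L = PSL(n,q), every element of L is a product of at most C·(log|L|)^c elements of S; that is, the diameter of the Cayley graph Cay(L,S) is at most C·(log|L|)^c. -/

import Mathlib

open scoped MatrixGroups Pointwise

set_option linter.unusedSectionVars false

namespace BabaiPSL

section Hilbert

open Module

variable {K : Type*} [Field K] {Ω Ω' ι : Type*}

/-- The span of `1` and the functions in `s`; its `t`-th power consists of the polynomials of
degree at most `t` in the functions in `s`. -/
def gen (K : Type*) [Field K] {Ω : Type*} (s : Set (Ω → K)) : Submodule K (Ω → K) :=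
  Submodule.span K (insert 1 s)

theorem one_le_gen (s : Set (Ω → K)) : 1 ≤ gen K s :=
  Submodule.one_le.2 (Submodule.subset_span (Set.mem_insert _ _))

theorem subset_gen (s : Set (Ω → K)) : s ⊆ gen K s :=
  (Set.subset_insert _ _).trans Submodule.subset_span

theorem mem_gen {s : Set (Ω → K)} {f : Ω → K} (hf : f ∈ s) : f ∈ gen K s := subset_gen s hf

theorem gen_le {s : Set (Ω → K)} {P : Submodule K (Ω → K)} (h1 : 1 ≤ P)
    (h : ∀ f ∈ s, f ∈ P) : gen K s ≤ P := by
  refine Submodule.span_le.2 ?_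
  rintro f (rfl | hf)
  · exact Submodule.one_le.1 h1
  · exact h f hf

theorem gen_mono {s s' : Set (Ω → K)} (h : s ⊆ s') : gen K s ≤ gen K s' :=
  gen_le (one_le_gen _) fun _ hf => mem_gen (h hf)

theorem gen_empty : gen K (∅ : Set (Ω → K)) = 1 := by
  rw [gen, Submodule.one_eq_span]; simp

theorem pow_mono_of_one_le {L : Submodule K (Ω → K)} (hL : 1 ≤ L) {a b : ℕ} (h : a ≤ b) :
    L ^ a ≤ L ^ b := pow_le_pow_right' hL h

theorem one_mem_pow {L : Submodule K (Ω → K)} (hL : 1 ≤ L) (a : ℕ) : (1 : Ω → K) ∈ L ^ a :=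
  Submodule.one_le.1 (one_le_pow_of_one_le' hL a)

theorem const_mem_pow {L : Submodule K (Ω → K)} (hL : 1 ≤ L) (a : ℕ) (x : K) :
    (fun _ => x : Ω → K) ∈ L ^ a := by
  have := (L ^ a).smul_mem x (one_mem_pow hL a)
  convert this using 1
  ext; simp

theorem mul_mem_pow_add {L : Submodule K (Ω → K)} {a b : ℕ} {f g : Ω → K}
    (hf : f ∈ L ^ a) (hg : g ∈ L ^ b) : f * g ∈ L ^ (a + b) := by
  rw [pow_add]; exact Submodule.mul_mem_mul hf hg

theorem pow_le_pow_mul {L L' : Submodule K (Ω → K)} {e : ℕ} (h : L ≤ L' ^ e) (t : ℕ) :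
    L ^ t ≤ L' ^ (e * t) := by
  rw [pow_mul]; exact pow_le_pow_left' h t

/-- A product of `n` functions of degree at most `e` has degree at most `e * n`. -/
theorem prod_mem_pow {L : Submodule K (Ω → K)} {e : ℕ} (s : Finset ι) (f : ι → Ω → K)
    (h : ∀ i ∈ s, f i ∈ L ^ e) : ∏ i ∈ s, f i ∈ L ^ (e * s.card) := by
  classical
  induction s using Finset.induction_on with
  | empty => exact ⟨1, by simp⟩
  | insert a s ha ih =>
    rw [Finset.prod_insert ha, Finset.card_insert_of_notMem ha, mul_add, mul_one, add_comm]
    exact mul_mem_pow_add (h a (Finset.mem_insert_self _ _))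
      (ih fun i hi => h i (Finset.mem_insert_of_mem hi))

/-- Composition with a map, as an algebra homomorphism between function algebras. -/
def pull (K : Type*) [Field K] {Ω Ω' : Type*} (u : Ω' → Ω) : (Ω → K) →ₐ[K] (Ω' → K) where
  toFun f := f ∘ u
  map_one' := rfl
  map_mul' _ _ := rfl
  map_zero' := rfl
  map_add' _ _ := rfl
  commutes' _ := rfl

@[simp] theorem pull_apply (u : Ω' → Ω) (f : Ω → K) : pull K u f = f ∘ u := rfl

/-- The restriction (pullback) of a space of functions. -/
def res (u : Ω' → Ω) (L : Submodule K (Ω → K)) : Submodule K (Ω' → K) :=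
  L.map (pull K u).toLinearMap

theorem mem_res {u : Ω' → Ω} {L : Submodule K (Ω → K)} {f : Ω' → K} :
    f ∈ res u L ↔ ∃ g ∈ L, g ∘ u = f := Iff.rfl

theorem comp_mem_res {u : Ω' → Ω} {L : Submodule K (Ω → K)} {f : Ω → K} (h : f ∈ L) :
    f ∘ u ∈ res u L := ⟨f, h, rfl⟩

theorem res_pow (u : Ω' → Ω) (L : Submodule K (Ω → K)) (t : ℕ) :
    res u (L ^ t) = res u L ^ t := Submodule.map_pow _ _ _

theorem res_mono (u : Ω' → Ω) {L L' : Submodule K (Ω → K)} (h : L ≤ L') :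
    res u L ≤ res u L' := Submodule.map_mono h

theorem res_res {Ω'' : Type*} (u : Ω' → Ω) (v : Ω'' → Ω') (L : Submodule K (Ω → K)) :
    res v (res u L) = res (u ∘ v) L := by
  ext f; constructor
  · rintro ⟨_, ⟨g, hg, rfl⟩, rfl⟩; exact ⟨g, hg, rfl⟩
  · rintro ⟨g, hg, rfl⟩; exact ⟨_, ⟨g, hg, rfl⟩, rfl⟩

theorem one_le_res (u : Ω' → Ω) {L : Submodule K (Ω → K)} (h : 1 ≤ L) : 1 ≤ res u L :=
  Submodule.one_le.2 ⟨1, Submodule.one_le.1 h, rfl⟩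

theorem res_gen (u : Ω' → Ω) (s : Set (Ω → K)) :
    res u (gen K s) = gen K ((fun f => f ∘ u) '' s) := by
  rw [res, gen, Submodule.map_span, gen, Set.image_insert_eq]; rfl

theorem comp_mem_pow {u : Ω' → Ω} {L : Submodule K (Ω → K)} {L' : Submodule K (Ω' → K)} {e : ℕ}
    (h : res u L ≤ L' ^ e) {t : ℕ} {f : Ω → K} (hf : f ∈ L ^ t) : f ∘ u ∈ L' ^ (e * t) := by
  have : f ∘ u ∈ res u L ^ t := by rw [← res_pow]; exact comp_mem_res hf
  exact pow_le_pow_mul h t this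

theorem finrank_mul_le' [Finite Ω] (A B : Submodule K (Ω → K)) :
    finrank K ↥(A * B) ≤ finrank K A * finrank K B := by
  rw [← Submodule.mulMap_range, ← finrank_tensorProduct]
  exact LinearMap.finrank_range_le _

theorem finrank_res_le [Finite Ω] (u : Ω' → Ω) (L : Submodule K (Ω → K)) :
    finrank K (res u L) ≤ finrank K L := Submodule.finrank_map_le _ _

theorem finrank_res_pow_le [Finite Ω] (u : Ω' → Ω) (L : Submodule K (Ω → K)) (t : ℕ) :
    finrank K ↥(res u L ^ t) ≤ finrank K ↥(L ^ t) := by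
  rw [← res_pow]; exact finrank_res_le _ _

theorem finrank_le_of_mul [Finite Ω] {A B : Submodule K (Ω → K)} {δ : Ω → K}
    (hδ : ∀ ω, δ ω ≠ 0) (h : ∀ f ∈ A, δ * f ∈ B) : finrank K A ≤ finrank K B := by
  let φ : A →ₗ[K] B := ((LinearMap.mulLeft K δ).comp A.subtype).codRestrict B
    fun f => h _ f.2
  refine LinearMap.finrank_le_finrank_of_injective (f := φ) fun f g hfg => ?_
  ext ω
  have := congrFun (congrArg Subtype.val hfg) ω
  exact mul_left_cancel₀ (hδ ω) this

/-- Passing to generators with a common denominator `δ`. -/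
theorem finrank_pow_le_of_denom [Finite Ω] {L L' : Submodule K (Ω → K)} {δ : Ω → K}
    (hδ : ∀ ω, δ ω ≠ 0) {a : ℕ} (h : ∀ f ∈ L, δ * f ∈ L' ^ a) (t : ℕ) :
    finrank K ↥(L ^ t) ≤ finrank K ↥(L' ^ (a * t)) := by
  refine finrank_le_of_mul (δ := δ ^ t) (fun ω => pow_ne_zero _ (hδ ω)) fun f hf => ?_
  refine Submodule.pow_induction_on_left' L
    (C := fun t f _ => δ ^ t * f ∈ L' ^ (a * t)) ?_ ?_ ?_ hf
  · intro r; simp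
  · intro x y i _ _ hx hy; rw [mul_add]; exact add_mem hx hy
  · intro m hm i x _ hx
    have := mul_mem_pow_add (h m hm) hx
    rw [show a + a * i = a * i.succ by rw [Nat.succ_eq_add_one]; ring] at this
    convert this using 1
    rw [Nat.succ_eq_add_one]; ring

theorem finrank_mono' [Finite Ω] {A B : Submodule K (Ω → K)} (h : A ≤ B) :
    finrank K A ≤ finrank K B := Submodule.finrank_mono h

/-- Polynomial growth of the Hilbert function. -/
def HB (L : Submodule K (Ω → K)) (C m : ℕ) : Prop :=
  ∀ t : ℕ, finrank K ↥(L ^ t) ≤ C * (t + 1) ^ m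

theorem HB.mono [Finite Ω] {L L' : Submodule K (Ω → K)} {C C' m m' : ℕ} (h : HB L' C m)
    (hL : L ≤ L') (hC : C ≤ C') (hm : m ≤ m') : HB L C' m' := fun t =>
  (finrank_mono' (pow_le_pow_left' hL t)).trans <| (h t).trans <|
    Nat.mul_le_mul hC (Nat.pow_le_pow_right (Nat.succ_pos t) hm)

theorem HB.res [Finite Ω] {L : Submodule K (Ω → K)} {C m : ℕ} (h : HB L C m) (u : Ω' → Ω) :
    HB (res u L) C m := fun t => (finrank_res_pow_le u L t).trans (h t)

theorem growth_mul_aux (C m a t : ℕ) (ha : 1 ≤ a) :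
    C * (a * t + 1) ^ m ≤ C * a ^ m * (t + 1) ^ m := by
  rw [mul_assoc, ← mul_pow]
  refine Nat.mul_le_mul le_rfl (Nat.pow_le_pow_left ?_ m)
  nlinarith

theorem HB.of_denom [Finite Ω] {L L' : Submodule K (Ω → K)} {δ : Ω → K} {C m : ℕ}
    (h' : HB L' C m) (hδ : ∀ ω, δ ω ≠ 0) {a : ℕ} (ha : 1 ≤ a) (h : ∀ f ∈ L, δ * f ∈ L' ^ a) :
    HB L (C * a ^ m) m := fun t =>
  (finrank_pow_le_of_denom hδ h t).trans ((h' _).trans (growth_mul_aux C m a t ha))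

/-- Subadditivity of the Hilbert function over a finite cover. -/
theorem HB.of_cover [Finite Ω] [Finite ι] {L : Submodule K (Ω → K)} {C m : ℕ}
    (P : ι → Set Ω) (hP : ∀ ω, ∃ i, ω ∈ P i)
    (h : ∀ i, HB (BabaiPSL.res (Subtype.val : P i → Ω) L) C m) : HB L (Nat.card ι * C) m := by
  classical
  intro t
  have := Fintype.ofFinite ι
  let φ : ↥(L ^ t) →ₗ[K] ∀ i, ↥(BabaiPSL.res (Subtype.val : P i → Ω) (L ^ t)) :=
    LinearMap.pi fun i => ((pull K (Subtype.val : P i → Ω)).toLinearMap.comp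
      (L ^ t).subtype).codRestrict _ fun f => comp_mem_res f.2
  have hφ : Function.Injective φ := by
    intro f g hfg
    ext ω
    obtain ⟨i, hi⟩ := hP ω
    have := congrFun (congrArg Subtype.val (congrFun hfg i)) ⟨ω, hi⟩
    exact this
  refine (LinearMap.finrank_le_finrank_of_injective hφ).trans ?_
  rw [Module.finrank_pi_fintype]
  refine (Finset.sum_le_card_nsmul _ _ (C * (t + 1) ^ m) fun i _ => ?_).trans ?_
  · rw [res_pow]; exact h i t
  · simp [mul_assoc]

/-! ### Elimination -/

theorem finrank_span_pow_le (u : Ω → K) (e : ℕ) :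
    finrank K (Submodule.span K (Set.range fun i : Fin e => u ^ (i : ℕ))) ≤ e :=
  (finrank_range_le_card (R := K) (fun i : Fin e => u ^ (i : ℕ))).trans (by simp)

/-- Adjoining one function. -/
theorem finrank_pow_le_of_sup [Finite Ω] {L L' : Submodule K (Ω → K)} {u : Ω → K}
    (h1 : 1 ≤ L') (hL : L ≤ L' ⊔ Submodule.span K {u}) (t : ℕ) :
    finrank K ↥(L ^ t) ≤ (t + 1) * finrank K ↥(L' ^ t) := by
  have key : ∀ t, L ^ t ≤
      Submodule.span K (Set.range fun i : Fin (t + 1) => u ^ (i : ℕ)) * L' ^ t := by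
    intro t
    induction t with
    | zero => simp [Submodule.one_eq_span, Submodule.span_mul_span]
    | succ t ih =>
      rw [pow_succ]
      refine (mul_le_mul' ih hL).trans ?_
      rw [Submodule.mul_sup, mul_assoc, ← pow_succ]
      refine sup_le (mul_le_mul_left (Submodule.span_mono ?_) _) ?_
      · rintro _ ⟨i, rfl⟩; exact ⟨i.castSucc, rfl⟩
      · rw [mul_right_comm, Submodule.span_mul_span]
        refine mul_le_mul' (Submodule.span_mono ?_) (pow_mono_of_one_le h1 t.le_succ)
        rintro _ ⟨_, ⟨i, rfl⟩, _, rfl, rfl⟩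
        exact ⟨i.succ, by simp [pow_succ]⟩
  refine (finrank_mono' (key t)).trans ((finrank_mul_le' _ _).trans ?_)
  exact Nat.mul_le_mul (finrank_span_pow_le u (t + 1)) le_rfl

/-- Adjoining one function which satisfies an algebraic relation whose leading coefficient
vanishes nowhere. -/
theorem finrank_pow_le_of_algebraic [Finite Ω] {L L' : Submodule K (Ω → K)} {u : Ω → K}
    (h1 : 1 ≤ L') (hL : L ≤ L' ⊔ Submodule.span K {u}) {e s : ℕ} (c : ℕ → Ω → K)
    (hc : ∀ i, c i ∈ L' ^ s) (hrel : ∑ i ∈ Finset.range (e + 1), c i * u ^ i = 0)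
    (hce : ∀ ω, c e ω ≠ 0) (t : ℕ) :
    finrank K ↥(L ^ t) ≤ e * finrank K ↥(L' ^ ((1 + s) * t)) := by
  set U : Submodule K (Ω → K) := Submodule.span K (Set.range fun i : Fin e => u ^ (i : ℕ))
    with hU
  have hUmem : ∀ i < e, ∀ a : ℕ, ∀ g ∈ L' ^ a, u ^ i * g ∈ U * L' ^ a := fun i hi a g hg =>
    Submodule.mul_mem_mul (Submodule.subset_span ⟨⟨i, hi⟩, rfl⟩) hg
  have hu : ∀ a : ℕ, ∀ f ∈ U * L' ^ a, c e * (u * f) ∈ U * L' ^ (a + s) := by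
    intro a f hf
    refine Submodule.mul_induction_on hf (fun p hp g hg => ?_) (fun x y hx hy => ?_)
    · have hpg : p * g ∈ U * L' ^ a := Submodule.mul_mem_mul hp hg
      clear hpg
      refine Submodule.span_induction (p := fun p _ => c e * (u * (p * g)) ∈ U * L' ^ (a + s))
        ?_ ?_ ?_ ?_ hp
      · rintro _ ⟨⟨i, hi⟩, rfl⟩
        rcases Nat.lt_or_ge (i + 1) e with h | h
        · have := hUmem (i + 1) h (a + s) _ (mul_mem_pow_add hg (hc e))
          convert this using 1; simp only; ring
        · obtain rfl : e = i + 1 := by omega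
          rw [Finset.sum_range_succ] at hrel
          have h2 : c (i + 1) * (u * (u ^ i * g)) =
              -∑ j ∈ Finset.range (i + 1), u ^ j * (g * c j) := by
            have : (∑ j ∈ Finset.range (i + 1), u ^ j * (g * c j)) =
                g * ∑ j ∈ Finset.range (i + 1), c j * u ^ j := by
              rw [Finset.mul_sum]; exact Finset.sum_congr rfl fun _ _ => by ring
            rw [this, eq_neg_of_add_eq_zero_left hrel]; ring
          simp only
          rw [h2]
          exact neg_mem (sum_mem fun j hj => hUmem j (Finset.mem_range.1 hj) _ _
            (mul_mem_pow_add hg (hc j)))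
      · simp
      · intro x y _ _ hx hy
        have := add_mem hx hy
        convert this using 1; ring
      · intro r x _ hx
        have := Submodule.smul_mem _ r hx
        convert this using 1; simp
    · have := add_mem hx hy
      convert this using 1; ring
  have hstep : ∀ a : ℕ, ∀ m ∈ L, ∀ f ∈ U * L' ^ a, c e * (m * f) ∈ U * L' ^ (a + (1 + s)) := by
    intro a m hm f hf
    obtain ⟨g, hg, w, hw, rfl⟩ := Submodule.mem_sup.1 (hL hm)
    obtain ⟨r, rfl⟩ := Submodule.mem_span_singleton.1 hw
    rw [add_mul, mul_add]
    refine add_mem ?_ ?_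
    · have : f * (g * c e) ∈ (U * L' ^ a) * L' ^ (1 + s) := by
        refine Submodule.mul_mem_mul hf ?_
        exact mul_mem_pow_add (by simpa using hg) (hc e)
      rw [mul_assoc, ← pow_add] at this
      convert this using 1; ring
    · have := Submodule.smul_mem _ r (hu a f hf)
      have := mul_le_mul_right (pow_mono_of_one_le h1 (show a + s ≤ a + (1 + s) by omega)) U this
      convert this using 1; simp
  rcases Nat.eq_zero_or_pos e with rfl | he
  · have : IsEmpty Ω := ⟨fun ω => hce ω (by simpa using congrFun hrel ω)⟩
    exact (Submodule.finrank_le (L ^ t)).trans (by simp [finrank_zero_of_subsingleton])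
  have key : ∀ f ∈ L ^ t, c e ^ t * f ∈ U * L' ^ ((1 + s) * t) := by
    intro f hf
    refine Submodule.pow_induction_on_left' L
      (C := fun t f _ => c e ^ t * f ∈ U * L' ^ ((1 + s) * t)) ?_ ?_ ?_ hf
    · intro r
      have := hUmem 0 he 0 (algebraMap K (Ω → K) r) (by
        rw [pow_zero]; exact Submodule.algebraMap_mem r)
      simpa using this
    · intro x y i _ _ hx hy; rw [mul_add]; exact add_mem hx hy
    · intro m hm i x _ hx
      have := hstep _ m hm _ hx
      rw [show (1 + s) * i + (1 + s) = (1 + s) * i.succ by rw [Nat.succ_eq_add_one]; ring] at this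
      convert this using 1
      rw [Nat.succ_eq_add_one]; ring
  refine (finrank_le_of_mul (fun ω => pow_ne_zero t (hce ω)) key).trans ?_
  exact (finrank_mul_le' _ _).trans (Nat.mul_le_mul (finrank_span_pow_le u e) le_rfl)

theorem HB.adjoin [Finite Ω] {L L' : Submodule K (Ω → K)} {u : Ω → K} {C m : ℕ}
    (h' : HB L' C m) (h1 : 1 ≤ L') (hL : L ≤ L' ⊔ Submodule.span K {u}) : HB L C (m + 1) :=
  fun t => (finrank_pow_le_of_sup h1 hL t).trans <| by
    rw [pow_succ, ← mul_assoc, mul_comm]; exact Nat.mul_le_mul (h' t) le_rfl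

theorem HB.adjoin_algebraic [Finite Ω] {L L' : Submodule K (Ω → K)} {u : Ω → K} {C m : ℕ}
    (h' : HB L' C m) (h1 : 1 ≤ L') (hL : L ≤ L' ⊔ Submodule.span K {u}) {e s : ℕ}
    (c : ℕ → Ω → K) (hc : ∀ i, c i ∈ L' ^ s)
    (hrel : ∑ i ∈ Finset.range (e + 1), c i * u ^ i = 0) (hce : ∀ ω, c e ω ≠ 0) :
    HB L (e * (C * (1 + s) ^ m)) m := fun t => by
  refine (finrank_pow_le_of_algebraic h1 hL c hc hrel hce t).trans ?_
  rw [mul_assoc]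
  exact Nat.mul_le_mul le_rfl ((h' _).trans (growth_mul_aux C m _ t (by omega)))

theorem HB_one [Finite Ω] : HB (1 : Submodule K (Ω → K)) 1 0 := fun t => by
  rw [one_pow, Submodule.one_eq_span]
  simpa using finrank_span_le_card (R := K) ({1} : Set (Ω → K))

theorem gen_insert_le (s : Set (Ω → K)) (u : Ω → K) :
    gen K (insert u s) ≤ gen K s ⊔ Submodule.span K {u} := by
  refine gen_le ((one_le_gen s).trans le_sup_left) ?_
  rintro f (rfl | hf)
  · exact Submodule.mem_sup_right (Submodule.mem_span_singleton_self _)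
  · exact Submodule.mem_sup_left (mem_gen hf)

theorem HB_gen_image [Finite Ω] (u : ι → Ω → K) (s : Finset ι) :
    HB (gen K (u '' s)) 1 s.card := by
  classical
  induction s using Finset.induction_on with
  | empty => simpa [gen_empty] using HB_one
  | insert a s ha ih =>
    rw [Finset.card_insert_of_notMem ha, Finset.coe_insert, Set.image_insert_eq]
    exact ih.adjoin (one_le_gen _) (gen_insert_le _ _)

theorem HB_gen_range [Finite Ω] [Fintype ι] (u : ι → Ω → K) :
    HB (gen K (Set.range u)) 1 (Fintype.card ι) := by
  classical
  simpa [← Finset.card_univ] using HB_gen_image u Finset.univ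

/-- The space of affine functions in the first `a` terms of a sequence. -/
def genLT (u : ℕ → Ω → K) (a : ℕ) : Submodule K (Ω → K) := gen K (u '' {b | b < a})

theorem one_le_genLT (u : ℕ → Ω → K) (a : ℕ) : 1 ≤ genLT u a := one_le_gen _

theorem mem_genLT (u : ℕ → Ω → K) {a b : ℕ} (h : b < a) : u b ∈ genLT u a :=
  mem_gen ⟨b, h, rfl⟩

theorem genLT_mono (u : ℕ → Ω → K) {a b : ℕ} (h : a ≤ b) : genLT u a ≤ genLT u b :=
  gen_mono (Set.image_mono fun _ hx => lt_of_lt_of_le hx h)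

theorem genLT_zero (u : ℕ → Ω → K) : genLT u 0 = 1 := by simp [genLT, gen_empty]

theorem genLT_succ_le (u : ℕ → Ω → K) (a : ℕ) :
    genLT u (a + 1) ≤ genLT u a ⊔ Submodule.span K {u a} := by
  refine le_trans (gen_mono ?_) (gen_insert_le _ _)
  rintro _ ⟨b, hb, rfl⟩
  rcases Nat.lt_succ_iff_lt_or_eq.1 hb with h | rfl
  · exact Or.inr ⟨b, h, rfl⟩
  · exact Or.inl rfl

theorem res_genLT (v : Ω' → Ω) (u : ℕ → Ω → K) (a : ℕ) :
    res v (genLT u a) = genLT (fun b => u b ∘ v) a := by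
  rw [genLT, res_gen, Set.image_image]; rfl

/-- An algebraic relation of degree at most `s` satisfied by the `a`-th function over the previous
ones, with leading coefficient `c e`. -/
def Rel (u : ℕ → Ω → K) (s a e : ℕ) (c : ℕ → Ω → K) : Prop :=
  1 ≤ e ∧ e ≤ s ∧ (∀ i, c i ∈ genLT u a ^ s) ∧ ∑ i ∈ Finset.range (e + 1), c i * u a ^ i = 0

theorem Rel.comp {u : ℕ → Ω → K} {s a e : ℕ} {c : ℕ → Ω → K} (h : Rel u s a e c) (v : Ω' → Ω) :
    Rel (fun b => u b ∘ v) s a e (fun i => c i ∘ v) := by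
  refine ⟨h.1, h.2.1, fun i => ?_, ?_⟩
  · rw [← res_genLT, ← res_pow]; exact comp_mem_res (h.2.2.1 i)
  · have := congrArg (pull K v) h.2.2.2
    rw [map_sum, map_zero] at this
    exact this

/-- The Hilbert function of a triangular system. -/
theorem HB_of_rel [Finite Ω] (u : ℕ → Ω → K) (s M : ℕ) (I : Finset ℕ)
    (h : ∀ a < M, a ∉ I → ∃ e c, Rel u s a e c ∧ ∀ ω, c e ω ≠ 0) :
    HB (genLT u M) (((1 + s) ^ (M + 1)) ^ M) (I ∩ Finset.range M).card := by
  suffices H : ∀ a ≤ M, HB (genLT u a) (((1 + s) ^ (M + 1)) ^ a)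
      (I ∩ Finset.range a).card from H M le_rfl
  intro a
  induction a with
  | zero => intro _; simpa [genLT_zero] using HB_one
  | succ a ih =>
    intro ha
    have ih := ih (by omega)
    have hcard : (I ∩ Finset.range a).card ≤ M :=
      (Finset.card_le_card Finset.inter_subset_right).trans (by simp; omega)
    rw [Finset.range_add_one]
    by_cases haI : a ∈ I
    · rw [Finset.inter_insert_of_mem haI, Finset.card_insert_of_notMem (by simp)]
      refine (ih.adjoin (one_le_genLT u a) (genLT_succ_le u a)).mono le_rfl ?_ le_rfl
      exact Nat.pow_le_pow_right (by positivity) a.le_succ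
    · rw [Finset.inter_insert_of_notMem haI]
      obtain ⟨e, c, ⟨h1, h2, h3, h4⟩, h5⟩ := h a (by omega) haI
      refine (ih.adjoin_algebraic (one_le_genLT u a) (genLT_succ_le u a) c h3 h4 h5).mono
        le_rfl ?_ le_rfl
      rw [pow_succ _ a, mul_left_comm]
      refine Nat.mul_le_mul le_rfl ?_
      rw [pow_succ, mul_comm]
      exact Nat.mul_le_mul (Nat.pow_le_pow_right (by omega) hcard) (by omega)

end Hilbert

section Genericity

open Module

variable {K : Type*} [Field K] {Ω Ω' E : Type*}

/-- Nonzero functions in `V` vanish on at most a proportion `c` of the points. -/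
def Generic (V : Submodule K (Ω → K)) (c : ℝ) : Prop :=
  ∀ f ∈ V, f ≠ 0 → (Nat.card {ω // f ω = 0} : ℝ) ≤ c * Nat.card Ω

theorem finrank_map_lt {V W : Type*} [AddCommGroup V] [Module K V] [AddCommGroup W] [Module K W]
    [FiniteDimensional K V] (φ : V →ₗ[K] W) (A : Submodule K V) {x : V} (hx : x ∈ A)
    (h : φ x = 0) (h0 : x ≠ 0) : finrank K (A.map φ) < finrank K A := by
  have h2 := LinearMap.finrank_range_add_finrank_ker (φ.domRestrict A)
  have h3 : 0 < finrank K (LinearMap.ker (φ.domRestrict A)) :=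
    finrank_pos_iff_exists_ne_zero.2 ⟨⟨⟨x, hx⟩, h⟩, fun h => h0 (congrArg (fun x => x.1.1) h)⟩
  rw [LinearMap.range_domRestrict] at h2
  omega

/-- Every finite set contains a large generic subset. -/
theorem exists_generic [Finite Ω] (V : Submodule K (Ω → K)) (p : ℕ) (hp : 0 < p) (X : Set Ω) :
    ∃ E ⊆ X, Nat.card X ≤ p ^ finrank K (res (Subtype.val : X → Ω) V) * Nat.card E ∧
      Generic (res (Subtype.val : E → Ω) V) (1 / p) := by
  suffices H : ∀ k : ℕ, ∀ X : Set Ω, finrank K (res (Subtype.val : X → Ω) V) ≤ k →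
      ∃ E ⊆ X, Nat.card X ≤ p ^ k * Nat.card E ∧
        Generic (res (Subtype.val : E → Ω) V) (1 / p) from H _ X le_rfl
  intro k
  induction k with
  | zero =>
    intro X hX
    refine ⟨X, subset_rfl, by simp, fun f hf hf0 => absurd ?_ hf0⟩
    have : res (Subtype.val : X → Ω) V = ⊥ := Submodule.finrank_eq_zero.1 (by omega)
    rw [this] at hf; exact (Submodule.mem_bot K).1 hf
  | succ k ih =>
    intro X hX
    by_cases hg : Generic (res (Subtype.val : X → Ω) V) (1 / p)
    · refine ⟨X, subset_rfl, ?_, hg⟩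
      exact Nat.le_mul_of_pos_left _ (by positivity)
    simp only [Generic, not_forall, not_le] at hg
    obtain ⟨_, ⟨f, hfV, rfl⟩, hf0, hcard⟩ := hg
    let Y : Set Ω := {ω ∈ X | f ω = 0}
    have hYX : Y ⊆ X := fun _ h => h.1
    have hY : Nat.card {ω : X // f ω = 0} = Nat.card Y :=
      Nat.card_congr
        ⟨fun ω => ⟨ω.1.1, ω.1.2, ω.2⟩, fun ω => ⟨⟨ω.1, ω.2.1⟩, ω.2.2⟩, fun _ => rfl, fun _ => rfl⟩
    have hlt : finrank K (res (Subtype.val : Y → Ω) V) <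
        finrank K (res (Subtype.val : X → Ω) V) := by
      have e : res (Subtype.val : Y → Ω) V =
          res (Set.inclusion hYX) (res (Subtype.val : X → Ω) V) := by rw [res_res]; rfl
      rw [e]
      refine finrank_map_lt _ _ ⟨f, hfV, rfl⟩ ?_ hf0
      ext ω; exact ω.2.2
    obtain ⟨E, hE, hEc, hEg⟩ := ih Y (by omega)
    refine ⟨E, hE.trans hYX, ?_, hEg⟩
    have hp' : (0 : ℝ) < p := by exact_mod_cast hp
    have : Nat.card X < p * Nat.card Y := by
      have hc : (1 / p : ℝ) * Nat.card X < Nat.card Y := by rw [← hY]; exact hcard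
      have : (Nat.card X : ℝ) < p * Nat.card Y := by
        rw [one_div, inv_mul_lt_iff₀ hp'] at hc; exact hc
      exact_mod_cast this
    calc Nat.card X ≤ p * (p ^ k * Nat.card E) := this.le.trans (Nat.mul_le_mul le_rfl hEc)
      _ = _ := by ring

theorem card_zeros_pair [Finite Ω] [Finite E] (f : Ω × E → K) {a b : ℝ} (hb : 0 ≤ b)
    (h1 : ∀ e, (∃ ω, f (ω, e) ≠ 0) → (Nat.card {ω // f (ω, e) = 0} : ℝ) ≤ b * Nat.card Ω)
    (h2 : ∀ ω, (∃ e, f (ω, e) ≠ 0) → (Nat.card {e // f (ω, e) = 0} : ℝ) ≤ a * Nat.card E)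
    (hf : f ≠ 0) : (Nat.card {x // f x = 0} : ℝ) ≤ (b + a) * Nat.card (Ω × E) := by
  classical
  have := Fintype.ofFinite Ω
  have := Fintype.ofFinite E
  obtain ⟨⟨ω₀, e₀⟩, h₀⟩ : ∃ x, f x ≠ 0 := by
    by_contra! h; exact hf (funext h)
  have hsum : Nat.card {x // f x = 0} = ∑ e : E, Nat.card {ω // f (ω, e) = 0} := by
    rw [← Nat.card_sigma]
    exact Nat.card_congr
      ⟨fun x => ⟨x.1.2, x.1.1, x.2⟩, fun x => ⟨(x.2.1, x.1), x.2.2⟩, fun _ => rfl, fun _ => rfl⟩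
  have hterm : ∀ e : E, (Nat.card {ω // f (ω, e) = 0} : ℝ) ≤
      b * Nat.card Ω + if f (ω₀, e) = 0 then (Nat.card Ω : ℝ) else 0 := by
    intro e
    by_cases he : ∃ ω, f (ω, e) ≠ 0
    · refine (h1 e he).trans (le_add_of_nonneg_right ?_)
      split_ifs <;> positivity
    · push Not at he
      rw [if_pos (he ω₀)]
      have : (Nat.card {ω // f (ω, e) = 0} : ℝ) ≤ Nat.card Ω := by
        exact_mod_cast Finite.card_subtype_le _
      have : 0 ≤ b * Nat.card Ω := by positivity
      linarith
  rw [hsum, Nat.cast_sum]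
  refine (Finset.sum_le_sum fun e _ => hterm e).trans ?_
  rw [Finset.sum_add_distrib, ← Finset.sum_filter]
  have h3 := h2 ω₀ ⟨e₀, h₀⟩
  rw [Nat.card_eq_fintype_card, Fintype.card_subtype] at h3
  simp only [Finset.sum_const, nsmul_eq_mul, Finset.card_univ, Nat.card_eq_fintype_card,
    Fintype.card_prod, Nat.cast_mul] at h3 ⊢
  have : (0 : ℝ) ≤ Fintype.card Ω := by positivity
  nlinarith

/-- A function on a power whose slices in every coordinate lie in a generic space. -/
theorem card_zeros_pow [Finite E] {V : Submodule K (E → K)} {c : ℝ} (hc : 0 ≤ c)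
    (hV : Generic V c) : ∀ (k : ℕ) (f : (Fin k → E) → K),
      (∀ i ω, (fun e => f (Function.update ω i e)) ∈ V) → f ≠ 0 →
      (Nat.card {ω // f ω = 0} : ℝ) ≤ k * c * Nat.card (Fin k → E)
  | 0, f, _, hf => by
    have : IsEmpty {ω // f ω = 0} := ⟨fun ω => hf (by
      ext x; rw [Subsingleton.elim x ω.1, ω.2]; rfl)⟩
    simp
  | k + 1, f, hs, hf => by
    let ε : (Fin k → E) × E ≃ (Fin (k + 1) → E) :=
      { toFun := fun x => Fin.snoc (α := fun _ => E) x.1 x.2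
        invFun := fun ω => (Fin.init ω, ω (Fin.last k))
        left_inv := fun x => by simp
        right_inv := fun x => by simp }
    have hε : ∀ x, ε x = Fin.snoc (α := fun _ => E) x.1 x.2 := fun _ => rfl
    have key := card_zeros_pair (fun x => f (ε x)) (a := c) (b := k * c) (by positivity) ?_ ?_ ?_
    · rw [← Nat.card_congr ε]
      have h : Nat.card {x // f (ε x) = 0} = Nat.card {ω // f ω = 0} :=
        Nat.card_congr (ε.subtypeEquiv fun _ => Iff.rfl)
      rw [h] at key
      push_cast
      linarith
    · rintro e ⟨ω, hω⟩
      refine card_zeros_pow hc hV k (fun ω => f (ε (ω, e))) ?_ fun h => hω (congrFun h ω)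
      intro i ω
      have := hs i.castSucc (ε (ω, e))
      convert this using 3
      simp [hε]
    · rintro ω ⟨e, he⟩
      refine hV (fun e => f (ε (ω, e))) ?_ fun h => he (congrFun h e)
      have := hs (Fin.last k) (ε (ω, e))
      convert this using 3
      simp only [hε, Fin.update_snoc_last]
    · intro h
      exact hf (funext fun ω => by simpa using congrFun h (ε.symm ω))

end Genericity

section Escape

open Module

variable {K : Type*} [Field K] {G : Type*} [Group G]

theorem mem_pow_of_closure_eq_top [Finite G] {S : Set G}
    (hS : Subgroup.closure S = ⊤) (x : G) : ∃ j, x ∈ S ^ j := by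
  have hx₀ : x ∈ Subgroup.closure S := by rw [hS]; trivial
  have hx : x ∈ Submonoid.closure S := by
    rw [← Subgroup.closure_toSubmonoid_of_finite]; exact hx₀
  clear hx₀
  induction hx using Submonoid.closure_induction with
  | mem x hx => exact ⟨1, by simpa using hx⟩
  | one => exact ⟨0, by simp⟩
  | mul x y _ _ hx hy =>
    obtain ⟨a, ha⟩ := hx
    obtain ⟨b, hb⟩ := hy
    exact ⟨a + b, by rw [pow_add]; exact Set.mul_mem_mul ha hb⟩

/-- A function from a translation invariant space which vanishes on a sufficiently large ball
vanishes everywhere. -/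
theorem escape [Finite G] {S : Set G} (h1 : 1 ∈ S) (hS : Subgroup.closure S = ⊤)
    (V : Submodule K (G → K)) (hV : ∀ f ∈ V, ∀ a, (fun x => f (x * a)) ∈ V) {m : ℕ}
    (hm : finrank K V ≤ m) {f : G → K} (hf : f ∈ V) (h0 : ∀ x ∈ S ^ m, f x = 0) : f = 0 := by
  let A : ℕ → Submodule K (G → K) := fun j =>
    { carrier := {f | f ∈ V ∧ ∀ x ∈ S ^ j, f x = 0}
      add_mem' := fun {f g} hf hg => ⟨add_mem hf.1 hg.1, fun x hx => by
        simp [hf.2 x hx, hg.2 x hx]⟩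
      zero_mem' := ⟨zero_mem _, fun _ _ => rfl⟩
      smul_mem' := fun r f hf => ⟨V.smul_mem r hf.1, fun x hx => by simp [hf.2 x hx]⟩ }
  have hA : ∀ j f, f ∈ A j ↔ f ∈ V ∧ ∀ x ∈ S ^ j, f x = 0 := fun _ _ => Iff.rfl
  have hanti : ∀ j, A (j + 1) ≤ A j := fun j f hf =>
    ⟨hf.1, fun x hx => hf.2 x (Set.pow_subset_pow_right h1 j.le_succ hx)⟩
  have hnext : ∀ j f, f ∈ A (j + 1) ↔ f ∈ V ∧ ∀ s ∈ S, (fun x => f (x * s)) ∈ A j := by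
    intro j f
    constructor
    · intro h
      refine ⟨h.1, fun s hs => ⟨hV f h.1 s, fun x hx => h.2 _ ?_⟩⟩
      rw [pow_succ]; exact Set.mul_mem_mul hx hs
    · intro h
      refine ⟨h.1, fun x hx => ?_⟩
      rw [pow_succ] at hx
      obtain ⟨y, hy, s, hs, rfl⟩ := hx
      exact (h.2 s hs).2 y hy
  have hstab : ∀ j, A (j + 1) = A j → ∀ i, A (j + i) = A j := by
    intro j hj i
    induction i with
    | zero => rfl
    | succ i ih =>
      rw [← hj]
      ext f
      rw [← add_assoc, hnext, hnext, ih]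
  have hzero : ∀ j, A (j + 1) = A j → A j = ⊥ := by
    intro j hj
    rw [eq_bot_iff]
    intro f hf
    rw [Submodule.mem_bot]
    ext x
    obtain ⟨i, hi⟩ := mem_pow_of_closure_eq_top hS x
    rw [← hstab j hj i] at hf
    exact hf.2 x (Set.pow_subset_pow_right h1 (Nat.le_add_left _ _) hi)
  have hdim : ∀ j, A j = ⊥ ∨ finrank K (A j) + j ≤ finrank K V := by
    intro j
    induction j with
    | zero => exact Or.inr (finrank_mono' (A := A 0) (B := V) fun f hf => hf.1)
    | succ j ih =>
      rcases (hanti j).eq_or_lt with h | h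
      · left; rw [h]; exact hzero j h
      · rcases ih with ih | ih
        · left; rw [ih] at h; exact absurd h not_lt_bot
        · right
          have := Submodule.finrank_lt_finrank_of_lt h
          omega
  have hfm : f ∈ A m := ⟨hf, h0⟩
  rcases hdim m with h | h
  · rw [h] at hfm; exact (Submodule.mem_bot K).1 hfm
  · have : A m = ⊥ := Submodule.finrank_eq_zero.1 (by omega)
    rw [this] at hfm; exact (Submodule.mem_bot K).1 hfm

end Escape

section Dominance

open Module

variable {K : Type*} [Field K] {G : Type*} [Group G]

/-- A space of functions on a group which is invariant under translations, and which is compatible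
with the conjugation maps. -/
structure TransInv (L : Submodule K (G → K)) (κ : ℕ) : Prop where
  one_le : 1 ≤ L
  right : ∀ a, ∀ f ∈ L, (fun x => f (x * a)) ∈ L
  left : ∀ a, ∀ f ∈ L, (fun x => f (a * x)) ∈ L
  conj : ∀ w h, ∀ f ∈ L, (fun x => f (w * (x * h * x⁻¹))) ∈ L ^ κ

namespace TransInv

variable {L : Submodule K (G → K)} {κ : ℕ}

theorem right_pow (hL : TransInv L κ) (a : G) {t : ℕ} {f : G → K} (hf : f ∈ L ^ t) :
    (fun x => f (x * a)) ∈ L ^ t := by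
  have : res (fun x => x * a) L ≤ L ^ 1 := by
    rintro _ ⟨f, hf, rfl⟩; rw [pow_one]; exact hL.right a f hf
  rw [← one_mul t]; exact comp_mem_pow this hf

theorem left_pow (hL : TransInv L κ) (a : G) {t : ℕ} {f : G → K} (hf : f ∈ L ^ t) :
    (fun x => f (a * x)) ∈ L ^ t := by
  have : res (fun x => a * x) L ≤ L ^ 1 := by
    rintro _ ⟨f, hf, rfl⟩; rw [pow_one]; exact hL.left a f hf
  rw [← one_mul t]; exact comp_mem_pow this hf

theorem conj_pow (hL : TransInv L κ) (w h : G) {t : ℕ} {f : G → K} (hf : f ∈ L ^ t) :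
    (fun x => f (w * (x * h * x⁻¹))) ∈ L ^ (κ * t) := by
  refine comp_mem_pow (u := fun x => w * (x * h * x⁻¹)) (L' := L) ?_ hf
  rintro _ ⟨f, hf, rfl⟩; exact hL.conj w h f hf

end TransInv

/-- The product `e₀ g₀⁻¹ ⋯` of the letters of `ω` interlaced with the elements `g j`. -/
def word {E : Set G} (g : ℕ → G) : (j : ℕ) → (Fin j → E) → G
  | 0, _ => 1
  | j + 1, ω => word g j (Fin.init ω) * (g j * ω (Fin.last j))

variable {E : Set G}

theorem word_snoc (g : ℕ → G) (j : ℕ) (ω : Fin j → E) (e : E) :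
    word g (j + 1) (Fin.snoc (α := fun _ => E) ω e) = word g j ω * (g j * e) := by
  simp [word]

theorem word_congr {g g' : ℕ → G} {j : ℕ} (h : ∀ i < j, g i = g' i) :
    word (E := E) g j = word g' j := by
  induction j with
  | zero => rfl
  | succ j ih => ext ω; simp only [word]; rw [ih fun i hi => h i (by omega), h j (by omega)]

theorem word_update (g : ℕ → G) : ∀ (j : ℕ) (ω : Fin j → E) (i : Fin j),
    ∃ a b : G, ∀ e, word g j (Function.update ω i e) = a * (e * b)
  | 0, _, i => i.elim0
  | j + 1, ω, i => by
    obtain ⟨ω, x, rfl⟩ : ∃ (ω' : Fin j → E) (x : E), ω = Fin.snoc (α := fun _ => E) ω' x :=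
      ⟨_, _, (Fin.snoc_init_self ω).symm⟩
    induction i using Fin.lastCases with
    | last =>
      refine ⟨word g j ω * g j, 1, fun e => ?_⟩
      rw [Fin.update_snoc_last, word_snoc]; group
    | cast i =>
      obtain ⟨a, b, h⟩ := word_update g j ω i
      refine ⟨a, b * (g j * x), fun e => ?_⟩
      rw [← Fin.snoc_update, word_snoc, h]; group

theorem word_mem_pow {S : Set G} {m N : ℕ} {g : ℕ → G} (hg : ∀ i, g i ∈ S ^ m) (hE : E ⊆ S ^ N) :
    ∀ (j : ℕ) (ω : Fin j → E), word g j ω ∈ S ^ (j * (m + N))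
  | 0, _ => by simp [word]
  | j + 1, ω => by
    rw [add_mul, one_mul, pow_add, word]
    refine Set.mul_mem_mul (word_mem_pow hg hE j _) ?_
    rw [pow_add]
    exact Set.mul_mem_mul (hg j) (hE (ω _).2)

variable {L : Submodule K (G → K)} {κ : ℕ}

theorem slice_mem (hL : TransInv L κ) (g : ℕ → G) {j t : ℕ} {f : G → K} (hf : f ∈ L ^ t)
    (i : Fin j) (ω : Fin j → E) :
    (fun e => f (word g j (Function.update ω i e))) ∈ res (Subtype.val : E → G) (L ^ t) := by
  obtain ⟨a, b, h⟩ := word_update g j ω i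
  refine ⟨_, hL.left_pow a (hL.right_pow b hf), ?_⟩
  ext e
  simp [h, mul_assoc]

theorem finrank_add_le {U V W : Type*} [AddCommGroup U] [Module K U] [AddCommGroup V] [Module K V]
    [AddCommGroup W] [Module K W] [FiniteDimensional K V]
    (φ : V →ₗ[K] W) (ψ : U →ₗ[K] V) (A : Submodule K V) (B : Submodule K U)
    (hA : ∀ x ∈ B, ψ x ∈ A) (hφ : ∀ x ∈ B, φ (ψ x) = 0) (hψ : ∀ x ∈ B, ψ x = 0 → x = 0) :
    finrank K B + finrank K (A.map φ) ≤ finrank K A := by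
  have h2 := LinearMap.finrank_range_add_finrank_ker (φ.domRestrict A)
  rw [LinearMap.range_domRestrict] at h2
  let χ : B →ₗ[K] LinearMap.ker (φ.domRestrict A) :=
    ((ψ.domRestrict B).codRestrict A fun x => hA x x.2).codRestrict _ fun x => hφ x x.2
  have hχ : Function.Injective χ := by
    refine (injective_iff_map_eq_zero χ).2 fun x hx => Subtype.ext (hψ x x.2 ?_)
    exact congrArg (fun y => y.1.1) hx
  have := LinearMap.finrank_le_finrank_of_injective hχ
  omega

theorem finrank_growth [Finite G] (hL : TransInv L κ) (g : ℕ → G) {D j s t : ℕ} {c : ℝ}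
    (hc : 0 ≤ c) (hjc : (j + 1 : ℕ) * c * 2 < 1)
    (hE : Generic (res (Subtype.val : E → G) (L ^ D)) c) (e₀ : E)
    {f : G → K} (hf : f ∈ L ^ s) (hf0 : f ∘ word (E := E) g (j + 1) ≠ 0)
    (hfe : ∀ ω : Fin j → E, f (word g j ω * (g j * e₀)) = 0) (ht : t + s ≤ D) :
    finrank K (res (word (E := E) g (j + 1)) (L ^ t)) +
      finrank K (res (word (E := E) g j) (L ^ (t + s))) ≤
      finrank K (res (word (E := E) g (j + 1)) (L ^ (t + s))) := by
  have : Nonempty E := ⟨e₀⟩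
  let ι : (Fin j → E) → (Fin (j + 1) → E) := fun ω => Fin.snoc (α := fun _ => E) ω e₀
  have h1 := finrank_add_le (pull K ι).toLinearMap
    (LinearMap.mulLeft K (f ∘ word (E := E) g (j + 1)))
    (res (word (E := E) g (j + 1)) (L ^ (t + s))) (res (word (E := E) g (j + 1)) (L ^ t))
    ?_ ?_ ?_
  · refine (Nat.add_le_add_left (finrank_mono' ?_) _).trans h1
    rintro _ ⟨F, hF, rfl⟩
    refine ⟨_, comp_mem_res (u := word g (j + 1)) (hL.right_pow (g j * e₀)⁻¹ hF), ?_⟩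
    ext ω
    simp only [AlgHom.toLinearMap_apply, pull_apply, Function.comp_apply, ι, word_snoc,
      mul_inv_cancel_right]
  · rintro _ ⟨F, hF, rfl⟩
    refine ⟨f * F, ?_, rfl⟩
    rw [add_comm]; exact mul_mem_pow_add hf hF
  · rintro _ ⟨F, hF, rfl⟩
    ext ω
    have := hfe ω
    simp only [LinearMap.mulLeft_apply, AlgHom.toLinearMap_apply, pull_apply, Function.comp_apply,
      Pi.mul_apply, Pi.zero_apply, ι, word_snoc, this, zero_mul]
  · rintro _ ⟨F, hF, rfl⟩ h0
    by_contra hF0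
    have z1 := card_zeros_pow hc hE (j + 1) (fun ω => f (word g (j + 1) ω))
      (fun i ω => res_mono _ (pow_mono_of_one_le hL.one_le (by omega)) (slice_mem hL g hf i ω)) hf0
    have z2 := card_zeros_pow hc hE (j + 1) (fun ω => F (word g (j + 1) ω))
      (fun i ω => res_mono _ (pow_mono_of_one_le hL.one_le (by omega)) (slice_mem hL g hF i ω)) hF0
    have h3 : Nat.card (Fin (j + 1) → E) ≤ Nat.card {ω : Fin (j + 1) → E // f (word g (j + 1) ω) = 0} +
        Nat.card {ω : Fin (j + 1) → E // F (word g (j + 1) ω) = 0} := by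
      rw [← Nat.card_sum]
      refine Nat.card_le_card_of_surjective (fun x : _ ⊕ _ => Sum.elim (fun x => x.1) (fun x => x.1) x) ?_
      intro ω
      have := congrFun h0 ω
      rcases mul_eq_zero.1 this with h | h
      · exact ⟨Sum.inl ⟨ω, h⟩, rfl⟩
      · exact ⟨Sum.inr ⟨ω, h⟩, rfl⟩
    have h4 : (0 : ℝ) < Nat.card (Fin (j + 1) → E) := by exact_mod_cast Nat.card_pos
    have h5 : (Nat.card (Fin (j + 1) → E) : ℝ) ≤
        (j + 1 : ℕ) * c * Nat.card (Fin (j + 1) → E) +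
        (j + 1 : ℕ) * c * Nat.card (Fin (j + 1) → E) :=
      le_trans (by exact_mod_cast h3) (add_le_add z1 z2)
    nlinarith

/-- If the functions of degree at most `s` which vanish on the values of `word g j` are not all
zero, then some letter `g j` allows the dimension to grow. -/
theorem exists_letter [Finite G] {S : Set G} (h1 : 1 ∈ S) (hS : Subgroup.closure S = ⊤)
    (hL : TransInv L κ) {s m : ℕ} (hm : finrank K ↥(L ^ (κ * s)) ≤ m)
    {e₁ e₂ : E} (he : Subgroup.normalClosure {(e₂ : G) * (e₁ : G)⁻¹} = ⊤) (W : Set G)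
    (hW : W.Nonempty) {f₀ : G → K} (hf₀ : f₀ ∈ L ^ s) (hf₀0 : f₀ ≠ 0) (hf₀W : ∀ w ∈ W, f₀ w = 0) :
    ∃ γ ∈ S ^ m, ∃ e₀ : E, ∃ f ∈ L ^ s, (∀ w ∈ W, f (w * (γ * e₀)) = 0) ∧
      ∃ w ∈ W, ∃ e : E, f (w * (γ * e)) ≠ 0 := by
  by_contra! hcon
  have inv1 : ∀ (a b : E) (x : G) (f : G → K), f ∈ L ^ s → (∀ w ∈ W, f w = 0) →
      ∀ w ∈ W, f (w * (x * ((a : G) * (b : G)⁻¹) * x⁻¹)) = 0 := by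
    intro a b x f hf hfW w hw
    have := escape h1 hS (L ^ (κ * s)) (fun f hf a => hL.right_pow a hf) hm
      (hL.conj_pow w ((a : G) * (b : G)⁻¹) hf) ?_
    · exact congrFun this x
    · intro γ hγ
      have := hcon γ hγ b (fun x => f (x * (γ * b)⁻¹)) (hL.right_pow _ hf)
        (fun w hw => by simpa only [mul_inv_cancel_right] using hfW w hw) w hw a
      simpa [mul_assoc] using this
  have hall : ∀ x : G, ∀ f ∈ L ^ s, (∀ w ∈ W, f w = 0) → ∀ w ∈ W, f (w * x) = 0 := by
    intro x
    have hx : x ∈ Subgroup.normalClosure {(e₂ : G) * (e₁ : G)⁻¹} := by rw [he]; trivial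
    rw [Subgroup.normalClosure] at hx
    induction hx using Subgroup.closure_induction'' with
    | mem y hy =>
      obtain ⟨_, rfl, hy⟩ := Group.mem_conjugatesOfSet_iff.1 hy
      obtain ⟨z, rfl⟩ := isConj_iff.1 hy
      intro f hf hfW w hw
      exact inv1 e₂ e₁ z f hf hfW w hw
    | inv_mem y hy =>
      obtain ⟨_, rfl, hy⟩ := Group.mem_conjugatesOfSet_iff.1 hy
      obtain ⟨z, rfl⟩ := isConj_iff.1 hy
      intro f hf hfW w hw
      have := inv1 e₁ e₂ z f hf hfW w hw
      simpa [mul_assoc] using this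
    | one => intro f hf hfW w hw; simpa using hfW w hw
    | mul x y _ _ hx hy =>
      intro f hf hfW w hw
      have := hx (fun x => f (x * y)) (hL.right_pow y hf) (fun w hw => hy f hf hfW w hw) w hw
      simpa [mul_assoc] using this
  obtain ⟨w, hw⟩ := hW
  exact hf₀0 (funext fun x => by simpa using hall (w⁻¹ * x) f₀ hf₀ hf₀W w hw)

theorem choose_gt_aux (C d s a : ℕ) (hs : 1 ≤ s) (ha : (d + 1).factorial * C * s ^ d < a + 1) :
    C * (a * s + 1) ^ d < (a + (d + 1)).choose (d + 1) := by
  have h1 : (a + 1) ^ (d + 1) ≤ (d + 1).factorial * (a + (d + 1)).choose (d + 1) := by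
    rw [← Nat.ascFactorial_eq_factorial_mul_choose]
    exact Nat.pow_succ_le_ascFactorial _ _
  have h2 : (a * s + 1) ^ d ≤ s ^ d * (a + 1) ^ d := by
    rw [← mul_pow]; exact Nat.pow_le_pow_left (by nlinarith) d
  have h3 : (d + 1).factorial * (C * (a * s + 1) ^ d) <
      (d + 1).factorial * (a + (d + 1)).choose (d + 1) := by
    refine lt_of_lt_of_le ?_ h1
    calc (d + 1).factorial * (C * (a * s + 1) ^ d)
        ≤ (d + 1).factorial * (C * (s ^ d * (a + 1) ^ d)) := by gcongr
      _ = (d + 1).factorial * C * s ^ d * (a + 1) ^ d := by ring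
      _ < (a + 1) * (a + 1) ^ d := Nat.mul_lt_mul_of_pos_right ha (by positivity)
      _ = _ := by ring
  exact lt_of_mul_lt_mul_left h3 (Nat.zero_le _)

/-- Products of `d + 1` copies of a generic set, interlaced with suitable short words, are
dense with respect to functions of degree at most `s`. -/
theorem exists_dense_word [Finite G] {S : Set G} (h1 : 1 ∈ S) (hS : Subgroup.closure S = ⊤)
    (hL : TransInv L κ) {C d s m D a : ℕ} (hs : 1 ≤ s) (hd : HB L C d)
    (hm : finrank K ↥(L ^ (κ * s)) ≤ m) (ha : (d + 1).factorial * C * s ^ d < a + 1)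
    (hD : (a + 1) * s ≤ D) {c : ℝ} (hc : 0 ≤ c) (hdc : (d + 1 : ℕ) * c * 2 < 1)
    (hE : Generic (res (Subtype.val : E → G) (L ^ D)) c)
    {e₁ e₂ : E} (he : Subgroup.normalClosure {(e₂ : G) * (e₁ : G)⁻¹} = ⊤) :
    ∃ g : ℕ → G, (∀ i, g i ∈ S ^ m) ∧
      ∀ f ∈ L ^ s, f ∘ word (E := E) g (d + 1) = 0 → f = 0 := by
  have hE' : Nonempty E := ⟨e₁⟩
  have key : ∀ j ≤ d + 1, ∃ g : ℕ → G, (∀ i, g i ∈ S ^ m) ∧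
      ((∀ f ∈ L ^ s, f ∘ word (E := E) g j = 0 → f = 0) ∨
        ∀ b ≤ a, (b + j).choose j ≤ finrank K (res (word (E := E) g j) (L ^ (b * s)))) := by
    intro j
    induction j with
    | zero =>
      intro _
      refine ⟨fun _ => 1, fun _ => Set.one_mem_pow h1, Or.inr fun b _ => ?_⟩
      rw [Nat.choose_zero_right, Nat.one_le_iff_ne_zero, Ne, Submodule.finrank_eq_zero]
      intro h
      have : (1 : (Fin 0 → E) → K) ∈ res (word (E := E) (fun _ => 1) 0) (L ^ (b * s)) :=
        ⟨1, one_mem_pow hL.one_le _, rfl⟩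
      rw [h, Submodule.mem_bot] at this
      exact one_ne_zero this
    | succ j ih =>
      intro hj
      obtain ⟨g, hg, h⟩ := ih (by omega)
      by_cases hdense : ∀ f ∈ L ^ s, f ∘ word (E := E) g j = 0 → f = 0
      · refine ⟨g, hg, Or.inl fun f hf hf0 => ?_⟩
        have := hdense (fun x => f (x * (g j * e₁))) (hL.right_pow _ hf) (by
          ext ω
          have := congrFun hf0 (Fin.snoc (α := fun _ => E) ω e₁)
          simpa [word_snoc] using this)
        ext x
        simpa only [inv_mul_cancel_right, Pi.zero_apply] using congrFun this (x * (g j * e₁)⁻¹)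
      have h := h.resolve_left hdense
      push Not at hdense
      obtain ⟨f₀, hf₀, hf₀W, hf₀0⟩ := hdense
      obtain ⟨γ, hγ, e₀, f, hf, hfe, w, ⟨ω, rfl⟩, e, hfw⟩ := exists_letter h1 hS hL hm he
        (Set.range (word (E := E) g j)) (Set.range_nonempty _) hf₀ hf₀0
        (by rintro _ ⟨ω, rfl⟩; exact congrFun hf₀W ω)
      set g' := Function.update g j γ with hg'
      have hw : word (E := E) g' j = word g j := word_congr fun i hi => by
        simp [hg', hi.ne]
      have hgj : g' j = γ := by simp [hg']
      refine ⟨g', fun i => ?_, Or.inr ?_⟩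
      · by_cases hi : i = j
        · subst hi; rw [hgj]; exact hγ
        · simp [hg', hi, hg]
      intro b
      induction b with
      | zero =>
        intro _
        rw [zero_add, Nat.choose_self, Nat.one_le_iff_ne_zero, Ne, Submodule.finrank_eq_zero]
        intro h
        have : (1 : (Fin (j + 1) → E) → K) ∈ res (word (E := E) g' (j + 1)) (L ^ (0 * s)) :=
          ⟨1, one_mem_pow hL.one_le _, rfl⟩
        rw [h, Submodule.mem_bot] at this
        exact one_ne_zero this
      | succ b ihb =>
        intro hb
        have h3 := finrank_growth hL g' (D := D) (j := j) (s := s) (t := b * s) hc ?_ hE e₀ hf ?_ ?_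
          ?_
        · refine le_trans ?_ (h3.trans_eq (by rw [add_mul, one_mul]))
          have h4 := ihb (by omega)
          have h5 := h (b + 1) hb
          rw [show b * s + s = (b + 1) * s by ring, hw]
          have : (b + 1 + (j + 1)).choose (j + 1) =
              (b + (j + 1)).choose (j + 1) + (b + 1 + j).choose j := by
            rw [show b + 1 + (j + 1) = (b + 1 + j) + 1 by ring, Nat.choose_succ_succ,
              show b + 1 + j = b + (j + 1) by ring]
            ring
          omega
        · have : ((j + 1 : ℕ) : ℝ) ≤ (d + 1 : ℕ) := by exact_mod_cast hj
          nlinarith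
        · intro h0
          have := congrFun h0 (Fin.snoc (α := fun _ => E) ω e)
          simp only [Function.comp_apply, word_snoc, hw, hgj] at this
          exact hfw this
        · intro ω
          rw [hw, hgj]; exact hfe _ ⟨ω, rfl⟩
        · nlinarith
  obtain ⟨g, hg, h | h⟩ := key (d + 1) le_rfl
  · exact ⟨g, hg, h⟩
  · exfalso
    have h2 := (h a le_rfl).trans ((finrank_res_le _ _).trans (hd (a * s)))
    exact absurd h2 (not_le.2 (choose_gt_aux C d s a hs ha))

end Dominance

section Frees

open Module

variable {K : Type*} [Field K] {Ω : Type*}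

/-- The `a`-th function of the sequence satisfies no nontrivial relation of degree at most `s` over
the previous ones. -/
def IsFree (u : ℕ → Ω → K) (s a : ℕ) : Prop := ∀ e c, Rel u s a e c → c e = 0

open Classical in
/-- The indices below `N` which are free at degree `s`. -/
noncomputable def frees (u : ℕ → Ω → K) (s N : ℕ) : Finset ℕ :=
  {a ∈ Finset.range N | IsFree u s a}

theorem mem_frees {u : ℕ → Ω → K} {s N a : ℕ} : a ∈ frees u s N ↔ a < N ∧ IsFree u s a := by
  simp [frees]

theorem exists_rel_of_not_mem_frees {u : ℕ → Ω → K} {s N a : ℕ} (ha : a < N)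
    (h : a ∉ frees u s N) : ∃ e c, Rel u s a e c ∧ c e ≠ 0 := by
  simpa [mem_frees, ha, IsFree] using h

theorem finrank_mul_pow_of_free [Finite Ω] (u : ℕ → Ω → K) {s s' a b : ℕ} (hs : s' ≤ s)
    (hb : b ≤ s) (hfree : IsFree u s a) :
    (s' + 1) * finrank K ↥(genLT u a ^ b) ≤ finrank K ↥(genLT u (a + 1) ^ (b + s')) := by
  let φ : (Fin (s' + 1) → ↥(genLT u a ^ b)) →ₗ[K] ↥(genLT u (a + 1) ^ (b + s')) :=
    (∑ i : Fin (s' + 1), ((LinearMap.mulLeft K (u a ^ (i : ℕ))).comp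
      ((genLT u a ^ b).subtype.comp (LinearMap.proj i)))).codRestrict _ (by
        intro q
        rw [LinearMap.sum_apply]
        refine sum_mem fun i _ => ?_
        have h1 : u a ^ (i : ℕ) ∈ genLT u (a + 1) ^ s' :=
          pow_mono_of_one_le (one_le_genLT _ _) (Nat.lt_succ_iff.1 i.2)
            (Submodule.pow_mem_pow _ (mem_genLT u (Nat.lt_succ_self a)) _)
        have h2 : (q i : Ω → K) ∈ genLT u (a + 1) ^ b :=
          pow_le_pow_left' (genLT_mono u a.le_succ) b (q i).2
        rw [add_comm b]
        exact mul_mem_pow_add h1 h2)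
  have hφ : ∀ q, (φ q : Ω → K) = ∑ i : Fin (s' + 1), u a ^ (i : ℕ) * (q i : Ω → K) := by
    intro q; simp [φ, LinearMap.sum_apply]
  have hinj : Function.Injective φ := by
    refine (injective_iff_map_eq_zero φ).2 fun q hq => ?_
    by_contra hne
    have hq : ∑ i : Fin (s' + 1), u a ^ (i : ℕ) * (q i : Ω → K) = 0 := by
      rw [← hφ, hq]; rfl
    classical
    let c : ℕ → Ω → K := fun i => if h : i < s' + 1 then (q ⟨i, h⟩ : Ω → K) else 0
    have hex : ∃ e, c e ≠ 0 := by
      by_contra! h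
      refine hne (funext fun i => Subtype.ext ?_)
      have := h i
      simp only [c, dif_pos i.2] at this
      exact this
    have hbd : ∀ i, c i ≠ 0 → i ≤ s' := by
      intro i hi
      by_contra h
      exact hi (by simp only [c]; rw [dif_neg (by omega)])
    obtain ⟨e, he⟩ := hex
    let e₁ := Nat.findGreatest (fun i => c i ≠ 0) s'
    have he₁ : c e₁ ≠ 0 := Nat.findGreatest_spec (P := fun i => c i ≠ 0) (hbd e he) he
    have he₁s : e₁ ≤ s' := Nat.findGreatest_le _
    have hsum : ∑ i ∈ Finset.range (e₁ + 1), c i * u a ^ i = 0 := by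
      have h1 : ∑ i : Fin (s' + 1), u a ^ (i : ℕ) * (q i : Ω → K) =
          ∑ i ∈ Finset.range (s' + 1), c i * u a ^ i := by
        rw [← Fin.sum_univ_eq_sum_range (fun i => c i * u a ^ i) (s' + 1)]
        refine Finset.sum_congr rfl fun i _ => ?_
        simp only [c, dif_pos i.2]
        exact mul_comm _ _
      rw [← hq, h1]
      refine Finset.sum_subset (Finset.range_mono (show e₁ + 1 ≤ s' + 1 by omega)) ?_
      intro i hi hi'
      have : c i = 0 := by
        by_contra h
        have := Nat.le_findGreatest (P := fun i => c i ≠ 0) (hbd i h) h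
        simp only [Finset.mem_range] at hi'
        omega
      rw [this, zero_mul]
    refine he₁ (hfree e₁ c ⟨?_, he₁s.trans hs, fun i => ?_, hsum⟩)
    · by_contra h
      have h0 : e₁ = 0 := by omega
      rw [h0] at hsum he₁
      exact he₁ (by simpa using hsum)
    · refine pow_mono_of_one_le (one_le_genLT _ _) hb ?_
      simp only [c]
      split_ifs
      · exact (q _).2
      · exact zero_mem _
  have := LinearMap.finrank_le_finrank_of_injective hinj
  simpa [Module.finrank_pi_fintype] using this

/-- Free indices force growth of the Hilbert function. -/
theorem pow_card_frees_le [Finite Ω] [Nonempty Ω] (u : ℕ → Ω → K) {s s' N : ℕ} (h : s' * N ≤ s)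
    (hs : s' ≤ s) : (s' + 1) ^ (frees u s N).card ≤ finrank K ↥(genLT u N ^ (s' * N)) := by
  suffices H : ∀ a ≤ N, (s' + 1) ^ (frees u s a).card ≤ finrank K ↥(genLT u a ^ (s' * a)) from
    H N le_rfl
  intro a
  induction a with
  | zero =>
    intro _
    simp only [frees, Finset.range_zero, Finset.filter_empty, Finset.card_empty, pow_zero]
    have : (1 : Ω → K) ∈ genLT u 0 ^ (s' * 0) := one_mem_pow (one_le_genLT _ _) _
    exact finrank_pos_iff_exists_ne_zero.2 ⟨⟨1, this⟩, fun h => one_ne_zero (congrArg Subtype.val h)⟩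
  | succ a ih =>
    intro ha
    by_cases hf : IsFree u s a
    · have h1 : (frees u s (a + 1)).card ≤ (frees u s a).card + 1 := by
        refine (Finset.card_le_card (t := insert a (frees u s a)) fun x hx => ?_).trans
          (Finset.card_insert_le _ _)
        rw [mem_frees] at hx
        rw [Finset.mem_insert, mem_frees]
        by_cases hxa : x = a
        · exact Or.inl hxa
        · exact Or.inr ⟨by omega, hx.2⟩
      calc (s' + 1) ^ (frees u s (a + 1)).card ≤ (s' + 1) ^ ((frees u s a).card + 1) :=
            Nat.pow_le_pow_right (Nat.succ_pos _) h1
        _ = (s' + 1) * (s' + 1) ^ (frees u s a).card := by ring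
        _ ≤ (s' + 1) * finrank K ↥(genLT u a ^ (s' * a)) :=
            Nat.mul_le_mul le_rfl (ih (by omega))
        _ ≤ _ := finrank_mul_pow_of_free u hs ((Nat.mul_le_mul le_rfl (by omega)).trans h) hf
    · have h1 : frees u s (a + 1) ⊆ frees u s a := by
        intro x hx
        rw [mem_frees] at hx ⊢
        refine ⟨lt_of_le_of_ne (by omega) ?_, hx.2⟩
        rintro rfl
        exact hf hx.2
      refine (Nat.pow_le_pow_right (Nat.succ_pos _) (Finset.card_le_card h1)).trans
        ((ih (by omega)).trans (finrank_mono' ?_))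
      exact (pow_le_pow_left' (genLT_mono u a.le_succ) _).trans
        (pow_mono_of_one_le (one_le_genLT _ _) (Nat.mul_le_mul le_rfl a.le_succ))

end Frees

section Count

theorem card_le_prod_of_fibers {E : Type*} [DecidableEq E] :
    ∀ (k : ℕ) (T : Finset (Fin k → E)) (β : Fin k → ℕ)
      (_ : ∀ ω₀ ∈ T, ∀ j, ({ω ∈ T | ∀ i < j, ω i = ω₀ i}.image fun ω => ω j).card ≤ β j),
      T.card ≤ ∏ j, β j
  | 0, T, β, _ => by
    simpa using Finset.card_le_one.2 fun a _ b _ => Subsingleton.elim a b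
  | k + 1, T, β, h => by
    rw [Fin.prod_univ_castSucc, mul_comm]
    have h1 := card_le_prod_of_fibers k (T.image fun ω => Fin.init ω) (fun j => β j.castSucc) ?_
    · refine (Finset.card_le_mul_card_image T (β (Fin.last k)) (f := fun ω => Fin.init ω)
        fun b hb => ?_).trans (Nat.mul_le_mul le_rfl h1)
      obtain ⟨ω₀, hω₀, rfl⟩ := Finset.mem_image.1 hb
      refine le_trans ?_ (h ω₀ hω₀ (Fin.last k))
      rw [← Finset.card_image_of_injOn (f := fun ω : Fin (k + 1) → E => ω (Fin.last k))]
      · refine Finset.card_le_card (Finset.image_subset_image ?_)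
        intro ω hω
        rw [Finset.mem_filter] at hω ⊢
        refine ⟨hω.1, fun i hi => ?_⟩
        induction i using Fin.lastCases with
        | last => exact absurd hi (lt_irrefl _)
        | cast i => exact congrFun hω.2 i
      · intro ω hω ω' hω' hl
        have h1 := (Finset.mem_filter.1 hω).2
        have h2 := (Finset.mem_filter.1 hω').2
        rw [← Fin.snoc_init_self ω, ← Fin.snoc_init_self ω']
        simp only at hl h1 h2
        rw [h1, h2, hl]
    · intro ω' hω' j
      obtain ⟨ω₀, hω₀, rfl⟩ := Finset.mem_image.1 hω'
      refine le_trans (Finset.card_le_card ?_) (h ω₀ hω₀ j.castSucc)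
      intro x hx
      obtain ⟨ω₁, hω₁, rfl⟩ := Finset.mem_image.1 hx
      obtain ⟨hω₁, h2⟩ := Finset.mem_filter.1 hω₁
      obtain ⟨ω, hω, rfl⟩ := Finset.mem_image.1 hω₁
      refine Finset.mem_image.2 ⟨ω, Finset.mem_filter.2 ⟨hω, fun i hi => ?_⟩, rfl⟩
      have hik : (i : ℕ) < k := lt_trans (Fin.lt_def.1 hi) j.2
      exact h2 ⟨i, hik⟩ (Fin.lt_def.2 (Fin.lt_def.1 hi))

theorem card_le_image_mul_prod {E B : Type*} [DecidableEq E] [DecidableEq B]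
    (k : ℕ) (T : Finset (Fin k → E)) (φ : (Fin k → E) → B) (β : Fin k → ℕ)
    (h : ∀ ω₀ ∈ T, ∀ j,
      ({ω ∈ T | φ ω = φ ω₀ ∧ ∀ i < j, ω i = ω₀ i}.image fun ω => ω j).card ≤ β j) :
    T.card ≤ (T.image φ).card * ∏ j, β j := by
  rw [mul_comm]
  refine Finset.card_le_mul_card_image T _ fun b _ => ?_
  refine card_le_prod_of_fibers k _ β fun ω₀ hω₀ j => ?_
  obtain ⟨hT, rfl⟩ := Finset.mem_filter.1 hω₀
  rw [Finset.filter_filter]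
  exact h ω₀ hT j

end Count

section Products

open Module

variable {K : Type*} [Field K] {Ω Ω' ι : Type*}

theorem res_mul (u : Ω' → Ω) (A B : Submodule K (Ω → K)) : res u (A * B) = res u A * res u B :=
  Submodule.map_mul _ _ _

theorem res_one (u : Ω' → Ω) : res u (1 : Submodule K (Ω → K)) = 1 :=
  Submodule.map_one _

theorem res_prod (u : Ω' → Ω) (s : Finset ι) (A : ι → Submodule K (Ω → K)) :
    res u (∏ i ∈ s, A i) = ∏ i ∈ s, res u (A i) := by
  classical
  induction s using Finset.induction_on with
  | empty => simpa using res_one u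
  | insert a s ha ih => rw [Finset.prod_insert ha, Finset.prod_insert ha, res_mul, ih]

theorem finrank_prod_le [Finite Ω] (s : Finset ι) (A : ι → Submodule K (Ω → K)) (c : ℕ)
    (h : ∀ i ∈ s, finrank K (A i) ≤ c) : finrank K ↥(∏ i ∈ s, A i) ≤ c ^ s.card := by
  classical
  induction s using Finset.induction_on with
  | empty =>
    have h1 := (HB_one : HB (1 : Submodule K (Ω → K)) 1 0) 1
    rw [pow_one, pow_zero, mul_one] at h1
    rw [Finset.prod_empty, Finset.card_empty, pow_zero]
    exact h1
  | insert a s ha ih =>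
    rw [Finset.prod_insert ha, Finset.card_insert_of_notMem ha, pow_succ']
    exact (finrank_mul_le' _ _).trans (Nat.mul_le_mul (h a (by simp))
      (ih fun i hi => h i (by simp [hi])))

theorem one_le_prod (s : Finset ι) (A : ι → Submodule K (Ω → K)) (h : ∀ i ∈ s, 1 ≤ A i) :
    1 ≤ ∏ i ∈ s, A i := by
  classical
  induction s using Finset.induction_on with
  | empty => simp
  | insert a s ha ih =>
    rw [Finset.prod_insert ha, ← mul_one 1]
    exact mul_le_mul' (h a (by simp)) (ih fun i hi => h i (by simp [hi]))

theorem le_prod_of_mem (s : Finset ι) (A : ι → Submodule K (Ω → K)) (h : ∀ i ∈ s, 1 ≤ A i)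
    {j : ι} (hj : j ∈ s) : A j ≤ ∏ i ∈ s, A i := by
  classical
  rw [← Finset.mul_prod_erase s A hj]
  calc A j = A j * 1 := (mul_one _).symm
    _ ≤ _ := mul_le_mul' le_rfl (one_le_prod _ _ fun i hi => h i (Finset.mem_of_mem_erase hi))

end Products

section LarsenPink

open Module

variable {K : Type*} [Field K] {G : Type*} [Group G]

theorem Rel.mono {Ω : Type*} {u : ℕ → Ω → K} {s s' a e : ℕ} {c : ℕ → Ω → K}
    (h : Rel u s a e c) (hs : s ≤ s') : Rel u s' a e c :=
  ⟨h.1, h.2.1.trans hs, fun i => pow_mono_of_one_le (one_le_genLT _ _) hs (h.2.2.1 i), h.2.2.2⟩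

/-- The properties of a sequence of coordinate functions on a group which are needed for the
dimensional estimates of Larsen–Pink type. -/
structure LPData (X : ℕ → G → K) (M d κ CG z σ : ℕ) : Prop where
  inv : TransInv (genLT X M) κ
  mul : ∀ f ∈ genLT X M, (fun p : G × G => f (p.1 * p.2)) ∈
    res Prod.fst (genLT X M) * res Prod.snd (genLT X M)
  hb : HB (genLT X M) CG d
  gen : ∀ E : Set G, z < Nat.card E → ∃ e₁ ∈ E, ∃ e₂ ∈ E, Subgroup.normalClosure {e₂ * e₁⁻¹} = ⊤
  free : d ≤ (frees X σ M).card

variable {X : ℕ → G → K} {M d κ CG z σ : ℕ} {E : Set G}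

/-- The product of the coordinate spaces of the letters. -/
def letters (L : Submodule K (G → K)) (E : Set G) (k : ℕ) : Submodule K ((Fin k → E) → K) :=
  ∏ i, res (fun ω : Fin k → E => (ω i : G)) L

theorem one_le_letters {L : Submodule K (G → K)} (hL : 1 ≤ L) (k : ℕ) : 1 ≤ letters L E k :=
  one_le_prod _ _ fun _ _ => one_le_res _ hL

theorem comp_word_mem {L : Submodule K (G → K)} (hL : TransInv L κ)
    (hmul : ∀ f ∈ L, (fun p : G × G => f (p.1 * p.2)) ∈ res Prod.fst L * res Prod.snd L)
    (g : ℕ → G) : ∀ (k : ℕ), ∀ f ∈ L, f ∘ word (E := E) g k ∈ letters L E k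
  | 0, f, _ => by
    rw [letters, Finset.univ_eq_empty, Finset.prod_empty]
    exact Submodule.mem_one.2 ⟨f 1, by ext ω; rfl⟩
  | k + 1, f, hf => by
    have h := comp_mem_res (u := fun ω : Fin (k + 1) → E =>
      (word g k (Fin.init ω), g k * (ω (Fin.last k) : G))) (hmul f hf)
    rw [res_mul, res_res, res_res] at h
    rw [letters, Fin.prod_univ_castSucc]
    refine SetLike.le_def.1 (mul_le_mul' ?_ ?_) h
    · have : ∏ i : Fin k, res (fun ω : Fin (k + 1) → E => (ω i.castSucc : G)) L =
          res (fun ω : Fin (k + 1) → E => (Fin.init ω : Fin k → E)) (letters L E k) := by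
        rw [letters, res_prod]
        refine Finset.prod_congr rfl fun i _ => ?_
        rw [res_res]; rfl
      rw [this]
      rintro _ ⟨f, hf, rfl⟩
      exact comp_mem_res (comp_word_mem hL hmul g k f hf)
    · rintro _ ⟨f, hf, rfl⟩
      exact comp_mem_res (hL.left (g k) f hf)

theorem res_update_letters_le {L : Submodule K (G → K)} {k : ℕ} (i : Fin k)
    (ω : Fin k → E) :
    res (fun e => Function.update ω i e) (letters L E k) ≤ res (Subtype.val : E → G) L := by
  rw [letters, res_prod, ← Finset.mul_prod_erase _ _ (Finset.mem_univ i)]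
  calc _ ≤ res (Subtype.val : E → G) L * 1 := by
        refine mul_le_mul' ?_ (Finset.prod_le_one' fun j hj => ?_)
        · rw [res_res]
          rintro _ ⟨f, hf, rfl⟩
          exact ⟨f, hf, by ext e; simp⟩
        · rw [res_res]
          rintro _ ⟨f, hf, rfl⟩
          refine Submodule.mem_one.2 ⟨f (ω j), ?_⟩
          ext e
          simp [Function.update_of_ne (Finset.ne_of_mem_erase hj)]
    _ = _ := mul_one _

theorem finrank_letters_pow_le [Finite G] {L : Submodule K (G → K)} {C m : ℕ}
    (h : HB (res (Subtype.val : E → G) L) C m) (k t : ℕ) :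
    finrank K ↥(letters L E k ^ t) ≤ (C * (t + 1) ^ m) ^ k := by
  rw [letters, ← Finset.prod_pow]
  have := finrank_prod_le Finset.univ
    (fun i => res (fun ω : Fin k → E => (ω i : G)) L ^ t) (C * (t + 1) ^ m) fun i _ => ?_
  · simpa using this
  · have h1 : res (fun ω : Fin k → E => (ω i : G)) L =
        res (fun ω : Fin k → E => ω i) (res (Subtype.val : E → G) L) := by rw [res_res]; rfl
    rw [h1]
    exact (h.res _) t

/-- The group elements whose coordinates are used: a word followed by its letters. -/
def vertex (g : ℕ → G) (k : ℕ) : ℕ → (Fin k → E) → G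
  | 0, ω => word g k ω
  | j + 1, ω => if h : j < k then ω ⟨j, h⟩ else 1

/-- The coordinates of a word followed by those of its letters. -/
def wordSeq (X : ℕ → G → K) (M : ℕ) (g : ℕ → G) (k : ℕ) (b : ℕ) (ω : Fin k → E) : K :=
  X (b % M) (vertex g k (b / M) ω)

theorem wordSeq_add (g : ℕ → G) (k j : ℕ) {a : ℕ} (ha : a < M) :
    wordSeq (E := E) X M g k (j * M + a) = X a ∘ vertex g k j := by
  ext ω
  have hM : 0 < M := by omega
  rw [wordSeq, Nat.mul_add_mod_of_lt ha, Nat.div_eq_of_lt_le (by omega : j * M ≤ j * M + a)]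
  · rfl
  · rw [Nat.succ_mul]; omega

theorem genLT_wordSeq_le (h : LPData X M d κ CG z σ) (g : ℕ → G) (k : ℕ) :
    genLT (wordSeq (E := E) X M g k) ((k + 1) * M) ≤ letters (genLT X M) E k := by
  have h1 := h.inv.one_le
  refine gen_le (one_le_letters h1 k) ?_
  rintro _ ⟨b, hbM, rfl⟩
  have hM : M ≠ 0 := by rintro rfl; simp at hbM
  have hb : b % M < M := Nat.mod_lt _ (by omega)
  have hb' := wordSeq_add (E := E) (X := X) g k (b / M) hb
  rw [Nat.div_add_mod'] at hb'
  rw [hb']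
  have hX := mem_genLT X hb
  rcases b / M with _ | j
  · exact comp_word_mem h.inv h.mul g k _ hX
  · by_cases hj : j < k
    · refine le_prod_of_mem _ _ (fun _ _ => one_le_res _ h1) (Finset.mem_univ ⟨j, hj⟩)
        ⟨_, hX, ?_⟩
      ext ω
      simp [vertex, hj]
    · refine one_le_letters h1 k (Submodule.mem_one.2 ⟨X (b % M) 1, ?_⟩)
      ext ω
      simp [vertex, hj]

end LarsenPink

section LarsenPink

open Module

variable {K : Type*} [Field K] {G : Type*} [Group G]
variable {X : ℕ → G → K} {M d κ CG z σ : ℕ} {E : Set G}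

theorem card_frees_wordSeq_le [Finite G] [Nonempty E] (h : LPData X M d κ CG z σ) {C m k s s' : ℕ}
    (g : ℕ → G) (hE : HB (res (Subtype.val : E → G) (genLT X M)) C m)
    (hs : s' * ((k + 1) * M) ≤ s) (hs1 : s' ≤ s)
    (hbig : C ^ k * ((k + 1) * M + 1) ^ (m * k) < s' + 1) :
    (frees (wordSeq (E := E) X M g k) s ((k + 1) * M)).card ≤ m * k := by
  set N := (k + 1) * M
  by_contra! hlt
  have h1 := pow_card_frees_le (wordSeq (E := E) X M g k) hs hs1
  have h2 : finrank K ↥(genLT (wordSeq (E := E) X M g k) N ^ (s' * N)) ≤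
      (C * (s' * N + 1) ^ m) ^ k :=
    (finrank_mono' (pow_le_pow_left' (genLT_wordSeq_le h g k) _)).trans
      (finrank_letters_pow_le hE k _)
  have h3 : (C * (s' * N + 1) ^ m) ^ k ≤ C ^ k * (N + 1) ^ (m * k) * (s' + 1) ^ (m * k) := by
    rw [mul_pow, ← pow_mul, mul_assoc, ← mul_pow]
    gcongr
    nlinarith
  have h4 : (s' + 1) ^ (m * k + 1) ≤ (s' + 1) ^ (frees (wordSeq (E := E) X M g k) s N).card :=
    Nat.pow_le_pow_right (Nat.succ_pos _) hlt
  have h5 : (s' + 1) ^ (m * k + 1) ≤ C ^ k * (N + 1) ^ (m * k) * (s' + 1) ^ (m * k) :=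
    h4.trans (h1.trans (h2.trans h3))
  rw [pow_succ'] at h5
  exact absurd (Nat.le_of_mul_le_mul_right h5 (pow_pos (Nat.succ_pos _) _)) (by omega)

theorem mem_frees_wordSeq {k s a : ℕ} (g : ℕ → G)
    (hg : ∀ f ∈ genLT X M ^ (2 * s), f ∘ word (E := E) g k = 0 → f = 0) (ha : a ∈ frees X s M) :
    a ∈ frees (wordSeq (E := E) X M g k) s ((k + 1) * M) := by
  obtain ⟨haM, hfree⟩ := mem_frees.1 ha
  have hu : ∀ b < M, wordSeq (E := E) X M g k b = X b ∘ word g k := by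
    intro b hb
    have := wordSeq_add (E := E) (X := X) g k 0 hb
    rw [zero_mul, zero_add] at this
    exact this
  have hgen : genLT (wordSeq (E := E) X M g k) a = res (word g k) (genLT X a) := by
    rw [res_genLT]
    unfold genLT
    congr 1
    refine Set.image_congr fun b hb => hu b (lt_trans hb haM)
  refine mem_frees.2 ⟨haM.trans_le (Nat.le_mul_of_pos_left _ (Nat.succ_pos _)), fun e c hc => ?_⟩
  obtain ⟨h1, h2, h3, h4⟩ := hc
  rw [hgen, ← res_pow] at h3
  choose C hC hCc using h3
  have hL := one_le_genLT X M
  have h5 : ∑ i ∈ Finset.range (e + 1), C i * X a ^ i = 0 := by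
    refine hg _ (sum_mem fun i hi => ?_) ?_
    · rw [two_mul]
      refine mul_mem_pow_add (pow_le_pow_left' (genLT_mono X haM.le) s (hC i)) ?_
      refine pow_mono_of_one_le hL ?_ (Submodule.pow_mem_pow _ (mem_genLT X haM) i)
      exact (Nat.lt_succ_iff.1 (Finset.mem_range.1 hi)).trans h2
    · rw [← h4]
      ext ω
      simp only [Function.comp_apply, Finset.sum_apply, Pi.mul_apply, Pi.pow_apply, hu a haM]
      refine Finset.sum_congr rfl fun i _ => ?_
      rw [← hCc]; rfl
  rw [← hCc, hfree e C ⟨h1, h2, hC, h5⟩]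
  exact map_zero (pull K (word g k))

theorem HB_fiber [Finite G] {k s : ℕ} (g : ℕ → G) (T : Set (Fin k → E)) (I : Finset ℕ)
    (hI : ∀ b < (k + 1) * M, b ∉ I → ∃ e c, Rel (wordSeq (E := E) X M g k) s b e c ∧
      ∀ ω ∈ T, c e ω ≠ 0) (ω₀ : Fin k → E) (j : Fin k) :
    HB (res (Subtype.val : ((fun ω : Fin k → E => (ω j : G)) ''
        {ω | ω ∈ T ∧ word g k ω = word g k ω₀ ∧ ∀ i < j, ω i = ω₀ i} : Set G) → G) (genLT X M))
      (((1 + s) ^ (M + 1)) ^ M) {a ∈ Finset.range M | (j + 1 : ℕ) * M + a ∈ I}.card := by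
  set Φ : Set G := (fun ω : Fin k → E => (ω j : G)) ''
    {ω | ω ∈ T ∧ word g k ω = word g k ω₀ ∧ ∀ i < j, ω i = ω₀ i} with hΦ
  choose τ hτ hτ' using fun x : Φ => x.2
  set u := wordSeq (E := E) X M g k with hu
  rw [res_genLT]
  have key := HB_of_rel (fun a => X a ∘ (Subtype.val : Φ → G)) s M
    {a ∈ Finset.range M | (j + 1 : ℕ) * M + a ∈ I} ?_
  · rw [Finset.inter_eq_left.2 (Finset.filter_subset _ _)] at key
    exact key
  intro a ha haI
  have hlast : ∀ a < M, u ((j + 1 : ℕ) * M + a) ∘ τ = X a ∘ (Subtype.val : Φ → G) := by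
    intro a ha
    rw [hu, wordSeq_add (E := E) (X := X) g k (j + 1) ha]
    ext x
    simp only [Function.comp_apply, vertex, j.2, dif_pos]
    rw [← hτ' x]
  have hb : (j + 1 : ℕ) * M + a < (k + 1) * M := by
    have : (j + 1 + 1 : ℕ) * M ≤ (k + 1) * M := Nat.mul_le_mul (by omega) le_rfl
    rw [Nat.succ_mul] at this
    omega
  obtain ⟨e, c, hc, hne⟩ := hI _ hb (by simpa [ha] using haI)
  refine ⟨e, fun i => c i ∘ τ, ?_, fun x => hne _ (hτ x).1⟩
  have hc' := hc.comp τ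
  refine ⟨hc'.1, hc'.2.1, fun i => ?_, ?_⟩
  · refine SetLike.le_def.1 (pow_le_pow_left' ?_ s) (hc'.2.2.1 i)
    refine gen_le (one_le_genLT _ _) ?_
    rintro _ ⟨b, hb, rfl⟩
    have hbM : b % M < M := Nat.mod_lt _ (by omega)
    have hdm : b / M * M + b % M = b := Nat.div_add_mod' b M
    simp only [Set.mem_ofPred_eq] at hb
    rcases lt_or_ge (b / M) (j + 1) with hlt | hge
    · refine one_le_genLT _ _ (Submodule.mem_one.2 ⟨u b ω₀, ?_⟩)
      ext x
      change X (b % M) (vertex g k (b / M) ω₀) = X (b % M) (vertex g k (b / M) (τ x))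
      congr 1
      rcases hq : b / M with _ | q
      · exact (hτ x).2.1.symm
      · have : q < k := by omega
        simp only [vertex, this, dif_pos]
        rw [(hτ x).2.2 ⟨q, this⟩ (Fin.lt_def.2 (by simp; omega))]
    · have h1 : b / M = j + 1 := by
        refine le_antisymm ?_ hge
        by_contra! h
        have : (j + 1 + 1 : ℕ) * M ≤ b / M * M := Nat.mul_le_mul h le_rfl
        rw [Nat.succ_mul] at this
        omega
      rw [h1] at hdm
      have : u b ∘ τ = X (b % M) ∘ Subtype.val := by rw [← hlast _ hbM, hdm]
      simp only [this]
      exact mem_genLT (fun a => X a ∘ (Subtype.val : Φ → G)) (by omega)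
  · have := hc'.2.2.2
    simp only [hlast a ha] at this
    exact this

theorem exists_good [Finite G] (h : LPData X M d κ CG z σ) {k s D : ℕ} (g : ℕ → G) {p : ℕ}
    (hp : 2 * (k * ((k + 1) * M)) ≤ p)  (hp0 : 0 < p) (hsD : s ≤ D)
    (hE : Generic (res (Subtype.val : E → G) (genLT X M ^ D)) (1 / p)) :
    ∃ T : Set (Fin k → E), Nat.card (Fin k → E) ≤ 2 * Nat.card T ∧
      ∀ b < (k + 1) * M, b ∉ frees (wordSeq (E := E) X M g k) s ((k + 1) * M) →
        ∃ e c, Rel (wordSeq (E := E) X M g k) s b e c ∧ ∀ ω ∈ T, c e ω ≠ 0 := by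
  classical
  set N := (k + 1) * M with hN
  set u := wordSeq (E := E) X M g k with hu
  have hrel : ∀ b : {b // b < N ∧ b ∉ frees u s N}, ∃ f : (Fin k → E) → K, f ≠ 0 ∧
      ∃ e c, Rel u s b e c ∧ c e = f := by
    intro b
    obtain ⟨e, c, h1, h2⟩ := exists_rel_of_not_mem_frees b.2.1 b.2.2
    exact ⟨_, h2, e, c, h1, rfl⟩
  choose f hf e c hc hcf using hrel
  have : Fintype {b // b < N ∧ b ∉ frees u s N} :=
    Fintype.ofInjective (fun b => (⟨b.1, b.2.1⟩ : Fin N)) fun a b h =>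
      Subtype.ext (congrArg Fin.val h)
  have hz : ∀ b, (Nat.card {ω // f b ω = 0} : ℝ) ≤ k * (1 / p) * Nat.card (Fin k → E) := by
    intro b
    refine card_zeros_pow (by positivity) hE k (f b) (fun i ω => ?_) (hf b)
    have h1 : f b ∈ letters (genLT X M) E k ^ s := by
      rw [← hcf]
      exact pow_le_pow_left' ((genLT_mono u b.2.1.le).trans (genLT_wordSeq_le h g k)) s
        ((hc b).2.2.1 _)
    have h2 := comp_mem_res (u := fun e => Function.update ω i e) h1
    rw [res_pow] at h2
    rw [res_pow]
    exact pow_mono_of_one_le (one_le_res _ h.inv.one_le) hsD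
      (pow_le_pow_left' (res_update_letters_le i ω) s h2)
  refine ⟨{ω | ∀ b, f b ω ≠ 0}, ?_, fun b hb hbI => ⟨e ⟨b, hb, hbI⟩, c ⟨b, hb, hbI⟩, hc _, ?_⟩⟩
  · have h1 : Nat.card (Fin k → E) ≤ Nat.card {ω | ∀ b, f b ω ≠ 0} +
        ∑ b, Nat.card {ω // f b ω = 0} := by
      rw [← Nat.card_sigma, ← Nat.card_sum]
      refine Nat.card_le_card_of_surjective
        (fun x : _ ⊕ _ => Sum.elim (fun x => x.1) (fun x => x.2.1) x) fun ω => ?_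
      by_cases hω : ∀ b, f b ω ≠ 0
      · exact ⟨Sum.inl ⟨ω, hω⟩, rfl⟩
      · push Not at hω
        obtain ⟨b, hb⟩ := hω
        exact ⟨Sum.inr ⟨b, ω, hb⟩, rfl⟩
    have h2 : (∑ b, Nat.card {ω // f b ω = 0} : ℝ) ≤
        N * (k * (1 / p) * Nat.card (Fin k → E)) := by
      refine (Finset.sum_le_sum fun b _ => hz b).trans ?_
      rw [Finset.sum_const, nsmul_eq_mul]
      refine mul_le_mul_of_nonneg_right ?_ (by positivity)
      have := Fintype.card_le_of_injective
        (fun b : {b // b < N ∧ b ∉ frees u s N} => (⟨b.1, b.2.1⟩ : Fin N))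
        fun a b h => Subtype.ext (congrArg Fin.val h)
      rw [Fintype.card_fin] at this
      exact_mod_cast this
    have hp' : (0 : ℝ) < p := by exact_mod_cast hp0
    have h3 : (N * (k * (1 / p) * Nat.card (Fin k → E)) : ℝ) ≤ Nat.card (Fin k → E) / 2 := by
      have h4 : (2 * (k * N) : ℝ) ≤ p := by exact_mod_cast hp
      have h5 : (N * (k * (1 / p)) : ℝ) ≤ 1 / 2 := by
        rw [mul_one_div, mul_div_assoc', div_le_div_iff₀ hp' two_pos]
        linarith
      have := mul_le_mul_of_nonneg_right h5 (Nat.cast_nonneg (α := ℝ) (Nat.card (Fin k → E)))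
      linarith
    have h6 : (Nat.card (Fin k → E) : ℝ) ≤ Nat.card {ω | ∀ b, f b ω ≠ 0} +
        ∑ b, (Nat.card {ω // f b ω = 0} : ℝ) := by exact_mod_cast h1
    have : (Nat.card (Fin k → E) : ℝ) ≤ 2 * Nat.card {ω | ∀ b, f b ω ≠ 0} := by linarith
    exact_mod_cast this
  · intro ω hω
    rw [hcf]
    exact hω _

end LarsenPink

section LarsenPink

open Module

theorem pow_le_of_fiber_bounds {k d m C B e T : ℕ} (β μ : Fin k → ℕ) (hT : e ^ k ≤ 2 * T)
    (hT' : T ≤ B * ∏ j, β j) (h1 : ∀ j, μ j < m → β j ^ d ≤ C * B ^ μ j) (h2 : ∀ j, β j ≤ e)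
    (hsum : d + ∑ j, μ j ≤ m * k) (hB : 1 ≤ B) (hC : 1 ≤ C) (he : 1 ≤ e) :
    e ^ d ≤ 2 ^ d * C ^ k * B ^ m := by
  classical
  set J : Finset (Fin k) := {j | μ j < m} with hJ
  have hcard : J.card + Jᶜ.card = k := by simp
  have hβ : ∏ j, β j ^ d ≤ C ^ J.card * B ^ (∑ j ∈ J, μ j) * (e ^ d) ^ Jᶜ.card := by
    rw [← Finset.prod_mul_prod_compl J]
    refine Nat.mul_le_mul ?_ ?_
    · refine (Finset.prod_le_prod' fun j hj => h1 j (by simpa [hJ] using hj)).trans ?_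
      rw [Finset.prod_mul_distrib, Finset.prod_const, Finset.prod_pow_eq_pow_sum]
    · exact Finset.prod_le_pow_card _ _ _ fun j _ => Nat.pow_le_pow_left (h2 j) d
  have hS : d + ∑ j ∈ J, μ j ≤ m * J.card := by
    have h3 : m * Jᶜ.card ≤ ∑ j ∈ Jᶜ, μ j := by
      rw [mul_comm, ← smul_eq_mul]
      refine Finset.card_nsmul_le_sum _ _ _ fun j hj => ?_
      simpa [hJ] using hj
    have h4 := Finset.sum_add_sum_compl J μ
    have h5 : m * k = m * J.card + m * Jᶜ.card := by rw [← mul_add, hcard]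
    omega
  have key : (e ^ d) ^ J.card * (e ^ d) ^ Jᶜ.card ≤
      (2 ^ d * C ^ J.card * B ^ (d + ∑ j ∈ J, μ j)) * (e ^ d) ^ Jᶜ.card := by
    rw [← pow_add, hcard, ← pow_mul, mul_comm d k, pow_mul]
    calc (e ^ k) ^ d ≤ (2 * (B * ∏ j, β j)) ^ d :=
          Nat.pow_le_pow_left (hT.trans (Nat.mul_le_mul le_rfl hT')) d
      _ = 2 ^ d * B ^ d * ∏ j, β j ^ d := by rw [Finset.prod_pow]; ring
      _ ≤ 2 ^ d * B ^ d * _ := Nat.mul_le_mul le_rfl hβ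
      _ = _ := by ring
  have key2 := Nat.le_of_mul_le_mul_right key (by positivity)
  rcases Nat.eq_zero_or_pos J.card with h0 | h0
  · have : d = 0 := by rw [h0] at hS; omega
    subst this
    simpa using Nat.one_le_iff_ne_zero.2 (by positivity)
  · refine le_of_pow_le_pow_left₀ h0.ne' (Nat.zero_le _) (key2.trans ?_)
    rw [mul_pow, mul_pow]
    refine Nat.mul_le_mul (Nat.mul_le_mul ?_ ?_) ?_
    · exact Nat.le_self_pow h0.ne' _
    · exact Nat.pow_le_pow_left (Nat.le_self_pow (by omega) C) _
    · rw [← pow_mul]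
      exact Nat.pow_le_pow_right hB hS

variable {K : Type*} [Field K] {G : Type*} [Group G]
variable {X : ℕ → G → K} {M d κ CG z σ : ℕ} {E : Set G}

theorem frees_anti {Ω : Type*} (u : ℕ → Ω → K) {s s' N : ℕ} (h : s ≤ s') :
    frees u s' N ⊆ frees u s N := by
  intro a ha
  rw [mem_frees] at ha ⊢
  exact ⟨ha.1, fun e c hc => ha.2 e c (hc.mono h)⟩

theorem sum_card_blocks_le (I : Finset ℕ) (k M : ℕ) :
    ∑ j ∈ Finset.range k, {a ∈ Finset.range M | j * M + a ∈ I}.card ≤ I.card := by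
  rw [← Finset.card_sigma]
  refine Finset.card_le_card_of_injOn (fun x => x.1 * M + x.2) ?_ ?_
  · intro x hx
    simp only [Finset.coe_sigma, Set.mem_sigma_iff, Finset.mem_coe, Finset.mem_filter] at hx
    exact hx.2.2
  · rintro ⟨j, a⟩ hx ⟨j', a'⟩ hx' h
    simp only [Finset.coe_sigma, Set.mem_sigma_iff, Finset.mem_coe, Finset.mem_filter,
      Finset.mem_range] at hx hx' h
    have h1 : j = j' := by
      have h1 : (j * M + a) / M = j := Nat.div_eq_of_lt_le (by omega) (by rw [Nat.succ_mul]; omega)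
      have h2 : (j' * M + a') / M = j' :=
        Nat.div_eq_of_lt_le (by omega) (by rw [Nat.succ_mul]; omega)
      rw [← h1, ← h2, h]
    subst h1
    have : a = a' := by omega
    rw [this]

theorem pow_mono_of_one_mem {S : Set G} (h1 : 1 ∈ S) {a b : ℕ} (h : a ≤ b) : S ^ a ⊆ S ^ b :=
  Set.pow_subset_pow_right h1 h

theorem card_pow_le_of_generic [Finite G] (h : LPData X M d κ CG z σ) {S : Set G} (h1 : 1 ∈ S)
    (hS : Subgroup.closure S = ⊤) {N : ℕ} (hN : 1 ≤ N) (hEN : E ⊆ S ^ N)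
    (hz : z < Nat.card E) {C m s s' a D p μ C₁ Q : ℕ}
    (hE : HB (res (Subtype.val : E → G) (genLT X M)) C m)
    (hs' : C ^ (d + 1) * ((d + 1 + 1) * M + 1) ^ (m * (d + 1)) < s' + 1)
    (hs : s' * ((d + 1 + 1) * M) ≤ s) (hss : s' ≤ s) (hs1 : 1 ≤ s) (hsσ : s ≤ σ)
    (ha : (d + 1).factorial * CG * (2 * s) ^ d < a + 1) (hD : (a + 1) * (2 * s) ≤ D)
    (hp : 2 * ((d + 1) * ((d + 1 + 1) * M)) ≤ p) (hp' : 2 * (d + 1) < p)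
    (hμ : CG * (κ * (2 * s) + 1) ^ d ≤ μ)
    (hgen : Generic (res (Subtype.val : E → G) (genLT X M ^ D)) (1 / p))
    (hC₁ : 1 ≤ C₁) (hQ : (d + 1) * (μ + 1) ≤ Q)
    (ih : ∀ Φ ⊆ E, ∀ m' < m, HB (res (Subtype.val : Φ → G) (genLT X M))
      (((1 + s) ^ (M + 1)) ^ M) m' → Nat.card Φ ^ d ≤ C₁ * Nat.card ↥(S ^ (Q * N)) ^ m') :
    Nat.card E ^ d ≤ 2 ^ d * C₁ ^ (d + 1) * Nat.card ↥(S ^ (Q * N)) ^ m := by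
  classical
  obtain ⟨e₁, he₁, e₂, he₂, hgenr⟩ := h.gen E hz
  have hp0 : 0 < p := by omega
  have hEne : Nonempty E := ⟨⟨e₁, he₁⟩⟩
  have hpR : (0 : ℝ) < p := by exact_mod_cast hp0
  obtain ⟨g, hg, hdens⟩ := exists_dense_word (e₁ := ⟨e₁, he₁⟩) (e₂ := ⟨e₂, he₂⟩) h1 hS h.inv
    (s := 2 * s) (m := μ) (by omega) h.hb ((h.hb _).trans hμ) ha hD (by positivity) (by
      rw [mul_one_div, div_mul_eq_mul_div, div_lt_one hpR]
      exact_mod_cast (by linarith : (d + 1) * 2 < p)) hgen hgenr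
  obtain ⟨T, hT, hTrel⟩ := exists_good h (k := d + 1) (s := s) g hp hp0
    ((by nlinarith : s ≤ (a + 1) * (2 * s)).trans hD) hgen
  set I := frees (wordSeq (E := E) X M g (d + 1)) s ((d + 1 + 1) * M) with hI
  have hIcard : I.card ≤ m * (d + 1) := card_frees_wordSeq_le h g hE hs hss hs'
  have hblocks := (sum_card_blocks_le I (d + 1 + 1) M).trans hIcard
  rw [Finset.sum_range_succ', add_comm, Finset.sum_range
    (fun j => {a ∈ Finset.range M | (j + 1) * M + a ∈ I}.card)] at hblocks
  have hfree : d ≤ {a ∈ Finset.range M | 0 * M + a ∈ I}.card := by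
    refine h.free.trans (Finset.card_le_card fun a ha => ?_)
    have ha := frees_anti X hsσ ha
    rw [Finset.mem_filter, Finset.mem_range, zero_mul, zero_add]
    exact ⟨(mem_frees.1 ha).1, mem_frees_wordSeq g hdens ha⟩
  have : Fintype E := Fintype.ofFinite E
  have : Fintype (Fin (d + 1) → E) := Fintype.ofFinite _
  let Tf : Finset (Fin (d + 1) → E) := T.toFinset
  have hTf : Tf.card = Nat.card T := by rw [Nat.card_eq_card_toFinset]
  have hTne : Tf.Nonempty := by
    rw [← Finset.card_pos, hTf]
    have : 0 < Nat.card (Fin (d + 1) → E) := Nat.card_pos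
    omega
  let fib : (Fin (d + 1) → E) → Fin (d + 1) → ℕ := fun ω₀ j =>
    ({ω ∈ Tf | word g (d + 1) ω = word g (d + 1) ω₀ ∧ ∀ i < j, ω i = ω₀ i}.image
      fun ω => ω j).card
  choose ω₁ hω₁ hω₁' using fun j => Finset.exists_mem_eq_sup Tf hTne (fun ω₀ => fib ω₀ j)
  refine pow_le_of_fiber_bounds (k := d + 1) (T := Nat.card T) (fun j => fib (ω₁ j) j)
    (fun j => {a ∈ Finset.range M | (j + 1 : ℕ) * M + a ∈ I}.card) ?_ ?_ ?_ ?_ ?_ ?_ hC₁ Nat.card_pos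
  · rwa [Nat.card_fun, Nat.card_eq_fintype_card (α := Fin _), Fintype.card_fin] at hT
  · rw [← hTf]
    refine (card_le_image_mul_prod (d + 1) Tf (word g (d + 1)) (fun j => fib (ω₁ j) j)
      fun ω₀ hω₀ j => ?_).trans (Nat.mul_le_mul ?_ le_rfl)
    · rw [← hω₁']
      exact Finset.le_sup (f := fun ω₀ => fib ω₀ j) hω₀
    · rw [Nat.card_coe_set_eq, ← Set.ncard_coe_finset]
      refine Set.ncard_le_ncard ?_ (Set.toFinite _)
      intro x hx
      obtain ⟨ω, -, rfl⟩ := Finset.mem_image.1 (Finset.mem_coe.1 hx)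
      refine pow_mono_of_one_mem h1 ?_ (word_mem_pow hg hEN _ ω)
      calc (d + 1) * (μ + N) ≤ (d + 1) * ((μ + 1) * N) :=
            Nat.mul_le_mul le_rfl (by nlinarith)
        _ = (d + 1) * (μ + 1) * N := by ring
        _ ≤ Q * N := Nat.mul_le_mul hQ le_rfl
  · intro j hj
    have hfib := HB_fiber g T I hTrel (ω₁ j) j
    refine le_trans (Nat.pow_le_pow_left ?_ d) (ih _ ?_ _ hj hfib)
    · rw [Nat.card_coe_set_eq]
      simp only [fib]
      rw [← Set.ncard_coe_finset, ← Set.ncard_image_of_injective _ Subtype.val_injective]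
      refine Set.ncard_le_ncard ?_ (Set.toFinite _)
      rintro _ ⟨x, hx, rfl⟩
      obtain ⟨ω, hω, rfl⟩ := Finset.mem_image.1 (Finset.mem_coe.1 hx)
      rw [Finset.mem_filter] at hω
      exact ⟨ω, ⟨by simpa [Tf] using hω.1, hω.2⟩, rfl⟩
    · rintro _ ⟨ω, -, rfl⟩
      exact (ω j).2
  · intro j
    rw [Nat.card_eq_fintype_card]
    exact Finset.card_le_univ _
  · omega
  · rw [Nat.one_le_iff_ne_zero, Nat.card_coe_set_eq]
    exact ((Set.ncard_pos (Set.toFinite _)).2 ⟨1, Set.one_mem_pow h1⟩).ne'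

end LarsenPink

universe u v

theorem larsen_pink_aux (M d κ CG z m : ℕ) : ∀ C₀ : ℕ, ∃ C σ : ℕ,
    ∀ (K : Type u) [Field K] (G : Type v) [Group G] [Finite G] (X : ℕ → G → K),
      LPData X M d κ CG z σ → ∀ S : Set G, 1 ∈ S → Subgroup.closure S = ⊤ → ∀ N, 1 ≤ N →
        ∀ A ⊆ S ^ N, ∀ m' < m, HB (res (Subtype.val : A → G) (genLT X M)) C₀ m' →
          Nat.card A ^ d ≤ C * Nat.card ↥(S ^ (C * N)) ^ m' := by
  induction m with
  | zero => exact fun _ => ⟨0, 0, fun _ _ _ _ _ _ _ _ _ _ _ _ _ _ _ h => absurd h (by omega)⟩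
  | succ m ih =>
    intro C₀
    obtain ⟨s', hs'⟩ : ∃ s', s' = C₀ ^ (d + 1) * ((d + 1 + 1) * M + 1) ^ (m * (d + 1)) := ⟨_, rfl⟩
    obtain ⟨s, hs⟩ : ∃ s, s = s' * ((d + 1 + 1) * M + 1) + 1 := ⟨_, rfl⟩
    obtain ⟨a, ha⟩ : ∃ a, a = (d + 1).factorial * CG * (2 * s) ^ d := ⟨_, rfl⟩
    obtain ⟨D, hD⟩ : ∃ D, D = (a + 1) * (2 * s) := ⟨_, rfl⟩
    obtain ⟨p, hp⟩ : ∃ p, p = 2 * ((d + 1) * ((d + 1 + 1) * M)) + 2 * (d + 1) + 1 := ⟨_, rfl⟩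
    obtain ⟨μ, hμ⟩ : ∃ μ, μ = CG * (κ * (2 * s) + 1) ^ d := ⟨_, rfl⟩
    obtain ⟨C₂, σ₂, h₂⟩ := ih (((1 + s) ^ (M + 1)) ^ M)
    obtain ⟨C₃, σ₃, h₃⟩ := ih C₀
    obtain ⟨w, hw⟩ : ∃ w, w = p ^ (C₀ * (D + 1) ^ m) := ⟨_, rfl⟩
    obtain ⟨c₁, hc₁⟩ : ∃ c₁, c₁ = w ^ d * (z ^ d + 2 ^ d * (C₂ + 1) ^ (d + 1)) := ⟨_, rfl⟩
    refine ⟨C₃ + C₂ + (d + 1) * (μ + 1) + c₁, s + σ₂ + σ₃, ?_⟩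
    intro K _ G _ _ X h S h1 hS N hN A hA m' hm' hHB
    have hmonoσ : ∀ σ', σ' ≤ s + σ₂ + σ₃ → LPData X M d κ CG z σ' := fun σ' hσ' =>
      ⟨h.inv, h.mul, h.hb, h.gen, h.free.trans (Finset.card_le_card (frees_anti X hσ'))⟩
    set Q := C₃ + C₂ + (d + 1) * (μ + 1) + c₁ with hQ
    have hcard : ∀ {Q'}, Q' ≤ Q → Nat.card ↥(S ^ (Q' * N)) ≤ Nat.card ↥(S ^ (Q * N)) := by
      intro Q' hQ'
      exact Nat.card_mono (Set.toFinite _)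
        (pow_mono_of_one_mem h1 (Nat.mul_le_mul hQ' le_rfl))
    rcases Nat.lt_or_ge m' m with hlt | hge
    · refine (h₃ K G X (hmonoσ _ (by omega)) S h1 hS N hN A hA m' hlt hHB).trans ?_
      exact Nat.mul_le_mul (by omega) (Nat.pow_le_pow_left (hcard (by omega)) _)
    obtain rfl : m' = m := by omega
    obtain ⟨E, hEA, hAE, hgen⟩ := exists_generic (genLT X M ^ D) p (by omega) A
    have hHBE : HB (res (Subtype.val : E → G) (genLT X M)) C₀ m' := by
      have := hHB.res (Set.inclusion hEA)
      rw [res_res] at this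
      exact this
    have hEd : Nat.card E ^ d ≤ (z ^ d + 2 ^ d * (C₂ + 1) ^ (d + 1)) *
        Nat.card ↥(S ^ (Q * N)) ^ m' := by
      rcases Nat.lt_or_ge z (Nat.card E) with hz | hz
      · refine (card_pow_le_of_generic (hmonoσ s (by omega)) h1 hS hN (hEA.trans hA) hz hHBE
          (s := s) (s' := s') (a := a) (D := D) (p := p) (μ := μ) (C₁ := C₂ + 1) (Q := Q)
          (by omega) ?_ ?_ (by omega) le_rfl (by omega) (by omega) (by omega) (by omega) (by omega)
          hgen (by omega) (by omega) ?_).trans (Nat.mul_le_mul (by omega) le_rfl)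
        · rw [hs]; nlinarith
        · rw [hs]; exact (Nat.le_mul_of_pos_right s' (Nat.succ_pos _)).trans (Nat.le_succ _)
        · intro Φ hΦ m'' hm'' hHB''
          refine (h₂ K G X (hmonoσ _ (by omega)) S h1 hS N hN Φ (hΦ.trans (hEA.trans hA)) m'' hm''
            hHB'').trans ?_
          exact Nat.mul_le_mul (by omega) (Nat.pow_le_pow_left (hcard (by omega)) _)
      · have h5 : 1 ≤ Nat.card ↥(S ^ (Q * N)) := by
          rw [Nat.one_le_iff_ne_zero, Nat.card_coe_set_eq]
          exact ((Set.ncard_pos (Set.toFinite _)).2 ⟨1, Set.one_mem_pow h1⟩).ne'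
        calc Nat.card E ^ d ≤ z ^ d * 1 := by rw [mul_one]; exact Nat.pow_le_pow_left hz d
          _ ≤ _ := Nat.mul_le_mul (by omega) (Nat.one_le_pow _ _ h5)
    have hAw : Nat.card A ≤ w * Nat.card E := by
      refine hAE.trans (Nat.mul_le_mul ?_ le_rfl)
      rw [hw]
      refine Nat.pow_le_pow_right (by omega) ?_
      rw [res_pow]
      exact hHB D
    calc Nat.card A ^ d ≤ (w * Nat.card E) ^ d := Nat.pow_le_pow_left hAw d
      _ = w ^ d * Nat.card E ^ d := mul_pow _ _ _
      _ ≤ w ^ d * ((z ^ d + 2 ^ d * (C₂ + 1) ^ (d + 1)) * Nat.card ↥(S ^ (Q * N)) ^ m') :=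
          Nat.mul_le_mul le_rfl hEd
      _ = c₁ * Nat.card ↥(S ^ (Q * N)) ^ m' := by rw [hc₁]; ring
      _ ≤ _ := Nat.mul_le_mul (by omega) le_rfl

/-- **Dimensional estimates of Larsen–Pink type**: a subset of `S ^ N` whose Hilbert function grows
with exponent `m` has size at most about `|S ^ (C N)| ^ (m / d)`. -/
theorem larsen_pink (M d κ CG z m C₀ : ℕ) : ∃ C σ : ℕ,
    ∀ (K : Type u) [Field K] (G : Type v) [Group G] [Finite G] (X : ℕ → G → K),
      LPData X M d κ CG z σ → ∀ S : Set G, 1 ∈ S → Subgroup.closure S = ⊤ → ∀ N, 1 ≤ N →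
        ∀ A ⊆ S ^ N, HB (res (Subtype.val : A → G) (genLT X M)) C₀ m →
          Nat.card A ^ d ≤ C * Nat.card ↥(S ^ (C * N)) ^ m := by
  obtain ⟨C, σ, h⟩ := larsen_pink_aux.{u, v} M d κ CG z (m + 1) C₀
  exact ⟨C, σ, fun K _ G _ _ X hX S h1 hS N hN A hA =>
    h K G X hX S h1 hS N hN A hA m (Nat.lt_succ_self m)⟩

section MatrixFunctions

variable {K : Type*} [Field K] {Ω : Type*} {ι : Type*} [Fintype ι] [DecidableEq ι]

theorem det_mem_pow {L : Submodule K (Ω → K)} {e : ℕ} (A : Ω → Matrix ι ι K)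
    (h : ∀ i j, (fun ω => A ω i j) ∈ L ^ e) :
    (fun ω => (A ω).det) ∈ L ^ (e * Fintype.card ι) := by
  have : (fun ω => (A ω).det) = ∑ σ : Equiv.Perm ι,
      ((Equiv.Perm.sign σ : ℤ) : K) • ∏ i, fun ω => A ω (σ i) i := by
    ext ω
    simp [Matrix.det_apply', Finset.sum_apply, Finset.prod_apply]
  rw [this]
  refine sum_mem fun σ _ => Submodule.smul_mem _ _ ?_
  rw [← Finset.card_univ]
  exact prod_mem_pow _ _ fun i _ => h _ _

theorem adjugate_mem_pow {L : Submodule K (Ω → K)} (hL : 1 ≤ L) {e : ℕ} (A : Ω → Matrix ι ι K)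
    (j : ι) (h : ∀ i, i ≠ j → ∀ k, (fun ω => A ω i k) ∈ L ^ e) (i : ι) :
    (fun ω => (A ω).adjugate i j) ∈ L ^ (e * Fintype.card ι) := by
  simp only [Matrix.adjugate_apply]
  refine det_mem_pow _ fun r k => ?_
  by_cases hr : r = j
  · subst hr
    simp only [Matrix.updateRow_self]
    exact const_mem_pow hL _ _
  · simpa only [Matrix.updateRow_ne hr] using h r hr k

theorem matrix_mul_mem_pow {L : Submodule K (Ω → K)} {e e' : ℕ}
    (A B : Ω → Matrix ι ι K) (hA : ∀ i j, (fun ω => A ω i j) ∈ L ^ e)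
    (hB : ∀ i j, (fun ω => B ω i j) ∈ L ^ e') (i j : ι) :
    (fun ω => (A ω * B ω) i j) ∈ L ^ (e + e') := by
  have : (fun ω => (A ω * B ω) i j) = ∑ k, (fun ω => A ω i k) * fun ω => B ω k j := by
    ext ω; simp [Matrix.mul_apply, Finset.sum_apply]
  rw [this]
  exact sum_mem fun k _ => mul_mem_pow_add (hA _ _) (hB _ _)

theorem matrix_const_mul_mem {Q : Submodule K (Ω → K)} (A : Matrix ι ι K)
    (B : Ω → Matrix ι ι K) (hB : ∀ i j, (fun ω => B ω i j) ∈ Q) (i j : ι) :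
    (fun ω => (A * B ω) i j) ∈ Q := by
  have : (fun ω => (A * B ω) i j) = ∑ k, A i k • fun ω => B ω k j := by
    ext ω; simp [Matrix.mul_apply, Finset.sum_apply]
  rw [this]
  exact sum_mem fun k _ => Submodule.smul_mem _ _ (hB _ _)

theorem matrix_mul_const_mem {Q : Submodule K (Ω → K)} (A : Matrix ι ι K)
    (B : Ω → Matrix ι ι K) (hB : ∀ i j, (fun ω => B ω i j) ∈ Q) (i j : ι) :
    (fun ω => (B ω * A) i j) ∈ Q := by
  have : (fun ω => (B ω * A) i j) = ∑ k, A k j • fun ω => B ω i k := by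
    ext ω; simp [Matrix.mul_apply, Finset.sum_apply, mul_comm]
  rw [this]
  exact sum_mem fun k _ => Submodule.smul_mem _ _ (hB _ _)

end MatrixFunctions

section Coordinates

variable {n : ℕ} {F : Type*} [Field F] {K : Type*} [Field K] [Algebra F K]

/-- The matrix of `g` over the extension field. -/
def bc (K : Type*) [Field K] [Algebra F K] (g : SL(n, F)) : Matrix (Fin n) (Fin n) K :=
  g.1.map (algebraMap F K)

theorem bc_mul (g h : SL(n, F)) : bc K (g * h) = bc K g * bc K h := by
  simp [bc, Matrix.map_mul]

theorem bc_one : bc K (1 : SL(n, F)) = 1 := by simp [bc]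

theorem det_bc (g : SL(n, F)) : (bc K g).det = 1 := by
  rw [bc, ← RingHom.mapMatrix_apply, ← RingHom.map_det, g.2, map_one]

theorem bc_inv (g : SL(n, F)) : bc K g⁻¹ = (bc K g).adjugate := by
  rw [bc, Matrix.SpecialLinearGroup.coe_inv, bc, ← RingHom.mapMatrix_apply, RingHom.map_adjugate]
  rfl

theorem bc_injective : Function.Injective (bc K : SL(n, F) → _) := fun _ _ h =>
  Subtype.ext (Matrix.map_injective (algebraMap F K).injective h)

/-- The matrix entries, listed row by row. -/
def coord (n : ℕ) (F K : Type*) [Field F] [Field K] [Algebra F K] (b : ℕ) (g : SL(n, F)) : K :=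
  if h : b < n * n then
    bc K g (finProdFinEquiv.symm ⟨b, h⟩).1 (finProdFinEquiv.symm ⟨b, h⟩).2 else 0

theorem coord_finProdFinEquiv (i j : Fin n) :
    coord n F K (finProdFinEquiv (i, j)) = fun g => bc K g i j := by
  ext g
  rw [coord, dif_pos (finProdFinEquiv (i, j)).2]
  simp only [Fin.eta, Equiv.symm_apply_apply]

/-- The space of affine functions of the matrix entries. -/
abbrev aff (n : ℕ) (F K : Type*) [Field F] [Field K] [Algebra F K] :
    Submodule K (SL(n, F) → K) := genLT (coord n F K) (n * n)

theorem entry_mem_aff (i j : Fin n) : (fun g => bc K g i j) ∈ aff n F K := by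
  rw [← coord_finProdFinEquiv]
  exact mem_genLT _ (finProdFinEquiv (i, j)).2

theorem one_le_aff : 1 ≤ aff n F K := one_le_genLT _ _

theorem aff_eq : aff n F K =
    gen K (Set.range fun p : Fin n × Fin n => fun g : SL(n, F) => bc K g p.1 p.2) := by
  apply le_antisymm
  · refine gen_le (one_le_gen _) ?_
    rintro _ ⟨b, hb, rfl⟩
    obtain ⟨p, hp⟩ := finProdFinEquiv.surjective ⟨b, hb⟩
    have : b = (finProdFinEquiv p : ℕ) := by rw [hp]
    rw [this, ← Prod.mk.eta (p := p), coord_finProdFinEquiv]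
    exact mem_gen ⟨p, rfl⟩
  · refine gen_le one_le_aff ?_
    rintro _ ⟨p, rfl⟩
    exact entry_mem_aff _ _

theorem aff_comp_mem {Ω : Type*} (u : Ω → SL(n, F)) {Q : Submodule K (Ω → K)} (h1 : 1 ≤ Q)
    (h : ∀ i j, (fun ω => bc K (u ω) i j) ∈ Q) {f : SL(n, F) → K} (hf : f ∈ aff n F K) :
    (fun ω => f (u ω)) ∈ Q := by
  have : aff n F K ≤ Q.comap (pull K u).toLinearMap := by
    rw [aff_eq]
    refine gen_le ?_ ?_
    · refine Submodule.one_le.2 ?_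
      have h1' : (1 : Ω → K) ∈ Q := Submodule.one_le.1 h1
      exact h1'
    · rintro _ ⟨p, rfl⟩
      exact h _ _
  exact this hf

theorem one_le_of_one_le_pow {Ω : Type*} {L : Submodule K (Ω → K)} (hL : 1 ≤ L) (e : ℕ) :
    1 ≤ L ^ e := Submodule.one_le.2 (one_mem_pow hL e)

theorem entry_mem_pow (i j : Fin n) : (fun g => bc K g i j) ∈ aff n F K ^ 1 := by
  rw [pow_one]; exact entry_mem_aff i j

theorem inv_entry_mem (i j : Fin n) : (fun g : SL(n, F) => bc K g⁻¹ i j) ∈ aff n F K ^ n := by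
  simp only [bc_inv]
  have := adjugate_mem_pow one_le_aff (fun g : SL(n, F) => bc K g) j
    (fun i _ k => entry_mem_pow i k) i
  simpa using this

theorem transInv_aff : TransInv (aff n F K) (n + 1) where
  one_le := one_le_aff
  right a f hf := by
    refine aff_comp_mem (fun x => x * a) one_le_aff (fun i j => ?_) hf
    simp only [bc_mul]
    exact matrix_mul_const_mem _ _ entry_mem_aff i j
  left a f hf := by
    refine aff_comp_mem (fun x => a * x) one_le_aff (fun i j => ?_) hf
    simp only [bc_mul]
    exact matrix_const_mul_mem _ _ entry_mem_aff i j
  conj w h f hf := by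
    refine aff_comp_mem (fun x => w * (x * h * x⁻¹)) (one_le_of_one_le_pow one_le_aff _)
      (fun i j => ?_) hf
    simp only [bc_mul]
    refine matrix_const_mul_mem _ (fun x => bc K x * bc K h * bc K x⁻¹) (fun i j => ?_) i j
    rw [add_comm n 1]
    refine matrix_mul_mem_pow (fun x => bc K x * bc K h) (fun x => bc K x⁻¹) (fun i j => ?_)
      inv_entry_mem i j
    exact matrix_mul_const_mem _ _ entry_mem_pow i j

theorem aff_mul_mem {f : SL(n, F) → K} (hf : f ∈ aff n F K) :
    (fun p : SL(n, F) × SL(n, F) => f (p.1 * p.2)) ∈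
      res Prod.fst (aff n F K) * res Prod.snd (aff n F K) := by
  refine aff_comp_mem (fun p : SL(n, F) × SL(n, F) => p.1 * p.2) ?_ (fun i j => ?_) hf
  · have := mul_le_mul' (one_le_res Prod.fst (one_le_aff (n := n) (F := F) (K := K)))
      (one_le_res Prod.snd (one_le_aff (n := n) (F := F) (K := K)))
    simpa using this
  · simp only [bc_mul]
    have : (fun p : SL(n, F) × SL(n, F) => (bc K p.1 * bc K p.2) i j) =
        ∑ k, (fun p : SL(n, F) × SL(n, F) => bc K p.1 i k) *
          (fun p : SL(n, F) × SL(n, F) => bc K p.2 k j) := by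
      ext p; simp [Matrix.mul_apply, Finset.sum_apply]
    rw [this]
    refine sum_mem fun k _ => Submodule.mul_mem_mul ?_ ?_
    · exact comp_mem_res (u := Prod.fst) (entry_mem_aff i k)
    · exact comp_mem_res (u := Prod.snd) (entry_mem_aff k j)

theorem HB_aff [Finite F] (hn : 0 < n) :
    HB (aff n F K) (n * (1 + (n + 1)) ^ (n * n - 1)) (n * n - 1) := by
  classical
  let i0 : Fin n := ⟨0, hn⟩
  let P : Fin n → Set SL(n, F) := fun j => {g | (bc K g).adjugate j i0 ≠ 0}
  have hsum : ∀ g : SL(n, F), ∑ j, bc K g i0 j * (bc K g).adjugate j i0 = 1 := by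
    intro g
    have := congrFun (congrFun (Matrix.mul_adjugate (bc K g)) i0) i0
    rw [det_bc, one_smul, Matrix.one_apply_eq, Matrix.mul_apply] at this
    exact this
  have hP : ∀ g, ∃ j, g ∈ P j := by
    intro g
    by_contra hcon
    push Not at hcon
    have h0 : ∀ j, (bc K g).adjugate j i0 = 0 := fun j => by
      by_contra h; exact hcon j h
    have := hsum g
    simp [h0] at this
  have key := HB.of_cover (L := aff n F K) (C := (1 + (n + 1)) ^ (n * n - 1)) (m := n * n - 1)
    P hP ?_
  · simpa using key
  intro j
  let u : Fin n × Fin n → P j → K := fun p g => bc K g.1 p.1 p.2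
  let s : Finset (Fin n × Fin n) := Finset.univ.erase (i0, j)
  have hs : s.card = n * n - 1 := by simp [s]
  let L' := gen K (u '' s)
  have h1 : 1 ≤ L' := one_le_gen _
  have hL' : HB L' 1 (n * n - 1) := hs ▸ HB_gen_image u s
  have hu : ∀ p, p ≠ (i0, j) → u p ∈ L' := fun p hp => mem_gen ⟨p, by simp [s, hp], rfl⟩
  have hadj : ∀ k, (fun g : P j => (bc K g.1).adjugate k i0) ∈ L' ^ n := by
    intro k
    have := adjugate_mem_pow h1 (e := 1) (fun g : P j => bc K g.1) i0
      (fun i hi k => by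
        rw [pow_one]; exact hu (i, k) (by intro h; exact hi (congrArg Prod.fst h))) k
    simpa using this
  let c : ℕ → P j → K := fun i => if i = 0 then
    (∑ k ∈ Finset.univ.erase j, u (i0, k) * fun g : P j => (bc K g.1).adjugate k i0) - 1
    else if i = 1 then fun g : P j => (bc K g.1).adjugate j i0 else 0
  have hfin := HB.adjoin_algebraic (L := res (Subtype.val : P j → SL(n, F)) (aff n F K)) (L' := L')
    (u := u (i0, j)) (e := 1) (s := n + 1) hL' h1 ?_ c ?_ ?_ ?_
  · simpa using hfin
  · rw [aff_eq, res_gen]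
    refine le_trans (gen_mono ?_) (gen_insert_le _ _)
    rintro _ ⟨_, ⟨p, rfl⟩, rfl⟩
    by_cases hp : p = (i0, j)
    · left; rw [hp]; rfl
    · right; exact ⟨p, by simp [s, hp], rfl⟩
  · intro i
    simp only [c]
    split_ifs with h0 h1'
    · refine sub_mem (sum_mem fun k hk => ?_) (one_mem_pow h1 _)
      rw [add_comm n 1]
      refine mul_mem_pow_add ?_ (hadj k)
      rw [pow_one]
      refine hu _ ?_
      intro h
      exact (Finset.mem_erase.1 hk).1 (congrArg Prod.snd h)
    · exact pow_mono_of_one_le h1 (Nat.le_succ n) (hadj j)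
    · exact zero_mem _
  · ext g
    have := hsum g.1
    rw [← Finset.add_sum_erase _ _ (Finset.mem_univ j)] at this
    simp only [Finset.sum_range_succ, Finset.range_zero, Finset.sum_empty, c, if_true, u,
      one_ne_zero, if_false, Pi.mul_apply, Pi.sub_apply, Finset.sum_apply,
      Pi.one_apply, pow_zero, pow_one, zero_add, mul_one, Pi.zero_apply]
    linear_combination this
  · intro g
    have hg : (bc K g.1).adjugate j i0 ≠ 0 := g.2
    simpa [c] using hg

end Coordinates

section BoundedGeneration

open Matrix.SpecialLinearGroup

variable {n : ℕ} {F : Type*} [Field F]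

/-- The set of elementary transvections, together with the identity. -/
def elems (n : ℕ) (F : Type*) [Field F] : Set SL(n, F) :=
  insert 1 {g | ∃ (i j : Fin n) (h : i ≠ j) (b : F), g = transvection h b}

theorem transvection_mem_elems {i j : Fin n} (h : i ≠ j) (b : F) :
    transvection h b ∈ elems n F := Or.inr ⟨i, j, h, b, rfl⟩

theorem transvection_mul_entry {i j : Fin n} (h : i ≠ j) (b : F) (g : SL(n, F)) (r k : Fin n) :
    (transvection h b * g).1 r k = g.1 r k + if r = i then b * g.1 j k else 0 := by
  rw [coe_mul]
  change (Matrix.transvection i j b * g.1) r k = _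
  split_ifs with hr
  · subst hr; rw [Matrix.transvection_mul_apply_same]
  · rw [Matrix.transvection_mul_apply_of_ne _ _ _ _ hr, add_zero]

/-- The first `k` columns of `g` are those of the identity. -/
def StdCols (k : ℕ) (g : SL(n, F)) : Prop :=
  ∀ j : Fin n, j.1 < k → ∀ i, g.1 i j = if i = j then 1 else 0

theorem StdCols.transvection_mul {k : ℕ} {g : SL(n, F)} (hg : StdCols k g) {a b : Fin n}
    (h : a ≠ b) (hb : k ≤ b.1) (c : F) : StdCols k (transvection h c * g) := by
  intro j hj i
  have hbj : b ≠ j := by rintro rfl; omega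
  rw [transvection_mul_entry, hg j hj i, hg j hj b, if_neg hbj]
  simp

theorem StdCols.exists_ne_zero {k : Fin n} {g : SL(n, F)} (hg : StdCols k.1 g) :
    ∃ i, k ≤ i ∧ g.1 i k ≠ 0 := by
  by_contra hcon
  push Not at hcon
  let x : Fin n → F := fun j => if j < k then - g.1 j k else if j = k then 1 else 0
  have hx : g.1.mulVec x = 0 := by
    ext i
    have hterm : ∀ j, g.1 i j * x j =
        (if j = i then (if i < k then - g.1 i k else 0) else 0) +
          if j = k then g.1 i k else 0 := by
      intro j
      simp only [x]
      by_cases hj : j < k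
      · rw [if_pos hj, hg j hj i, if_neg hj.ne]
        by_cases hij : j = i
        · subst hij; simp [hj]
        · simp [hij, Ne.symm hij]
      · rw [if_neg hj]
        have h1 : (if j = i then (if i < k then - g.1 i k else 0) else 0) = 0 := by
          split_ifs with h1 h2
          · exact absurd (h1 ▸ h2) hj
          · rfl
          · rfl
        rw [h1]
        split_ifs with h2
        · subst h2; simp
        · simp
    simp only [Matrix.mulVec, dotProduct, hterm, Finset.sum_add_distrib, Finset.sum_ite_eq',
      Finset.mem_univ, if_true, Pi.zero_apply]
    split_ifs with hi
    · ring
    · rw [hcon i (not_lt.1 hi)]; ring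
  have := Matrix.eq_zero_of_mulVec_eq_zero (by rw [g.2]; exact one_ne_zero) hx
  have := congrFun this k
  simp [x] at this

theorem StdCols.last_eq_one {k : Fin n} {g : SL(n, F)} (hg : StdCols k.1 g) (hk : k.1 + 1 = n) :
    g.1 k k = 1 := by
  have htri : g.1.BlockTriangular id := by
    intro i j hij
    have hij' : j.1 < i.1 := hij
    have : j.1 < k.1 := by omega
    rw [hg j this i, if_neg]
    rintro rfl; omega
  have hdet := Matrix.det_of_isUpperTriangular htri
  rw [g.2, Finset.prod_eq_single k] at hdet
  · exact hdet.symm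
  · intro j _ hj
    have : j.1 < k.1 := by
      have : j.1 ≠ k.1 := fun h => hj (Fin.ext h)
      omega
    rw [hg j this j, if_pos rfl]
  · simp

theorem one_mem_elems : (1 : SL(n, F)) ∈ elems n F := Or.inl rfl

theorem StdCols.exists_pivot {k : Fin n} {g : SL(n, F)} (hg : StdCols k.1 g) :
    ∃ w ∈ elems n F ^ 2, StdCols k.1 (w * g) ∧ (w * g).1 k k = 1 := by
  by_cases hk : k.1 + 1 = n
  · exact ⟨1, Set.one_mem_pow one_mem_elems, by rwa [one_mul],
      by rw [one_mul]; exact hg.last_eq_one hk⟩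
  have key : ∀ h : SL(n, F), StdCols k.1 h → ∀ i, k < i → h.1 i k ≠ 0 →
      ∃ w ∈ elems n F, StdCols k.1 (w * h) ∧ (w * h).1 k k = 1 := by
    intro h hh i hi h0
    refine ⟨transvection hi.ne ((1 - h.1 k k) / h.1 i k), transvection_mem_elems _ _,
      hh.transvection_mul _ (le_of_lt hi) _, ?_⟩
    rw [transvection_mul_entry, if_pos rfl, div_mul_cancel₀ _ h0]
    ring
  by_cases hex : ∃ i, k < i ∧ g.1 i k ≠ 0
  · obtain ⟨i, hi, h0⟩ := hex
    obtain ⟨w, hw, h1, h2⟩ := key g hg i hi h0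
    refine ⟨w, ?_, h1, h2⟩
    rw [pow_two]
    exact ⟨w, hw, 1, one_mem_elems, mul_one w⟩
  · push Not at hex
    obtain ⟨i, hi, h0⟩ := hg.exists_ne_zero
    have hik : i = k := by
      by_contra hne
      exact h0 (hex i (lt_of_le_of_ne hi (Ne.symm hne)))
    subst hik
    let l : Fin n := ⟨i.1 + 1, by omega⟩
    have hl : i < l := Nat.lt_succ_self _
    obtain ⟨w, hw, h1, h2⟩ := key (transvection hl.ne' 1 * g)
      (hg.transvection_mul hl.ne' le_rfl 1) l hl (by
        rw [transvection_mul_entry, if_pos rfl, hex l hl]; simpa using h0)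
    refine ⟨w * transvection hl.ne' 1, ?_, by rwa [mul_assoc], by rwa [mul_assoc]⟩
    rw [pow_two]
    exact ⟨w, hw, _, transvection_mem_elems _ _, rfl⟩

theorem StdCols.exists_clear {k : Fin n} {g : SL(n, F)} (hg : StdCols k.1 g)
    (h1 : g.1 k k = 1) (s : Finset (Fin n)) :
    ∃ w ∈ elems n F ^ s.card, StdCols k.1 (w * g) ∧ (w * g).1 k k = 1 ∧
      ∀ i ∈ s, i ≠ k → (w * g).1 i k = 0 := by
  classical
  induction s using Finset.induction_on with
  | empty => exact ⟨1, by simp, by rwa [one_mul], by rwa [one_mul], by simp⟩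
  | insert a s ha ih =>
    obtain ⟨w, hw, hs, hk, hz⟩ := ih
    rw [Finset.card_insert_of_notMem ha, pow_succ']
    by_cases hak : a = k
    · refine ⟨w, ⟨1, one_mem_elems, w, hw, one_mul w⟩, hs, hk, fun i hi hik => ?_⟩
      rcases Finset.mem_insert.1 hi with rfl | hi
      · exact absurd hak hik
      · exact hz i hi hik
    · refine ⟨transvection hak (-(w * g).1 a k) * w, ⟨_, transvection_mem_elems _ _, w, hw, rfl⟩,
        ?_, ?_, fun i hi hik => ?_⟩
      · rw [mul_assoc]; exact hs.transvection_mul hak le_rfl _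
      · rw [mul_assoc, transvection_mul_entry, if_neg (Ne.symm hak), add_zero, hk]
      · rw [mul_assoc, transvection_mul_entry]
        rcases Finset.mem_insert.1 hi with rfl | hi
        · rw [if_pos rfl, hk]; ring
        · rw [if_neg (fun h : i = a => ha (h ▸ hi)), add_zero, hz i hi hik]

theorem exists_stdCols (g : SL(n, F)) (k : ℕ) (hk : k ≤ n) :
    ∃ w ∈ elems n F ^ ((n + 2) * k), StdCols k (w * g) := by
  induction k with
  | zero => exact ⟨1, by simp, fun j hj => absurd hj (Nat.not_lt_zero _)⟩
  | succ k ih =>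
    obtain ⟨w, hw, hs⟩ := ih (by omega)
    let κ : Fin n := ⟨k, hk⟩
    obtain ⟨w₁, hw₁, hs₁, hk₁⟩ := StdCols.exists_pivot (k := κ) hs
    obtain ⟨w₂, hw₂, hs₂, hk₂, hz⟩ := hs₁.exists_clear hk₁ Finset.univ
    rw [Finset.card_univ, Fintype.card_fin] at hw₂
    refine ⟨w₂ * (w₁ * w), ?_, ?_⟩
    · rw [show (n + 2) * (k + 1) = n + (2 + (n + 2) * k) by ring, pow_add, pow_add]
      exact ⟨w₂, hw₂, _, ⟨w₁, hw₁, w, hw, rfl⟩, rfl⟩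
    · rw [mul_assoc, mul_assoc]
      intro j hj i
      rcases Nat.lt_succ_iff_lt_or_eq.1 hj with h | h
      · exact hs₂ j h i
      · have : j = κ := Fin.ext h
        subst this
        split_ifs with hi
        · rw [hi]; exact hk₂
        · exact hz i (Finset.mem_univ _) hi

theorem elems_pow_eq_univ : elems n F ^ ((n + 2) * n) = Set.univ := by
  refine Set.eq_univ_of_forall fun g => ?_
  obtain ⟨w, hw, hs⟩ := exists_stdCols g⁻¹ n le_rfl
  have : w * g⁻¹ = 1 := by
    ext i j
    rw [hs j j.2 i, coe_one, Matrix.one_apply]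
  rwa [← mul_inv_eq_one.1 this]

theorem closure_elems : Subgroup.closure (elems n F) = ⊤ := by
  rw [eq_top_iff]
  intro g _
  have hg : g ∈ elems n F ^ ((n + 2) * n) := by rw [elems_pow_eq_univ]; trivial
  have key : ∀ k : ℕ, elems n F ^ k ⊆ Subgroup.closure (elems n F) := by
    intro k
    induction k with
    | zero => simp
    | succ k ih =>
      rw [pow_succ]
      rintro _ ⟨x, hx, y, hy, rfl⟩
      exact mul_mem (ih hx) (Subgroup.subset_closure hy)
  exact key _ hg

end BoundedGeneration

section NormalClosure

open Matrix.SpecialLinearGroup LinearAlgebra.Projectivization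
open scoped LinearAlgebra.Projectivization commutatorElement

variable {n : ℕ} {F : Type*} [Field F]

theorem diag2n_mul_transvection {i j : Fin n} (hij : i ≠ j) (a : F) (ha : a ≠ 0) (c : F) :
    diag2n hij a ha * transvection hij c * (diag2n hij a ha)⁻¹ = transvection hij (a ^ 2 * c) := by
  rw [mul_inv_eq_iff_eq_mul]
  ext r k
  rw [coe_mul, coe_mul, diag2n_coe, transvection_coe, transvection_coe, Matrix.diagonal_mul,
    Matrix.mul_diagonal]
  simp only [Matrix.add_apply, Matrix.single_apply, Matrix.one_apply]
  by_cases h1 : i = r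
  · subst h1
    by_cases h2 : j = k
    · subst h2
      simp [hij, hij.symm]
      field_simp
    · by_cases h3 : i = k
      · subst h3; simp [h2]
      · simp [h2, h3]
  · by_cases h3 : r = k
    · subst h3; simp [h1, mul_comm]
    · simp [h1, h3]

theorem commutator_eq_top {a : F} (ha : a ≠ 0) (ha2 : a ^ 2 ≠ 1) :
    commutator SL(n, F) = ⊤ := by
  rw [eq_top_iff, ← closure_elems, Subgroup.closure_le]
  rintro g (rfl | ⟨i, j, hij, b, rfl⟩)
  · exact one_mem _
  have hb : a ^ 2 - 1 ≠ 0 := sub_ne_zero.2 ha2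
  have : transvection hij b = ⁅diag2n hij a ha, transvection hij (b / (a ^ 2 - 1))⁆ := by
    rw [commutatorElement_def, diag2n_mul_transvection, transvection_inv, ← transvection_add]
    congr 1
    field_simp
    ring
  rw [this]
  exact Subgroup.commutator_mem_commutator (Subgroup.mem_top _) (Subgroup.mem_top _)

/-- The Iwasawa structure for the action of `SL(n, F)` on projective space. -/
noncomputable def iwasawa (n : ℕ) (F : Type*) [Field F] :
    MulAction.IwasawaStructure SL(n, F) (ℙ F (Fin n → F)) where
  T p := lineStab p.submodule
  is_comm p := by
    rw [← Projectivization.mk_rep p, Projectivization.submodule_mk]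
    exact lineStab_isMulCommutative_of_span p.rep p.rep_nonzero
  is_conj g p := by
    rw [PSL.smul_submodule, lineStab_smul]
  is_generator := by
    rw [eq_top_iff, ← closure_elems, Subgroup.closure_le]
    rintro g (rfl | ⟨i, j, hij, b, rfl⟩)
    · exact one_mem _
    have h0 : (Pi.single i 1 : Fin n → F) ≠ 0 := Pi.single_ne_zero_iff.2 one_ne_zero
    refine Subgroup.mem_iSup_of_mem (Projectivization.mk F _ h0) ?_
    rw [Projectivization.submodule_mk]
    exact SL2Gen.transvection_mem_lineStab hij b

theorem normalClosure_eq_top {a : F} (ha : a ≠ 0) (ha2 : a ^ 2 ≠ 1) {g : SL(n, F)}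
    (hg : g ∉ Subgroup.center SL(n, F)) : Subgroup.normalClosure {g} = ⊤ := by
  rw [eq_top_iff, ← commutator_eq_top ha ha2]
  refine (iwasawa n F).commutator_le (Subgroup.normalClosure {g}) fun h => hg ?_
  rw [← Projectivization.SL_mulAction_ker, MonoidHom.mem_ker]
  ext p : 1
  have : p ∈ MulAction.fixedPoints (Subgroup.normalClosure {g}) (ℙ F (Fin n → F)) := by
    rw [h]; trivial
  exact this ⟨g, Subgroup.subset_normalClosure rfl⟩

theorem card_center_le [Finite F] (hn : 0 < n) : Nat.card (Subgroup.center SL(n, F)) ≤ n := by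
  have : NeZero n := ⟨hn.ne'⟩
  have : NeZero (Fintype.card (Fin n)) := ⟨by simpa using hn.ne'⟩
  rw [Nat.card_congr (center_equiv_rootsOfUnity (n := Fin n) (R := F)).toEquiv,
    max_eq_left (by simpa using Nat.succ_le_of_lt hn)]
  simpa using card_rootsOfUnity F (Fintype.card (Fin n))

theorem exists_pair_normalClosure [Finite F] (hn : 0 < n) (hq : 4 ≤ Nat.card F) (E : Set SL(n, F))
    (hE : n < Nat.card E) : ∃ e₁ ∈ E, ∃ e₂ ∈ E, Subgroup.normalClosure {e₂ * e₁⁻¹} = ⊤ := by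
  obtain ⟨a, ha, ha2⟩ : ∃ a : F, a ≠ 0 ∧ a ^ 2 ≠ 1 := by
    obtain ⟨x, hx⟩ : IsCyclic Fˣ := inferInstance
    refine ⟨x, Units.ne_zero x, fun h ↦ ?_⟩
    have h1 := Nat.card_eq_card_units_add_one F
    have h2 := orderOf_eq_card_of_forall_mem_zpowers hx
    have h3 := orderOf_le_of_pow_eq_one zero_lt_two (Units.ext <| by simpa using h : x ^ 2 = 1)
    omega
  have hne : E.Nonempty := by
    by_contra h
    rw [Set.not_nonempty_iff_eq_empty] at h
    subst h; simp at hE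
  obtain ⟨e₁, h₁⟩ := hne
  by_contra hcon
  push Not at hcon
  have hc : ∀ e₂ ∈ E, e₂ * e₁⁻¹ ∈ Subgroup.center SL(n, F) := by
    intro e₂ h₂
    by_contra h
    exact hcon e₁ h₁ e₂ h₂ (normalClosure_eq_top ha ha2 h)
  have : Nat.card E ≤ Nat.card (Subgroup.center SL(n, F)) :=
    Nat.card_le_card_of_injective (fun e : E => ⟨e * e₁⁻¹, hc e e.2⟩) fun x y h => by
      have := congrArg Subtype.val h
      exact Subtype.ext (mul_right_cancel this)
  have := card_center_le (F := F) hn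
  omega

end NormalClosure

section OneVariable

variable {F : Type*} [Field F] {K : Type*} [Field K] [Algebra F K]

/-- Affine functions of one variable in `F`. -/
def aff₁ (F K : Type*) [Field F] [Field K] [Algebra F K] : Submodule K (F → K) :=
  gen K {fun z => algebraMap F K z}

theorem one_le_aff₁ : 1 ≤ aff₁ F K := one_le_gen _

theorem id_mem_aff₁ : (fun z : F => algebraMap F K z) ∈ aff₁ F K := mem_gen rfl

theorem const_mem_aff₁ (x : K) : (fun _ : F => x) ∈ aff₁ F K := by
  have := const_mem_pow (one_le_aff₁ (F := F) (K := K)) 1 x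
  rwa [pow_one] at this

theorem exists_polynomial_of_mem_aff₁_pow {D : ℕ} {f : F → K} (hf : f ∈ aff₁ F K ^ D) :
    ∃ p : Polynomial K, p.natDegree ≤ D ∧ ∀ z, f z = p.eval (algebraMap F K z) := by
  induction D generalizing f with
  | zero =>
    rw [pow_zero] at hf
    obtain ⟨x, rfl⟩ := Submodule.mem_one.1 hf
    exact ⟨Polynomial.C x, by simp, by simp⟩
  | succ D ih =>
    rw [pow_succ] at hf
    refine Submodule.mul_induction_on hf ?_ ?_
    · intro g hg h hh
      obtain ⟨p, hp, hpe⟩ := ih hg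
      have hle : aff₁ F K ≤ 1 ⊔ Submodule.span K {fun z : F => algebraMap F K z} :=
        gen_le le_sup_left fun f hf => Submodule.mem_sup_right (Submodule.subset_span hf)
      obtain ⟨y, hy, w, hw, rfl⟩ := Submodule.mem_sup.1 (hle hh)
      obtain ⟨a, rfl⟩ := Submodule.mem_one.1 hy
      obtain ⟨b, rfl⟩ := Submodule.mem_span_singleton.1 hw
      refine ⟨p * (Polynomial.C a + Polynomial.C b * Polynomial.X), ?_, fun z => ?_⟩
      · refine Polynomial.natDegree_mul_le.trans (add_le_add hp ?_)
        refine (Polynomial.natDegree_add_le _ _).trans (max_le (by simp) ?_)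
        exact (Polynomial.natDegree_C_mul_le b _).trans Polynomial.natDegree_X_le
      · simp [hpe]
    · rintro g h ⟨p, hp, hpe⟩ ⟨r, hr, hre⟩
      exact ⟨p + r, (Polynomial.natDegree_add_le _ _).trans (max_le hp hr), fun z => by
        simp [hpe, hre]⟩

theorem card_roots_le [Finite F] {p : Polynomial K} (hp : p ≠ 0) {D : ℕ} (hD : p.natDegree ≤ D)
    (x : K) (s : Set F) (hs : ∀ z ∈ s, p.eval (x + algebraMap F K z) = 0) : Nat.card s ≤ D := by
  classical
  have h1 : Nat.card s ≤ Nat.card {y // y ∈ p.roots.toFinset} :=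
    Nat.card_le_card_of_injective (fun z : s => ⟨x + algebraMap F K z, by
      simpa [hp] using hs z z.2⟩) fun z w h => by
        have := congrArg Subtype.val h
        exact Subtype.ext ((algebraMap F K).injective (add_left_cancel this))
  have h2 : Nat.card {y // y ∈ p.roots.toFinset} = p.roots.toFinset.card := by
    rw [Nat.card_eq_fintype_card, Fintype.card_coe]
  rw [h2] at h1
  exact h1.trans ((Multiset.toFinset_card_le _).trans ((p.card_roots').trans hD))

theorem card_zeros_aff₁ [Finite F] {D : ℕ} {f : F → K} (hf : f ∈ aff₁ F K ^ D) (h0 : f ≠ 0) :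
    Nat.card {z // f z = 0} ≤ D := by
  obtain ⟨p, hp, hpe⟩ := exists_polynomial_of_mem_aff₁_pow hf
  refine card_roots_le (p := p) ?_ hp 0 {z | f z = 0} fun z hz => ?_
  · rintro rfl; exact h0 (funext fun z => by simp [hpe])
  · rw [zero_add, ← hpe]; exact hz

theorem generic_aff₁ [Finite F] (D : ℕ) : Generic (aff₁ F K ^ D) (D / Nat.card F) := by
  intro f hf h0
  have h1 : (0 : ℝ) < Nat.card F := Nat.cast_pos.2 Nat.card_pos
  rw [div_mul_cancel₀ _ h1.ne']
  exact_mod_cast card_zeros_aff₁ hf h0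

end OneVariable

section Parametrization

open Matrix.SpecialLinearGroup

variable {n : ℕ} {F : Type*} [Field F] {K : Type*} [Field K] [Algebra F K]

/-- The elementary transvection in the position numbered `m` modulo `n * n`. -/
noncomputable def elt (n : ℕ) {F : Type*} [Field F] (m : ℕ) (b : F) : SL(n, F) :=
  if h : m % (n * n) < n * n then
    if h' : (finProdFinEquiv.symm ⟨m % (n * n), h⟩).1 ≠ (finProdFinEquiv.symm ⟨m % (n * n), h⟩).2
    then transvection h' b else 1
  else 1

theorem elt_zero (m : ℕ) : elt n m (0 : F) = 1 := by
  unfold elt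
  split_ifs <;> simp

theorem exists_elt {g : SL(n, F)} (hg : g ∈ elems n F) (hn : 0 < n) (r : ℕ) :
    ∃ a < n * n, ∃ b, g = elt n (n * n * r + a) b := by
  rcases hg with rfl | ⟨i, j, hij, b, rfl⟩
  · exact ⟨0, by positivity, 0, (elt_zero _).symm⟩
  · refine ⟨(finProdFinEquiv (i, j)).1, (finProdFinEquiv (i, j)).2, b, ?_⟩
    have h1 : (n * n * r + (finProdFinEquiv (i, j)).1) % (n * n) = (finProdFinEquiv (i, j)).1 := by
      rw [Nat.mul_add_mod, Nat.mod_eq_of_lt (finProdFinEquiv (i, j)).2]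
    unfold elt
    simp only [h1, Fin.is_lt, dif_pos, Fin.eta, Equiv.symm_apply_apply]
    rw [dif_pos hij]

theorem elt_entry_mem (m : ℕ) (i j : Fin n) :
    (fun z : F => bc K (elt n m z) i j) ∈ aff₁ F K := by
  unfold elt
  split_ifs with h h'
  · have : ∀ z : F, bc K (transvection h' z) i j = (1 : Matrix (Fin n) (Fin n) K) i j +
        (Matrix.single (finProdFinEquiv.symm ⟨m % (n * n), h⟩).1
          (finProdFinEquiv.symm ⟨m % (n * n), h⟩).2 (1 : K) i j) * algebraMap F K z := by
      intro z
      rw [bc, transvection_coe, Matrix.map_apply, Matrix.add_apply, map_add, Matrix.single_apply,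
        Matrix.single_apply, Matrix.one_apply, Matrix.one_apply]
      split_ifs <;> simp
    simp only [this]
    exact add_mem (const_mem_aff₁ _) (Submodule.smul_mem _ _ id_mem_aff₁)
  · exact const_mem_aff₁ _
  · exact const_mem_aff₁ _

/-- The product of the first `m` transvections with the given parameters. -/
noncomputable def tword (n : ℕ) {F : Type*} [Field F] (x : ℕ → F) : ℕ → SL(n, F)
  | 0 => 1
  | m + 1 => tword n x m * elt n m (x m)

theorem tword_congr {x y : ℕ → F} : ∀ {m : ℕ}, (∀ i < m, x i = y i) → tword n x m = tword n y m
  | 0, _ => rfl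
  | m + 1, h => by
    rw [tword, tword, h m (Nat.lt_succ_self m), tword_congr fun i hi => h i (hi.trans m.lt_succ_self)]

theorem tword_add_of_eq_zero {x : ℕ → F} {m : ℕ} : ∀ {l : ℕ}, (∀ i, m ≤ i → i < m + l → x i = 0) →
    tword n x (m + l) = tword n x m
  | 0, _ => rfl
  | l + 1, h => by
    rw [← add_assoc, tword, h (m + l) (by omega) (by omega), elt_zero, mul_one,
      tword_add_of_eq_zero fun i hi hi' => h i hi (by omega)]

theorem exists_tword (hn : 0 < n) (r : ℕ) :
    ∀ g ∈ elems n F ^ r, ∃ x : ℕ → F, tword n x (n * n * r) = g := by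
  induction r with
  | zero =>
    intro g hg
    exact ⟨0, by simpa [tword, eq_comm] using hg⟩
  | succ r ih =>
    intro g hg
    rw [pow_succ] at hg
    obtain ⟨w, hw, e, he, rfl⟩ := hg
    obtain ⟨x, hx⟩ := ih w hw
    obtain ⟨a, ha, b, rfl⟩ := exists_elt he hn r
    refine ⟨fun i => if i < n * n * r then x i else if i = n * n * r + a then b else 0, ?_⟩
    have h1 : n * n * (r + 1) = (n * n * r + a + 1) + (n * n - a - 1) := by
      rw [mul_add, mul_one]; omega
    rw [h1, tword_add_of_eq_zero, tword, tword_add_of_eq_zero]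
    · rw [tword_congr (y := x) fun i hi => by simp [hi], hx]
      simp
    · intro i h2 h3
      rw [if_neg (by omega), if_neg (by omega)]
    · intro i h2 h3
      rw [if_neg (by omega), if_neg (by omega)]

theorem tword_update_entry_mem (x : ℕ → F) (k m : ℕ) (i j : Fin n) :
    (fun z : F => bc K (tword n (Function.update x k z) m) i j) ∈ aff₁ F K := by
  induction m generalizing i j with
  | zero => exact const_mem_aff₁ (F := F) (bc K (1 : SL(n, F)) i j)
  | succ m ih =>
    simp only [tword, bc_mul]
    by_cases hk : m = k
    · subst hk
      have : ∀ z, tword n (Function.update x m z) m = tword n x m := fun z =>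
        tword_congr fun i hi => Function.update_of_ne hi.ne _ _
      simp only [this, Function.update_self]
      exact matrix_const_mul_mem _ (fun z => bc K (elt n m z)) (fun i j => elt_entry_mem m i j) i j
    · simp only [Function.update_of_ne hk]
      exact matrix_mul_const_mem _ (fun z => bc K (tword n (Function.update x k z) m)) ih i j

/-- The number of parameters which suffice to write every element as a product of transvections. -/
def wlen (n : ℕ) : ℕ := n * n * ((n + 2) * n)

/-- A polynomial parametrization of `SL(n, F)`. -/
noncomputable def param (n : ℕ) {F : Type*} [Field F] (x : Fin (wlen n) → F) : SL(n, F) :=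
  tword n (fun i => if h : i < wlen n then x ⟨i, h⟩ else 0) (wlen n)

theorem param_surjective (hn : 0 < n) : Function.Surjective (param n (F := F)) := by
  intro g
  have hg : g ∈ elems n F ^ ((n + 2) * n) := by rw [elems_pow_eq_univ]; trivial
  obtain ⟨x, hx⟩ := exists_tword hn _ g hg
  refine ⟨fun i => x i, ?_⟩
  rw [← hx]
  exact tword_congr fun i hi => by
    have hi' : i < wlen n := hi
    simp [hi']

theorem param_update_mem {D : ℕ} {f : SL(n, F) → K} (hf : f ∈ aff n F K ^ D) (i : Fin (wlen n))
    (x : Fin (wlen n) → F) :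
    (fun z => f (param n (Function.update x i z))) ∈ aff₁ F K ^ D := by
  have : res (fun z => param n (Function.update x i z)) (aff n F K) ≤ aff₁ F K ^ 1 := by
    rintro _ ⟨f, hf, rfl⟩
    rw [pow_one]
    refine aff_comp_mem (fun z => param n (Function.update x i z)) one_le_aff₁ (fun r s => ?_) hf
    convert tword_update_entry_mem (K := K)
      (fun i => if h : i < wlen n then x ⟨i, h⟩ else 0) i (wlen n) r s using 4 with z
    refine congrArg (fun y => tword n y (wlen n)) ?_
    funext k
    by_cases hk : k < wlen n
    · rw [dif_pos hk]
      by_cases hki : k = i.1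
      · have : (⟨k, hk⟩ : Fin (wlen n)) = i := Fin.ext hki
        rw [this, hki, Function.update_self, Function.update_self]
      · rw [Function.update_of_ne hki, Function.update_of_ne fun h => hki (congrArg Fin.val h),
          dif_pos hk]
    · rw [dif_neg hk, Function.update_of_ne, dif_neg hk]
      intro h; exact hk (h ▸ i.2)
  have key := comp_mem_pow this hf
  rwa [one_mul] at key

theorem exists_ne_zero_pair [Finite F] (hn : 0 < n) {D : ℕ} (hq : 2 * wlen n * D < Nat.card F)
    {f₁ f₂ : SL(n, F) → K} (h₁ : f₁ ∈ aff n F K ^ D) (h₂ : f₂ ∈ aff n F K ^ D) (h₁0 : f₁ ≠ 0)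
    (h₂0 : f₂ ≠ 0) : ∃ g, f₁ g ≠ 0 ∧ f₂ g ≠ 0 := by
  have hz : ∀ f ∈ aff n F K ^ D, f ≠ 0 →
      (Nat.card {x : Fin (wlen n) → F // f (param n x) = 0} : ℝ) ≤
        wlen n * (D / Nat.card F) * Nat.card (Fin (wlen n) → F) := by
    intro f hf h0
    refine card_zeros_pow (by positivity) (generic_aff₁ (F := F) (K := K) D) (wlen n)
      (fun x => f (param n x)) (fun i ω => param_update_mem hf i ω) fun h => h0 ?_
    ext g
    obtain ⟨x, rfl⟩ := param_surjective hn g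
    exact congrFun h x
  by_contra hcon
  push Not at hcon
  have hcov : Nat.card (Fin (wlen n) → F) ≤ Nat.card {x : Fin (wlen n) → F // f₁ (param n x) = 0} +
      Nat.card {x : Fin (wlen n) → F // f₂ (param n x) = 0} := by
    rw [← Nat.card_sum]
    refine Nat.card_le_card_of_surjective (Sum.elim Subtype.val Subtype.val) fun x => ?_
    by_cases h : f₁ (param n x) = 0
    · exact ⟨Sum.inl ⟨x, h⟩, rfl⟩
    · exact ⟨Sum.inr ⟨x, hcon _ h⟩, rfl⟩
  have hcov' : (Nat.card (Fin (wlen n) → F) : ℝ) ≤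
      Nat.card {x : Fin (wlen n) → F // f₁ (param n x) = 0} +
      Nat.card {x : Fin (wlen n) → F // f₂ (param n x) = 0} := by exact_mod_cast hcov
  have hN : (0 : ℝ) < Nat.card (Fin (wlen n) → F) := Nat.cast_pos.2 Nat.card_pos
  have hF : (0 : ℝ) < Nat.card F := Nat.cast_pos.2 Nat.card_pos
  have hlt : 2 * (wlen n * ((D : ℝ) / Nat.card F)) < 1 := by
    have : (2 * wlen n * D : ℝ) < Nat.card F := by exact_mod_cast hq
    rw [← mul_div_assoc, ← mul_div_assoc, div_lt_one hF]
    linarith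
  have := hz f₁ h₁ h₁0
  have := hz f₂ h₂ h₂0
  nlinarith

end Parametrization

section Freeness

variable {n : ℕ} {F : Type*} [Field F] {K : Type*} [Field K] [Algebra F K]

theorem eq_of_mem_genLT_pow {Ω : Type*} (u : ℕ → Ω → K) {a s : ℕ} {ω ω' : Ω}
    (h : ∀ b < a, u b ω = u b ω') {f : Ω → K} (hf : f ∈ genLT u a ^ s) : f ω = f ω' := by
  have h1 : ∀ f ∈ genLT u a, f ω = f ω' := by
    have : genLT u a ≤ LinearMap.ker (LinearMap.proj (R := K) (φ := fun _ : Ω => K) ω -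
        LinearMap.proj (R := K) (φ := fun _ : Ω => K) ω') := by
      refine gen_le (Submodule.one_le.2 (by simp)) ?_
      rintro _ ⟨b, hb, rfl⟩
      simpa [sub_eq_zero] using h b hb
    intro f hf
    simpa [sub_eq_zero] using this hf
  induction s generalizing f with
  | zero =>
    rw [pow_zero] at hf
    obtain ⟨x, rfl⟩ := Submodule.mem_one.1 hf
    rfl
  | succ s ih =>
    rw [pow_succ] at hf
    refine Submodule.mul_induction_on hf (fun g hg k hk => ?_) fun g k hg hk => ?_
    · rw [Pi.mul_apply, Pi.mul_apply, ih hg, h1 k hk]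
    · rw [Pi.add_apply, Pi.add_apply, hg, hk]

theorem det_add_single (A : Matrix (Fin n) (Fin n) F) (l : Fin n) (w : F) :
    (A + Matrix.single l l w).det = A.det + w * A.adjugate l l := by
  have : A + Matrix.single l l w = A.updateRow l (A l + w • Pi.single l 1) := by
    ext i j
    by_cases hi : i = l
    · subst hi
      simp [Matrix.single_apply, Pi.single_apply, eq_comm]
    · simp [hi, Ne.symm hi]
  rw [this, Matrix.det_updateRow_add, Matrix.det_updateRow_smul, Matrix.updateRow_eq_self,
    Matrix.adjugate_apply]

theorem isFree_coord [Finite F] (hn : 0 < n) {σ : ℕ} (hq : 2 * wlen n * (σ + n) < Nat.card F)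
    (hq' : σ + n < Nat.card F) {a : ℕ} (ha : a < n * n - 1) : IsFree (coord n F K) σ a := by
  rintro e c ⟨he1, heσ, hc, hrel⟩
  by_contra hce
  let l : Fin n := ⟨n - 1, by omega⟩
  have hl : (finProdFinEquiv (l, l) : ℕ) = n * n - 1 := by
    have h1 : n - 1 + n * (n - 1) + 1 = n * n := by
      obtain ⟨m, rfl⟩ : ∃ m, n = m + 1 := ⟨n - 1, by omega⟩
      simp only [Nat.add_sub_cancel]; ring
    simp only [finProdFinEquiv_apply_val, l]
    omega
  obtain ⟨⟨i, j⟩, hij⟩ := finProdFinEquiv.surjective (⟨a, by omega⟩ : Fin (n * n))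
  have hija : (finProdFinEquiv (i, j) : ℕ) = a := by rw [hij]
  have hne : (i, j) ≠ (l, l) := by
    rintro h; rw [h, hl] at hija; omega
  have hadj : (fun g : SL(n, F) => (bc K g).adjugate l l) ∈ aff n F K ^ n := by
    have := adjugate_mem_pow one_le_aff (fun g : SL(n, F) => bc K g) l
      (fun i _ k => entry_mem_pow i k) l
    simpa using this
  obtain ⟨g, hg1, hg2⟩ := exists_ne_zero_pair hn hq
    (pow_mono_of_one_le one_le_aff (Nat.le_add_right σ n)
      (pow_le_pow_left' (genLT_mono _ (by omega)) σ (hc e) : c e ∈ aff n F K ^ σ))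
    (pow_mono_of_one_le one_le_aff (Nat.le_add_left n σ) hadj) hce (fun h => by
      have := congrFun h 1
      simp [bc_one] at this)
  let A : F → Matrix (Fin n) (Fin n) F := fun z => g.1 + Matrix.single i j z
  let m : F → K := fun z => ((A z).map (algebraMap F K)).adjugate l l
  have hm_eq : ∀ z, m z = algebraMap F K ((A z).adjugate l l) := by
    intro z
    simp only [m]
    rw [← RingHom.mapMatrix_apply, ← RingHom.map_adjugate]; rfl
  have hm : m ∈ aff₁ F K ^ n := by
    have := adjugate_mem_pow one_le_aff₁ (e := 1) (fun z => (A z).map (algebraMap F K)) l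
      (fun r _ k => by
        rw [pow_one]
        have : ∀ z, (A z).map (algebraMap F K) r k = algebraMap F K (g.1 r k) +
            Matrix.single i j (1 : K) r k * algebraMap F K z := by
          intro z
          simp only [A, Matrix.map_apply, Matrix.add_apply, map_add, Matrix.single_apply]
          split_ifs <;> simp
        simp only [this]
        exact add_mem (const_mem_aff₁ _) (Submodule.smul_mem _ _ id_mem_aff₁)) l
    simpa using this
  have hm0 : m ≠ 0 := fun h => hg2 (by
    have := congrFun h 0
    simpa [m, A, bc] using this)
  have hzeros := card_zeros_aff₁ hm hm0
  let p : Polynomial K := ∑ k ∈ Finset.range (e + 1), Polynomial.C (c k g) * Polynomial.X ^ k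
  have hpe : p.coeff e = c e g := by
    simp [p, Polynomial.finsetSum_coeff, Polynomial.coeff_C_mul, Polynomial.coeff_X_pow]
  have hp0 : p ≠ 0 := fun h => hg1 (by rw [← hpe, h, Polynomial.coeff_zero])
  have hpd : p.natDegree ≤ σ := by
    refine Polynomial.natDegree_sum_le_of_forall_le _ _ fun k hk => ?_
    refine (Polynomial.natDegree_C_mul_X_pow_le _ _).trans ?_
    have := Finset.mem_range.1 hk; omega
  have hroots := card_roots_le hp0 hpd (bc K g i j) {z | m z ≠ 0} (by
    intro z hz
    have hz' : (A z).adjugate l l ≠ 0 := fun h => hz (by rw [hm_eq, h, map_zero])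
    let w := (1 - (A z).det) / (A z).adjugate l l
    let h : SL(n, F) := ⟨A z + Matrix.single l l w, by
      rw [det_add_single, div_mul_cancel₀ _ hz']; ring⟩
    have hentry : ∀ r k, (r, k) ≠ (l, l) → bc K h r k =
        bc K g r k + if (r, k) = (i, j) then algebraMap F K z else 0 := by
      intro r k hrk
      have h1 : ¬ (l = r ∧ l = k) := fun h => hrk (by rw [← h.1, ← h.2])
      simp only [bc, h, A, Matrix.map_apply, Matrix.add_apply, map_add, Matrix.single_apply, if_neg h1,
        add_zero, Prod.mk.injEq]
      congr 1
      simp only [eq_comm (a := r), eq_comm (a := k)]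
      split_ifs <;> simp
    have hb : ∀ b < a, coord n F K b h = coord n F K b g := by
      intro b hb
      obtain ⟨⟨r, k⟩, hrk⟩ := finProdFinEquiv.surjective (⟨b, by omega⟩ : Fin (n * n))
      have hrkb : (finProdFinEquiv (r, k) : ℕ) = b := by rw [hrk]
      rw [← hrkb, coord_finProdFinEquiv]
      change bc K h r k = bc K g r k
      rw [hentry, if_neg, add_zero]
      · intro h; rw [h] at hrkb; omega
      · intro h; rw [h] at hrkb; omega
    have hrel' := congrFun hrel h
    have ha' : coord n F K a h = bc K g i j + algebraMap F K z := by
      rw [← hija, coord_finProdFinEquiv]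
      change bc K h i j = _
      rw [hentry i j hne, if_pos rfl]
    simp only [Finset.sum_apply, Pi.mul_apply, Pi.pow_apply, Pi.zero_apply, ha'] at hrel'
    simp only [p, Polynomial.eval_finsetSum, Polynomial.eval_mul, Polynomial.eval_C,
      Polynomial.eval_pow, Polynomial.eval_X]
    rw [← hrel']
    exact Finset.sum_congr rfl fun k _ => by
      rw [eq_of_mem_genLT_pow (coord n F K) hb (hc k)])
  have hcov : Nat.card F ≤ Nat.card {z // m z = 0} + Nat.card {z | m z ≠ 0} := by
    rw [← Nat.card_sum]
    refine Nat.card_le_card_of_surjective (Sum.elim Subtype.val Subtype.val) fun z => ?_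
    by_cases h : m z = 0
    · exact ⟨Sum.inl ⟨z, h⟩, rfl⟩
    · exact ⟨Sum.inr ⟨z, h⟩, rfl⟩
  omega

theorem le_card_frees [Finite F] (hn : 0 < n) {σ : ℕ} (hq : 2 * wlen n * (σ + n) < Nat.card F)
    (hq' : σ + n < Nat.card F) : n * n - 1 ≤ (frees (coord n F K) σ (n * n)).card := by
  rw [← Finset.card_range (n * n - 1)]
  refine Finset.card_le_card fun a ha => mem_frees.2 ⟨?_, ?_⟩
  · have := Finset.mem_range.1 ha; omega
  · exact isFree_coord hn hq hq' (Finset.mem_range.1 ha)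

/-- The special linear groups satisfy the hypotheses of the Larsen–Pink inequality. -/
theorem lpData_coord [Finite F] (hn : 0 < n) {σ : ℕ} (hq : 2 * wlen n * (σ + n) < Nat.card F)
    (hq' : σ + n < Nat.card F) (h4 : 4 ≤ Nat.card F) :
    LPData (coord n F K) (n * n) (n * n - 1) (n + 1) (n * (1 + (n + 1)) ^ (n * n - 1)) n σ where
  inv := transInv_aff
  mul _ hf := aff_mul_mem hf
  hb := HB_aff hn
  gen E hE := exists_pair_normalClosure hn h4 E hE
  free := le_card_frees hn hq hq'

end Freeness

section Cardinality

open Module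

variable {n : ℕ} {F : Type*} [Field F] {K : Type*} [Field K] [Algebra F K]

theorem card_SL_mul_le [Finite F] (hn : 0 < n) :
    Nat.card SL(n, F) * (Nat.card F - 1) ≤ Nat.card F ^ (n * n) := by
  let r : Fin n := ⟨0, hn⟩
  have h1 : Nat.card (SL(n, F) × Fˣ) ≤ Nat.card (Matrix (Fin n) (Fin n) F) := by
    refine Nat.card_le_card_of_injective
      (fun p => p.1.1.updateRow r ((p.2 : F) • p.1.1 r)) fun p p' h => ?_
    have hdet : ∀ p : SL(n, F) × Fˣ, (p.1.1.updateRow r ((p.2 : F) • p.1.1 r)).det = p.2 := by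
      intro p
      rw [Matrix.det_updateRow_smul, Matrix.updateRow_eq_self, p.1.2, mul_one]
    have h2 : p.2 = p'.2 := by
      apply Units.ext
      rw [← hdet p, ← hdet p']
      exact congrArg Matrix.det h
    refine Prod.ext (Subtype.ext (Matrix.ext fun i j => ?_)) h2
    have h3 := congrFun (congrFun h i) j
    simp only [Matrix.updateRow_apply] at h3
    split_ifs at h3 with hi
    · rw [hi]
      rw [h2] at h3
      exact mul_left_cancel₀ p'.2.ne_zero h3
    · exact h3
  have h4 : Nat.card (Matrix (Fin n) (Fin n) F) = Nat.card F ^ (n * n) := by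
    have : Nat.card (Matrix (Fin n) (Fin n) F) = Nat.card (Fin n → Fin n → F) := rfl
    rw [this, Nat.card_pi, Finset.prod_const, Nat.card_pi]
    simp [pow_mul]
  rwa [Nat.card_prod, Nat.card_units, h4] at h1

theorem card_SL_le [Finite F] (hn : 0 < n) : Nat.card SL(n, F) ≤ 2 * Nat.card F ^ (n * n - 1) := by
  have h1 := card_SL_mul_le (F := F) hn
  have h2 : 1 < Nat.card F := Finite.one_lt_card
  obtain ⟨d, hd⟩ : ∃ d, n * n = d + 1 := ⟨n * n - 1, by have := Nat.mul_pos hn hn; omega⟩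
  rw [hd, pow_succ] at h1
  rw [hd, Nat.add_sub_cancel]
  obtain ⟨q, hq⟩ : ∃ q, Nat.card F = q + 2 := ⟨Nat.card F - 2, by omega⟩
  rw [hq] at h1 ⊢
  have h3 : q + 2 - 1 = q + 1 := by omega
  rw [h3] at h1
  generalize (q + 2) ^ d = x at *
  generalize Nat.card SL(n, F) = y at *
  by_contra hcon
  push Not at hcon
  nlinarith

theorem le_card_SL [Finite F] (hn : 0 < n) :
    Nat.card F ^ (n * n - 1) ≤ 2 ^ n * Nat.card SL(n, F) := by
  classical
  have := Fintype.ofFinite F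
  let r : Fin n := ⟨0, hn⟩
  set q := Nat.card F with hq
  have hq1 : 1 < q := Finite.one_lt_card
  have h1 : Nat.card (GL (Fin n) F) ≤ Nat.card SL(n, F) * q := by
    rw [hq, ← Nat.card_prod]
    refine Nat.card_le_card_of_injective (β := SL(n, F) × F) (fun g =>
      (⟨g.1.updateRow r (g.1.det⁻¹ • g.1 r), ?_⟩, g.1.det)) ?_
    · rw [Matrix.det_updateRow_smul, Matrix.updateRow_eq_self]
      exact inv_mul_cancel₀ ((Matrix.isUnit_iff_isUnit_det _).1 g.isUnit).ne_zero
    · intro g g' h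
      have h2 : g.1.det = g'.1.det := congrArg Prod.snd h
      have h3 : g.1.updateRow r (g.1.det⁻¹ • g.1 r) = g'.1.updateRow r (g'.1.det⁻¹ • g'.1 r) :=
        congrArg (fun p => p.1.1) h
      have h0 : g'.1.det ≠ 0 := ((Matrix.isUnit_iff_isUnit_det _).1 g'.isUnit).ne_zero
      refine Units.ext (Matrix.ext fun i j => ?_)
      have h4 := congrFun (congrFun h3 i) j
      simp only [Matrix.updateRow_apply] at h4
      split_ifs at h4 with hi
      · rw [hi]
        rw [h2] at h4
        exact mul_left_cancel₀ (inv_ne_zero h0) h4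
      · exact h4
  have h2 : q ^ (n * n) ≤ 2 ^ n * Nat.card (GL (Fin n) F) := by
    rw [Matrix.card_GL_field, pow_mul, ← Nat.card_eq_fintype_card, ← hq]
    have : ∀ i : Fin n, q ^ n ≤ 2 * (q ^ n - q ^ (i : ℕ)) := by
      intro i
      have h3 : 2 * q ^ (i : ℕ) ≤ q ^ n := by
        calc 2 * q ^ (i : ℕ) ≤ q * q ^ (i : ℕ) := Nat.mul_le_mul_right _ hq1
          _ = q ^ ((i : ℕ) + 1) := by ring
          _ ≤ q ^ n := Nat.pow_le_pow_right (by omega) i.2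
      omega
    calc (q ^ n) ^ n = ∏ _i : Fin n, q ^ n := by simp
      _ ≤ ∏ i : Fin n, 2 * (q ^ n - q ^ (i : ℕ)) := Finset.prod_le_prod' fun i _ => this i
      _ = _ := by rw [Finset.prod_mul_distrib]; simp
  obtain ⟨d, hd⟩ : ∃ d, n * n = d + 1 := ⟨n * n - 1, by have := Nat.mul_pos hn hn; omega⟩
  rw [hd, pow_succ] at h2
  rw [hd, Nat.add_sub_cancel]
  refine Nat.le_of_mul_le_mul_right (h2.trans ?_) (by omega : 0 < q)
  rw [mul_assoc]
  exact Nat.mul_le_mul_left _ h1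

theorem indicator_mem_aff_pow [Finite F] (g : SL(n, F)) [DecidableEq SL(n, F)] :
    (Pi.single g 1 : SL(n, F) → K) ∈ aff n F K ^ ((Nat.card F - 1) * (n * n)) := by
  classical
  have := Fintype.ofFinite F
  have key : (Pi.single g 1 : SL(n, F) → K) = ∏ p : Fin n × Fin n,
      (1 - (fun x : SL(n, F) => bc K x p.1 p.2 - bc K g p.1 p.2) ^ (Nat.card F - 1)) := by
    ext x
    rw [Finset.prod_apply]
    simp only [Pi.sub_apply, Pi.one_apply, Pi.pow_apply]
    by_cases hx : x = g
    · subst hx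
      have h0 : Nat.card F - 1 ≠ 0 := by
        have : 1 < Nat.card F := Finite.one_lt_card
        omega
      rw [Pi.single_eq_same]
      exact (Finset.prod_eq_one fun p _ => by rw [sub_self, zero_pow h0, sub_zero]).symm
    · rw [Pi.single_eq_of_ne hx]
      obtain ⟨i, j, hij⟩ : ∃ i j, x.1 i j ≠ g.1 i j := by
        by_contra hcon
        push Not at hcon
        exact hx (Subtype.ext (Matrix.ext hcon))
      refine (Finset.prod_eq_zero (Finset.mem_univ (i, j)) ?_).symm
      have h1 : (x.1 i j - g.1 i j) ^ (Nat.card F - 1) = 1 := by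
        rw [Nat.card_eq_fintype_card]
        exact FiniteField.pow_card_sub_one_eq_one _ (sub_ne_zero.2 hij)
      rw [bc, bc, Matrix.map_apply, Matrix.map_apply, ← map_sub, ← map_pow, h1, map_one, sub_self]
  rw [key]
  have := prod_mem_pow (L := aff n F K) (e := Nat.card F - 1) Finset.univ (fun p : Fin n × Fin n =>
    1 - (fun x : SL(n, F) => bc K x p.1 p.2 - bc K g p.1 p.2) ^ (Nat.card F - 1)) fun p _ => by
      refine sub_mem (one_mem_pow one_le_aff _) (Submodule.pow_mem_pow _ ?_ _)
      refine sub_mem (entry_mem_aff _ _) ?_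
      have := const_mem_pow (one_le_aff (n := n) (F := F) (K := K)) 1 (bc K g p.1 p.2)
      rwa [pow_one] at this
  simpa using this

theorem card_le_of_HB [Finite F] (Φ : Set SL(n, F)) {C m : ℕ} (hn : 0 < n)
    (h : HB (res (Subtype.val : Φ → SL(n, F)) (aff n F K)) C m) :
    Nat.card Φ ≤ C * (n * n) ^ m * Nat.card F ^ m := by
  classical
  have := Fintype.ofFinite SL(n, F)
  have := Fintype.ofFinite Φ
  set q := Nat.card F with hq
  have hq1 : 1 < q := Finite.one_lt_card
  have htop : aff n F K ^ ((q - 1) * (n * n)) = ⊤ := by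
    rw [eq_top_iff]
    intro f _
    have : f = ∑ g, f g • (Pi.single g 1 : SL(n, F) → K) := by
      ext x
      simp [Finset.sum_apply, Pi.single_apply]
    rw [this]
    exact Submodule.sum_mem _ fun g _ => Submodule.smul_mem _ _ (indicator_mem_aff_pow g)
  have hres : res (Subtype.val : Φ → SL(n, F)) (⊤ : Submodule K (SL(n, F) → K)) = ⊤ := by
    rw [eq_top_iff]
    intro f _
    rw [mem_res]
    refine ⟨fun x => if hx : x ∈ Φ then f ⟨x, hx⟩ else 0, trivial, ?_⟩
    ext x
    simp
  have h1 := h ((q - 1) * (n * n))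
  rw [← res_pow, htop, hres, finrank_top, finrank_pi, ← Nat.card_eq_fintype_card] at h1
  refine h1.trans ?_
  rw [mul_assoc, ← mul_pow]
  gcongr
  have := Nat.mul_pos hn hn
  calc (q - 1) * (n * n) + 1 ≤ (q - 1) * (n * n) + n * n := by omega
    _ = n * n * (q - 1 + 1) := by ring
    _ = n * n * q := by rw [Nat.sub_add_cancel hq1.le]

end Cardinality

section Classes

open Module

variable {n : ℕ} {F : Type*} [Field F] {K : Type*} [Field K] [Algebra F K]

/-- The elements whose matrix is diagonalized with eigenvalues `ν` by `P`. -/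
def Diag (P : Matrix (Fin n) (Fin n) K) (ν : Fin n → K) (x : SL(n, F)) : Prop :=
  bc K x * P = P * Matrix.diagonal ν

theorem Diag.conj {P : Matrix (Fin n) (Fin n) K} {ν : Fin n → K} {x : SL(n, F)} (h : Diag P ν x)
    (g : SL(n, F)) : Diag (bc K g * P) ν (g * x * g⁻¹) := by
  have h1 : bc K (g * x * g⁻¹) * bc K g = bc K g * bc K x := by
    rw [← bc_mul, ← bc_mul, inv_mul_cancel_right]
  unfold Diag at h ⊢
  rw [← mul_assoc, h1, mul_assoc, h, mul_assoc]

theorem det_bc_mul (g : SL(n, F)) (P : Matrix (Fin n) (Fin n) K) : (bc K g * P).det = P.det := by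
  rw [Matrix.det_mul, det_bc, one_mul]

theorem Diag.det_smul {P : Matrix (Fin n) (Fin n) K} {ν : Fin n → K} {x : SL(n, F)}
    (h : Diag P ν x) (i j : Fin n) :
    P.det * bc K x i j = ((P * Matrix.diagonal ν) * P.adjugate) i j := by
  unfold Diag at h
  rw [← h, mul_assoc, Matrix.mul_adjugate, mul_smul_comm, mul_one]
  rfl

theorem Diag.eq {P : Matrix (Fin n) (Fin n) K} (hP : P.det ≠ 0) {ν : Fin n → K} {x y : SL(n, F)}
    (hx : Diag P ν x) (hy : Diag P ν y) : x = y := by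
  refine bc_injective (K := K) (Matrix.ext fun i j => mul_left_cancel₀ hP ?_)
  rw [hx.det_smul, hy.det_smul]

theorem HB_res_of_denom {Ω : Type*} [Finite Ω] (u : Ω → SL(n, F)) {L' : Submodule K (Ω → K)}
    {C m : ℕ} (h' : HB L' C m) {δ : Ω → K} (hδ : ∀ ω, δ ω ≠ 0) {a : ℕ} (ha : 1 ≤ a)
    (hδa : δ ∈ L' ^ a) (h : ∀ i j, (fun ω => δ ω * bc K (u ω) i j) ∈ L' ^ a) :
    HB (res u (aff n F K)) (C * a ^ m) m := by
  refine h'.of_denom hδ ha ?_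
  rintro _ ⟨f, hf, rfl⟩
  refine aff_comp_mem u (Q := (L' ^ a).comap (LinearMap.mulLeft K δ)) ?_ (fun i j => h i j) hf
  rw [Submodule.one_le]
  simpa using hδa

theorem exists_entry_ne_zero {P : Matrix (Fin n) (Fin n) K} (hP : P.det ≠ 0) (j : Fin n) :
    ∃ i, P i j ≠ 0 := by
  by_contra hcon
  push Not at hcon
  exact hP (Matrix.det_eq_zero_of_column_eq_zero j hcon)

/-- Growth of the functions on a set of matrices with the same eigenvalues. -/
theorem HB_class [Finite F] (Φ : Set SL(n, F)) (lam : Fin n → K)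
    (h : ∀ x ∈ Φ, ∃ P : Matrix (Fin n) (Fin n) K, P.det ≠ 0 ∧ Diag P lam x) :
    HB (res (Subtype.val : Φ → SL(n, F)) (aff n F K)) (n ^ n * (n + 1) ^ (n * (n - 1)))
      (n * (n - 1)) := by
  choose P hP hPx using h
  have key := HB.of_cover (K := K) (L := res (Subtype.val : Φ → SL(n, F)) (aff n F K))
    (C := (n + 1) ^ (n * (n - 1))) (m := n * (n - 1)) (ι := Fin n → Fin n)
    (fun s => {x | ∀ j, P x.1 x.2 (s j) j ≠ 0}) (fun x => by
      choose s hs using fun j => exists_entry_ne_zero (hP x.1 x.2) j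
      exact ⟨s, hs⟩) ?_
  · simpa using key
  intro s
  rw [res_res]
  set Ω := {x : Φ | ∀ j, P x.1 x.2 (s j) j ≠ 0}
  let Q : Ω → Matrix (Fin n) (Fin n) K := fun x =>
    P x.1.1 x.1.2 * Matrix.diagonal fun j => (P x.1.1 x.1.2 (s j) j)⁻¹
  have hQ : ∀ x i j, Q x i j = P x.1.1 x.1.2 i j * (P x.1.1 x.1.2 (s j) j)⁻¹ := fun x i j =>
    Matrix.mul_diagonal _ _ _ _
  have hQdet : ∀ x, (Q x).det ≠ 0 := fun x => by
    rw [Matrix.det_mul, Matrix.det_diagonal]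
    exact mul_ne_zero (hP _ _) (Finset.prod_ne_zero_iff.2 fun j _ => inv_ne_zero (x.2 j))
  have hQx : ∀ x : Ω, Diag (Q x) lam x.1.1 := fun x => by
    have := hPx x.1.1 x.1.2
    unfold Diag at this ⊢
    rw [← mul_assoc, this, mul_assoc, mul_assoc, Matrix.diagonal_mul_diagonal,
      Matrix.diagonal_mul_diagonal]
    simp only [mul_comm]
  let v : (Σ j : Fin n, {i : Fin n // i ≠ s j}) → Ω → K := fun p x => Q x p.2.1 p.1
  have hcard : Fintype.card (Σ j : Fin n, {i : Fin n // i ≠ s j}) = n * (n - 1) := by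
    simp [Fintype.card_sigma]
  have hHB := HB_gen_range (K := K) v
  rw [hcard] at hHB
  set L' := gen K (Set.range v)
  have h1 : 1 ≤ L' := one_le_gen _
  have hent : ∀ i j, (fun x => Q x i j) ∈ L' ^ 1 := by
    intro i j
    by_cases hi : i = s j
    · have : (fun x => Q x i j) = fun _ => 1 := by
        ext x
        rw [hQ, hi, mul_inv_cancel₀ (x.2 j)]
      rw [this]
      exact const_mem_pow h1 1 1
    · rw [pow_one]
      exact mem_gen ⟨⟨j, i, hi⟩, rfl⟩
  have hdet := det_mem_pow Q hent
  have hadj : ∀ i j, (fun x => (Q x).adjugate i j) ∈ L' ^ n := fun i j => by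
    simpa using adjugate_mem_pow h1 Q j (fun i _ k => hent i k) i
  have := HB_res_of_denom (fun x : Ω => x.1.1) hHB (δ := fun x => (Q x).det) hQdet (a := n + 1)
    (by omega) (pow_mono_of_one_le h1 (by simp) hdet) (fun i j => by
      simp only [(hQx _).det_smul]
      have := matrix_mul_mem_pow (fun x => Q x * Matrix.diagonal lam) (fun x => (Q x).adjugate)
        (e := 1) (fun i j => matrix_mul_const_mem _ Q hent i j) hadj i j
      rwa [add_comm] at this)
  rw [one_mul] at this
  exact this

/-- Growth of the functions on a family of simultaneously diagonalized matrices, all of whose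
eigenvalues belong to a family of functions satisfying one monomial relation. -/
theorem HB_diag {Ω ι : Type*} [Finite Ω] [Fintype ι] (u : Ω → SL(n, F))
    {P : Matrix (Fin n) (Fin n) K} (hP : P.det ≠ 0) (ν : Ω → Fin n → K)
    (hν : ∀ ω, Diag P (ν ω) (u ω)) (μ : ι → Ω → K) (v : Ω → K) {e : ℕ} (he : 1 ≤ e)
    (hrel : ∀ ω, v ω ^ e * ∏ k, μ k ω = 1)
    (hmem : ∀ i, (fun ω => ν ω i) ∈ gen K (Set.range μ) ⊔ Submodule.span K {v}) :
    HB (res u (aff n F K)) (e * (1 + (Fintype.card ι)) ^ Fintype.card ι) (Fintype.card ι) := by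
  classical
  set L' := gen K (Set.range μ)
  have h1 : 1 ≤ L' := one_le_gen _
  have hle : res u (aff n F K) ≤ L' ⊔ Submodule.span K {v} := by
    rintro _ ⟨f, hf, rfl⟩
    refine aff_comp_mem u (h1.trans le_sup_left) (fun i j => ?_) hf
    have : (fun ω => bc K (u ω) i j) = P.det⁻¹ • fun ω => (P * Matrix.diagonal (ν ω) *
        P.adjugate) i j := by
      ext ω
      rw [Pi.smul_apply, ← (hν ω).det_smul, smul_eq_mul, inv_mul_cancel_left₀ hP]
    rw [this]
    refine Submodule.smul_mem _ _ ?_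
    refine matrix_mul_const_mem _ (fun ω => P * Matrix.diagonal (ν ω)) (fun i j => ?_) i j
    simp only [Matrix.mul_diagonal]
    exact Submodule.smul_mem _ (P i j) (hmem j)
  have hprod : ∏ k, μ k ∈ L' ^ Fintype.card ι := by
    have := prod_mem_pow (L := L') (e := 1) Finset.univ μ fun k _ => by
      rw [pow_one]; exact mem_gen ⟨k, rfl⟩
    rwa [one_mul, Finset.card_univ] at this
  have := (HB_gen_range (K := K) μ).adjoin_algebraic h1 hle (e := e) (s := Fintype.card ι)
    (fun i => if i = e then ∏ k, μ k else if i = 0 then -1 else 0) (fun i => by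
      split_ifs
      · exact hprod
      · exact neg_mem (one_mem_pow h1 _)
      · exact zero_mem _) ?_ ?_
  · simpa using this
  · rw [Finset.sum_range_succ, Finset.sum_eq_single 0]
    · ext ω
      have := hrel ω
      simp only [if_pos, if_neg (show ¬ 0 = e by omega)]
      simp [mul_comm, this]
    · intro i hi hi0
      rw [if_neg (Finset.mem_range.1 hi).ne, if_neg hi0, zero_mul]
    · intro h; exact absurd (Finset.mem_range.2 (by omega)) h
  · intro ω h0
    have := hrel ω
    rw [if_pos rfl, Finset.prod_apply] at h0
    rw [h0, mul_zero] at this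
    exact zero_ne_one this

theorem Diag.prod_eq_one {P : Matrix (Fin n) (Fin n) K} (hP : P.det ≠ 0) {ν : Fin n → K}
    {x : SL(n, F)} (h : Diag P ν x) : ∏ i, ν i = 1 := by
  have := congrArg Matrix.det h
  rw [Matrix.det_mul, Matrix.det_mul, det_bc, Matrix.det_diagonal, one_mul] at this
  exact mul_left_cancel₀ hP (by rw [← this, mul_one])

/-- The split torus defined by `P`. -/
def torus (F : Type*) [Field F] [Algebra F K] (P : Matrix (Fin n) (Fin n) K) : Set SL(n, F) :=
  {x | ∃ ν, Diag P ν x}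

theorem HB_torus [Finite F] (hn : 0 < n) {P : Matrix (Fin n) (Fin n) K} (hP : P.det ≠ 0) :
    HB (res (Subtype.val : torus F P → SL(n, F)) (aff n F K)) (n ^ n) (n - 1) := by
  classical
  have hx : ∀ x : torus F P, ∃ ν, Diag P ν x.1 := fun x => x.2
  choose ν hν using hx
  let r : Fin n := ⟨0, hn⟩
  have hcard : Fintype.card {k : Fin n // k ≠ r} = n - 1 := by simp
  have := HB_diag Subtype.val hP ν hν (fun k : {k : Fin n // k ≠ r} => fun x => ν x k)
    (fun x => ν x r) le_rfl (fun x => by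
      rw [pow_one, ← (hν x).prod_eq_one hP, ← Finset.mul_prod_erase _ _ (Finset.mem_univ r)]
      congr 1
      exact (Finset.prod_subtype _ (by simp) _).symm) (fun i => by
      by_cases hi : i = r
      · rw [hi]; exact Submodule.mem_sup_right (Submodule.mem_span_singleton_self _)
      · exact Submodule.mem_sup_left (mem_gen ⟨⟨i, hi⟩, rfl⟩))
  rw [hcard] at this
  refine this.mono le_rfl ?_ le_rfl
  rw [one_mul, Nat.add_sub_cancel' hn]
  exact Nat.pow_le_pow_right hn (by omega)

theorem HB_torus_singular [Finite F] {P : Matrix (Fin n) (Fin n) K} (hP : P.det ≠ 0)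
    {i j : Fin n} (hij : i ≠ j) (Φ : Set SL(n, F)) (h : ∀ x ∈ Φ, ∃ ν, Diag P ν x ∧ ν i = ν j) :
    HB (res (Subtype.val : Φ → SL(n, F)) (aff n F K)) (2 * n ^ n) (n - 2) := by
  classical
  choose ν hν hνij using fun x : Φ => h x.1 x.2
  have hcard : Fintype.card {k : Fin n // k ∉ ({i, j} : Finset (Fin n))} = n - 2 := by
    rw [Fintype.card_subtype_compl, Fintype.card_coe, Finset.card_pair hij, Fintype.card_fin]
  have := HB_diag Subtype.val hP ν hν
    (fun k : {k : Fin n // k ∉ ({i, j} : Finset (Fin n))} => fun x => ν x k)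
    (fun x => ν x i) one_le_two (fun x => by
      rw [← (hν x).prod_eq_one hP, ← Finset.prod_mul_prod_compl {i, j}, Finset.prod_pair hij,
        ← hνij x, ← sq]
      congr 1
      exact (Finset.prod_subtype _ (by simp) _).symm) (fun k => by
      by_cases hk : k ∈ ({i, j} : Finset (Fin n))
      · refine Submodule.mem_sup_right ?_
        have : (fun x => ν x k) = fun x => ν x i := by
          rcases Finset.mem_insert.1 hk with rfl | hk
          · rfl
          · rw [Finset.mem_singleton.1 hk]; exact funext fun x => (hνij x).symm
        rw [this]
        exact Submodule.mem_span_singleton_self _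
      · exact Submodule.mem_sup_left (mem_gen ⟨⟨k, hk⟩, rfl⟩))
  rw [hcard] at this
  refine this.mono le_rfl ?_ le_rfl
  have hn : 0 < n := i.pos
  refine Nat.mul_le_mul_left 2 ?_
  by_cases h2 : 2 ≤ n
  · exact (Nat.pow_le_pow_left (by omega) _).trans (Nat.pow_le_pow_right hn (by omega))
  · have : n - 2 = 0 := by omega
    rw [this]
    simpa using Nat.one_le_pow _ _ hn

end Classes

section Regular

open Module

variable {n : ℕ} {F : Type*} [Field F] {K : Type*} [Field K] [Algebra F K]

/-- The Gram matrix of the trace form on the powers of a matrix. -/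
def traceGram (A : Matrix (Fin n) (Fin n) K) : Matrix (Fin n) (Fin n) K :=
  Matrix.of fun i j => (A ^ (i + j : ℕ)).trace

theorem charpoly_roots_nodup [IsAlgClosed K] {A : Matrix (Fin n) (Fin n) K}
    (h : (traceGram A).det ≠ 0) : A.charpoly.roots.Nodup := by
  classical
  rw [Multiset.nodup_iff_count_le_one]
  intro a
  by_contra hcon
  push Not at hcon
  rw [Polynomial.count_roots] at hcon
  obtain ⟨f, hf⟩ := (Polynomial.le_rootMultiplicity_iff A.charpoly_monic.ne_zero).1 hcon
  have hXa := Polynomial.monic_X_sub_C a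
  have hfm : f.Monic := (hXa.pow 2).of_mul_monic_left (hf ▸ A.charpoly_monic)
  set p := (Polynomial.X - Polynomial.C a) * f with hp
  have hpm : p.Monic := hXa.mul hfm
  have hpA : A.charpoly = (Polynomial.X - Polynomial.C a) * p := by rw [hf, hp]; ring
  have hpd : p.natDegree + 1 = n := by
    have := congrArg Polynomial.natDegree hpA
    rw [A.charpoly_natDegree_eq_dim, hXa.natDegree_mul hpm, Polynomial.natDegree_X_sub_C,
      Fintype.card_fin] at this
    omega
  set x := Polynomial.aeval A p with hx
  have hxx : x * x = 0 := by
    rw [hx, ← map_mul]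
    have : p * p = A.charpoly * f := by rw [hpA, hp]; ring
    rw [this, map_mul, Matrix.aeval_self_charpoly, zero_mul]
  have htr : ∀ k : ℕ, (x * A ^ k).trace = 0 := by
    intro k
    have hc : Commute x (A ^ k) := by
      rw [hx]
      have : A ^ k = Polynomial.aeval A (Polynomial.X ^ k : Polynomial K) := by simp
      rw [this]
      exact (Commute.all p (Polynomial.X ^ k)).map (Polynomial.aeval A)
    have hn : IsNilpotent (x * A ^ k) := ⟨2, by rw [hc.mul_pow, sq, hxx, zero_mul]⟩
    exact (Matrix.isNilpotent_trace_of_isNilpotent hn).eq_zero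
  refine h (Matrix.exists_mulVec_eq_zero_iff.1 ⟨fun i => p.coeff i, fun h0 => ?_, ?_⟩)
  · have := congrFun h0 ⟨p.natDegree, by omega⟩
    simp [hpm.coeff_natDegree] at this
  · ext i
    have h2 := htr i
    rw [hx, Polynomial.aeval_eq_sum_range, hpd, Finset.sum_mul, Matrix.trace_sum,
      Finset.sum_range] at h2
    rw [Pi.zero_apply, ← h2, Matrix.mulVec, dotProduct]
    refine Finset.sum_congr rfl fun j _ => ?_
    rw [traceGram, Matrix.of_apply, smul_mul_assoc, Matrix.trace_smul, ← pow_add, smul_eq_mul,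
      mul_comm, add_comm]

theorem exists_diag_of_nodup [IsAlgClosed K] {A : Matrix (Fin n) (Fin n) K}
    (h : A.charpoly.roots.Nodup) : ∃ (P : Matrix (Fin n) (Fin n) K) (lam : Fin n → K),
      P.det ≠ 0 ∧ Function.Injective lam ∧ A * P = P * Matrix.diagonal lam := by
  classical
  have hcard : A.charpoly.roots.card = n := by
    rw [IsAlgClosed.card_roots_eq_natDegree, A.charpoly_natDegree_eq_dim, Fintype.card_fin]
  have hc2 : A.charpoly.roots.toFinset.card = n := by
    rw [Multiset.toFinset_card_of_nodup h, hcard]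
  let e := A.charpoly.roots.toFinset.equivFinOfCardEq hc2
  let lam : Fin n → K := fun i => (e.symm i).1
  have hlam : Function.Injective lam := Subtype.val_injective.comp e.symm.injective
  have hroot : ∀ i, ∃ v : Fin n → K, v ≠ 0 ∧ A.mulVec v = lam i • v := by
    intro i
    have h1 : A.charpoly.eval (lam i) = 0 := by
      have := (e.symm i).2
      rw [Multiset.mem_toFinset] at this
      exact (Polynomial.mem_roots'.1 this).2
    rw [Matrix.eval_charpoly] at h1
    obtain ⟨v, hv, hv'⟩ := Matrix.exists_mulVec_eq_zero_iff.2 h1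
    refine ⟨v, hv, ?_⟩
    rw [Matrix.sub_mulVec, sub_eq_zero] at hv'
    rw [← hv']
    ext j
    simp [Matrix.scalar_apply, Matrix.mulVec_diagonal]
  choose v hv hAv using hroot
  have hli : LinearIndependent K v := by
    refine Module.End.eigenvectors_linearIndependent' (Matrix.toLin' A) lam hlam v fun i => ?_
    rw [Module.End.hasEigenvector_iff, Module.End.mem_eigenspace_iff]
    exact ⟨by rw [Matrix.toLin'_apply, hAv], hv i⟩
  refine ⟨(Matrix.of v).transpose, lam, ?_, hlam, ?_⟩
  · rw [Matrix.det_transpose]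
    have : IsUnit (Matrix.of v) := Matrix.linearIndependent_rows_iff_isUnit.1 hli
    exact ((Matrix.isUnit_iff_isUnit_det _).1 this).ne_zero
  · ext i j
    rw [Matrix.mul_diagonal]
    have := congrFun (hAv j) i
    simpa [Matrix.mul_apply, Matrix.mulVec, dotProduct, mul_comm] using this

theorem bc_pow_entry_mem (k : ℕ) (i j : Fin n) :
    (fun g : SL(n, F) => (bc K g ^ k) i j) ∈ aff n F K ^ k := by
  induction k generalizing i j with
  | zero =>
    simp only [pow_zero]
    exact const_mem_pow one_le_aff 0 _
  | succ k ih =>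
    simp only [pow_succ (bc K _)]
    exact matrix_mul_mem_pow (fun g => bc K g ^ k) (fun g => bc K g) ih
      (fun i j => entry_mem_pow i j) i j

theorem traceGram_det_mem :
    (fun g : SL(n, F) => (traceGram (bc K g)).det) ∈ aff n F K ^ (2 * n * n) := by
  have := det_mem_pow (L := aff n F K) (e := 2 * n) (fun g : SL(n, F) => traceGram (bc K g))
    fun i j => by
      have : (fun g : SL(n, F) => traceGram (bc K g) i j) =
          ∑ k, fun g : SL(n, F) => (bc K g ^ (i + j : ℕ)) k k := by
        ext g
        simp [traceGram, Matrix.trace, Finset.sum_apply]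
      rw [this]
      exact sum_mem fun k _ => pow_mono_of_one_le one_le_aff (by omega) (bc_pow_entry_mem _ _ _)
  rwa [Fintype.card_fin] at this

theorem exists_diagonal [Finite F] (hq : n * n + 1 < Nat.card F) :
    ∃ d : Fin n → F, Function.Injective d ∧ ∏ i, d i = 1 := by
  rcases n with _ | m
  · exact ⟨fun i => i.elim0, fun i => i.elim0, by simp⟩
  obtain ⟨a, ha⟩ := IsCyclic.exists_ofOrder_eq_natCard (α := Fˣ)
  rw [Nat.card_units] at ha
  have hinj : ∀ k l : ℕ, k < Nat.card F - 1 → l < Nat.card F - 1 → (a : F) ^ k = (a : F) ^ l →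
      k = l := by
    intro k l hk hl h
    have h1 : a ^ k = a ^ l := Units.ext (by push_cast; exact h)
    exact pow_injOn_Iio_orderOf (by rw [ha]; exact hk) (by rw [ha]; exact hl) h1
  set s := ∑ k : Fin m, ((k : ℕ) + 1)
  have hs : s ≤ m * m := by
    calc s ≤ ∑ _k : Fin m, m := Finset.sum_le_sum fun k _ => k.2
      _ = m * m := by simp
  have hnn : (m + 1) * (m + 1) = m * m + 2 * m + 1 := by ring
  have key : ∀ k : Fin m, (a : F) ^ ((k : ℕ) + 1) ≠ ((a : F) ^ s)⁻¹ := by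
    intro k h
    have h1 : (a : F) ^ ((k : ℕ) + 1 + s) = (a : F) ^ 0 := by
      rw [pow_add, h, pow_zero]
      exact inv_mul_cancel₀ (pow_ne_zero _ a.ne_zero)
    have := hinj _ _ (by omega) (by omega) h1
    omega
  refine ⟨Fin.snoc (fun k : Fin m => (a : F) ^ ((k : ℕ) + 1)) ((a : F) ^ s)⁻¹, ?_, ?_⟩
  · intro i j
    induction i using Fin.lastCases with
    | last =>
      induction j using Fin.lastCases with
      | last => intro _; rfl
      | cast j => intro h; rw [Fin.snoc_last, Fin.snoc_castSucc] at h; exact absurd h.symm (key j)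
    | cast i =>
      induction j using Fin.lastCases with
      | last => intro h; rw [Fin.snoc_last, Fin.snoc_castSucc] at h; exact absurd h (key i)
      | cast j =>
        intro h
        rw [Fin.snoc_castSucc, Fin.snoc_castSucc] at h
        have := hinj _ _ (by omega) (by omega) h
        rw [Fin.ext (by omega : (i : ℕ) = j)]
  · rw [Fin.prod_univ_castSucc]
    simp only [Fin.snoc_castSucc, Fin.snoc_last, Finset.prod_pow_eq_pow_sum]
    exact mul_inv_cancel₀ (pow_ne_zero _ a.ne_zero)

theorem traceGram_det_ne_zero [Finite F] (hq : n * n + 1 < Nat.card F) :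
    (fun g : SL(n, F) => (traceGram (bc K g)).det) ≠ 0 := by
  obtain ⟨d, hd, hd1⟩ := exists_diagonal hq
  let g : SL(n, F) := ⟨Matrix.diagonal d, by rw [Matrix.det_diagonal, hd1]⟩
  intro h
  have h1 := congrFun h g
  have h2 : bc K g = Matrix.diagonal fun i => algebraMap F K (d i) := by
    simp only [bc, g]
    exact Matrix.diagonal_map (map_zero _)
  set w : Fin n → K := fun i => algebraMap F K (d i)
  have h3 : traceGram (bc K g) = (Matrix.vandermonde w).transpose * Matrix.vandermonde w := by
    ext i j
    rw [traceGram, Matrix.of_apply, h2, Matrix.diagonal_pow, Matrix.trace_diagonal,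
      Matrix.mul_apply]
    exact Finset.sum_congr rfl fun k _ => by
      simp [Matrix.vandermonde_apply, pow_add]
  have hw : Function.Injective w := (algebraMap F K).injective.comp hd
  have h4 := Matrix.det_vandermonde_ne_zero_iff.2 hw
  simp only [h3, Matrix.det_mul, Matrix.det_transpose, Pi.zero_apply] at h1
  exact mul_ne_zero h4 h4 h1

/-- A bounded power of a generating set contains a regular semisimple element. -/
theorem exists_regular (hn : 0 < n) : ∃ M : ℕ, ∀ (F : Type*) [Field F] [Finite F] (K : Type*)
    [Field K] [Algebra F K] [IsAlgClosed K], n * n + 1 < Nat.card F → ∀ S : Set SL(n, F), 1 ∈ S →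
      Subgroup.closure S = ⊤ → ∃ t ∈ S ^ M, ∃ (P : Matrix (Fin n) (Fin n) K) (lam : Fin n → K),
        P.det ≠ 0 ∧ Function.Injective lam ∧ Diag P lam t := by
  refine ⟨n * (1 + (n + 1)) ^ (n * n - 1) * (2 * n * n + 1) ^ (n * n - 1), ?_⟩
  intro F _ _ K _ _ _ hq S h1 hS
  by_contra hcon
  push Not at hcon
  refine traceGram_det_ne_zero (K := K) hq (escape h1 hS (aff n F K ^ (2 * n * n))
    (fun f hf a => transInv_aff.right_pow a hf) (HB_aff hn _) traceGram_det_mem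
    fun x hx => ?_)
  by_contra h0
  obtain ⟨P, lam, hP, hl, h⟩ := exists_diag_of_nodup (charpoly_roots_nodup h0)
  exact hcon x hx P lam hP hl h

theorem Diag.mem_torus_of_commute {P : Matrix (Fin n) (Fin n) K} (hP : P.det ≠ 0)
    {lam : Fin n → K} (hl : Function.Injective lam) {t x : SL(n, F)} (ht : Diag P lam t)
    (hx : x * t = t * x) : x ∈ torus F P := by
  unfold Diag at ht
  have hu : IsUnit P.det := hP.isUnit
  set D := P⁻¹ * bc K x * P with hD
  have hPD : P * D = bc K x * P := by
    rw [hD, mul_assoc, Matrix.mul_nonsing_inv_cancel_left _ _ hu]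
  have hcomm : D * Matrix.diagonal lam = Matrix.diagonal lam * D := by
    have : P * (D * Matrix.diagonal lam) = P * (Matrix.diagonal lam * D) := by
      rw [← mul_assoc, hPD, mul_assoc, ← ht, ← mul_assoc, ← bc_mul, hx, bc_mul, mul_assoc, ← hPD,
        ← mul_assoc, ht, mul_assoc]
    have h2 := congrArg (P⁻¹ * ·) this
    simpa only [Matrix.nonsing_inv_mul_cancel_left _ _ hu] using h2
  refine ⟨fun i => D i i, ?_⟩
  unfold Diag
  rw [← hPD]
  congr 1
  ext i j
  by_cases hij : i = j
  · rw [hij, Matrix.diagonal_apply_eq]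
  · rw [Matrix.diagonal_apply_ne _ hij]
    have := congrFun (congrFun hcomm i) j
    rw [Matrix.mul_diagonal, Matrix.diagonal_mul, mul_comm] at this
    by_contra h0
    exact hij (hl (mul_right_cancel₀ h0 this).symm)

end Regular

section Arithmetic

theorem le_sq_of_pow_le {a B R d C : ℕ} (ha : 0 < a) (hd : 0 < d) (hR : 2 * d ≤ R)
    (hB : B ^ R ≤ a ^ (R + 1)) (h : a ^ d ≤ C * B ^ (d - 1)) : a ≤ C ^ 2 := by
  obtain ⟨k, rfl⟩ : ∃ k, d = k + 1 := ⟨d - 1, by omega⟩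
  obtain ⟨r, rfl⟩ : ∃ r, R = 2 * (k + 1) + r := ⟨R - 2 * (k + 1), by omega⟩
  rw [Nat.add_sub_cancel] at h
  set R := 2 * (k + 1) + r with hRdef
  have h1 : a ^ (k + 2 + r) * a ^ ((R + 1) * k) ≤ C ^ R * a ^ ((R + 1) * k) := by
    calc a ^ (k + 2 + r) * a ^ ((R + 1) * k) = (a ^ (k + 1)) ^ R := by
          rw [← pow_add, ← pow_mul]; congr 1; rw [hRdef]; ring
      _ ≤ (C * B ^ k) ^ R := Nat.pow_le_pow_left h _
      _ = C ^ R * (B ^ R) ^ k := by ring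
      _ ≤ C ^ R * (a ^ (R + 1)) ^ k := by gcongr
      _ = _ := by ring
  have h2 := Nat.le_of_mul_le_mul_right h1 (pow_pos ha _)
  have h3 : a ^ R ≤ (C ^ 2) ^ R := by
    calc a ^ R ≤ a ^ (2 * (k + 2 + r)) := Nat.pow_le_pow_right ha (by omega)
      _ = (a ^ (k + 2 + r)) ^ 2 := by ring
      _ ≤ (C ^ R) ^ 2 := Nat.pow_le_pow_left h2 _
      _ = _ := by ring
  exact (Nat.pow_le_pow_iff_left (by omega)).1 h3

theorem pow_le_of_pivot {n q a B R d e C C₁ g ρ : ℕ} (he : 0 < e)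
    (hde : d = e + (n - 1)) (ha : 0 < a) (hR : R = 8 * d * (e + d))
    (hB : B ^ R ≤ a ^ (R + 1)) (hag : a ≤ g) (hg : g ≤ 2 * q ^ d) (hg' : q ^ d ≤ 2 ^ n * g)
    (hρ : g * ρ ≤ B * (C₁ * q ^ (n - 1))) (h : a ^ d ≤ 2 ^ d * (C * B ^ e) * ρ ^ d)
    (hq : ((2 ^ (n * d + d) * C * C₁ ^ d) ^ R * 2 ^ (e + d)) ^ 8 ≤ q) (hq0 : 0 < q) :
    q ^ (4 * d - 1) ≤ a ^ 4 := by
  set C₃ := 2 ^ (n * d + d) * C * C₁ ^ d with hC₃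
  have hd : 0 < d := by omega
  have h1 : q ^ (d * e) * a ^ d ≤ C₃ * B ^ (e + d) := by
    refine Nat.le_of_mul_le_mul_right (c := q ^ ((n - 1) * d)) ?_ (pow_pos hq0 _)
    calc q ^ (d * e) * a ^ d * q ^ ((n - 1) * d) = (q ^ d) ^ d * a ^ d := by
          rw [mul_right_comm, ← pow_add, ← pow_mul]; congr 2; rw [hde]; ring
      _ ≤ (2 ^ n * g) ^ d * (2 ^ d * (C * B ^ e) * ρ ^ d) := by gcongr
      _ = 2 ^ (n * d + d) * C * B ^ e * (g * ρ) ^ d := by ring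
      _ ≤ 2 ^ (n * d + d) * C * B ^ e * (B * (C₁ * q ^ (n - 1))) ^ d := by gcongr
      _ = _ := by rw [hC₃]; ring
  have h2 : q ^ (d * e * R) ≤ C₃ ^ R * 2 ^ (e + d) * (a ^ (e * R) * q ^ (d * (e + d))) := by
    refine Nat.le_of_mul_le_mul_right (c := a ^ (d * R)) ?_ (pow_pos ha _)
    calc q ^ (d * e * R) * a ^ (d * R) = (q ^ (d * e) * a ^ d) ^ R := by ring
      _ ≤ (C₃ * B ^ (e + d)) ^ R := Nat.pow_le_pow_left h1 _
      _ = C₃ ^ R * (B ^ R) ^ (e + d) := by ring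
      _ ≤ C₃ ^ R * (a ^ (R + 1)) ^ (e + d) := by gcongr
      _ = C₃ ^ R * a ^ (e * R) * a ^ (d * R) * a ^ (e + d) := by ring
      _ ≤ C₃ ^ R * a ^ (e * R) * a ^ (d * R) * (2 * q ^ d) ^ (e + d) := by
          gcongr
          exact hag.trans hg
      _ = _ := by ring
  have hRpos : 0 < R := by rw [hR]; positivity
  have h3 : (q ^ (8 * d)) ^ (e * R) ≤ (a ^ 8 * q ^ 2) ^ (e * R) := by
    calc (q ^ (8 * d)) ^ (e * R) = (q ^ (d * e * R)) ^ 8 := by ring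
      _ ≤ (C₃ ^ R * 2 ^ (e + d) * (a ^ (e * R) * q ^ (d * (e + d)))) ^ 8 :=
          Nat.pow_le_pow_left h2 _
      _ = (C₃ ^ R * 2 ^ (e + d)) ^ 8 * (a ^ 8) ^ (e * R) * q ^ R := by rw [hR]; ring
      _ ≤ q ^ 1 * (a ^ 8) ^ (e * R) * q ^ R := by rw [pow_one]; gcongr
      _ ≤ q ^ (e * R) * (a ^ 8) ^ (e * R) * q ^ (e * R) := by
          gcongr
          · exact Nat.mul_pos he hRpos
          · exact Nat.le_mul_of_pos_left _ he
      _ = _ := by ring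
  have h4 := (Nat.pow_le_pow_iff_left (Nat.mul_pos he hRpos).ne').1 h3
  have h5 : (q ^ (4 * d - 1)) ^ 2 ≤ (a ^ 4) ^ 2 := by
    refine Nat.le_of_mul_le_mul_right (c := q ^ 2) ?_ (pow_pos hq0 _)
    calc (q ^ (4 * d - 1)) ^ 2 * q ^ 2 = q ^ (8 * d) := by
          rw [← pow_mul, ← pow_add]; congr 1; omega
      _ ≤ a ^ 8 * q ^ 2 := h4
      _ = _ := by ring
  exact (Nat.pow_le_pow_iff_left two_ne_zero).1 h5

theorem card_le_mul_of_fiber {α β : Type*} [Finite α] [Finite β] (f : α → β) {k : ℕ}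
    (h : ∀ a, Nat.card {a' // f a' = f a} ≤ k) : Nat.card α ≤ Nat.card β * k := by
  have := Fintype.ofFinite β
  rw [Nat.card_congr (Equiv.sigmaFiberEquiv f).symm, Nat.card_sigma, Nat.card_eq_fintype_card,
    ← smul_eq_mul, ← Finset.card_univ]
  refine Finset.sum_le_card_nsmul _ _ _ fun b _ => ?_
  by_cases hb : ∃ a, f a = b
  · obtain ⟨a, rfl⟩ := hb
    exact h a
  · have : IsEmpty {a // f a = b} := ⟨fun a => hb ⟨a.1, a.2⟩⟩
    simp

end Arithmetic

section LarsenPink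

variable {n : ℕ}

theorem larsen_pink_SL (hn : 0 < n) (m C₀ : ℕ) : ∃ C Q : ℕ, ∀ (F : Type) [Field F] [Finite F],
    Q ≤ Nat.card F → ∀ S : Set SL(n, F), 1 ∈ S → Subgroup.closure S = ⊤ → ∀ N, 1 ≤ N →
      ∀ A ⊆ S ^ N, HB (res (Subtype.val : A → SL(n, F)) (aff n F (AlgebraicClosure F))) C₀ m →
        Nat.card A ^ (n * n - 1) ≤ C * Nat.card ↥(S ^ (C * N)) ^ m := by
  obtain ⟨C, σ, h⟩ := larsen_pink.{0, 0} (n * n) (n * n - 1) (n + 1)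
    (n * (1 + (n + 1)) ^ (n * n - 1)) n m C₀
  refine ⟨C, 2 * wlen n * (σ + n) + (σ + n) + 5, fun F _ _ hQ S h1 hS N hN A hA hHB => ?_⟩
  exact h (AlgebraicClosure F) SL(n, F) (coord n F (AlgebraicClosure F))
    (lpData_coord hn (by omega) (by omega) (by omega)) S h1 hS N hN A hA hHB

/-- The elements of the torus of `P` two of whose eigenvalues agree. -/
def singular (F : Type*) [Field F] {K : Type*} [Field K] [Algebra F K]
    (P : Matrix (Fin n) (Fin n) K) (i j : Fin n) : Set SL(n, F) :=
  {x | ∃ ν, Diag P ν x ∧ ν i = ν j}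

/-- The regular elements of the torus of `P`. -/
def regular (F : Type*) [Field F] {K : Type*} [Field K] [Algebra F K]
    (P : Matrix (Fin n) (Fin n) K) : Set SL(n, F) :=
  {x | ∃ ν, Function.Injective ν ∧ Diag P ν x}

theorem larsen_pink_class_singular (hn : 0 < n) : ∃ C Q : ℕ, ∀ (F : Type) [Field F] [Finite F],
    Q ≤ Nat.card F → ∀ S : Set SL(n, F), 1 ∈ S → Subgroup.closure S = ⊤ → ∀ N, 1 ≤ N →
      (∀ A ⊆ S ^ N, ∀ lam, (∀ x ∈ A, ∃ P : Matrix (Fin n) (Fin n) (AlgebraicClosure F),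
        P.det ≠ 0 ∧ Diag P lam x) →
        Nat.card A ^ (n * n - 1) ≤ C * Nat.card ↥(S ^ (C * N)) ^ (n * (n - 1))) ∧
      ∀ P : Matrix (Fin n) (Fin n) (AlgebraicClosure F), P.det ≠ 0 → ∀ i j, i ≠ j →
        Nat.card ↥(S ^ N ∩ singular F P i j) ^ (n * n - 1) ≤
          C * Nat.card ↥(S ^ (C * N)) ^ (n - 2) := by
  obtain ⟨C₁, Q₁, h₁⟩ := larsen_pink_SL hn (n * (n - 1)) (n ^ n * (n + 1) ^ (n * (n - 1)))
  obtain ⟨C₂, Q₂, h₂⟩ := larsen_pink_SL hn (n - 2) (2 * n ^ n)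
  refine ⟨max C₁ C₂, max Q₁ Q₂, fun F _ _ hQ S h1 hS N hN => ?_⟩
  have hmono : ∀ {c}, c ≤ max C₁ C₂ →
      Nat.card ↥(S ^ (c * N)) ≤ Nat.card ↥(S ^ (max C₁ C₂ * N)) := fun {c} hc =>
    Nat.card_mono (Set.toFinite _) (pow_mono_of_one_mem h1 (Nat.mul_le_mul_right N hc))
  refine ⟨fun A hA lam hlam => ?_, fun P hP i j hij => ?_⟩
  · refine (h₁ F ((le_max_left _ _).trans hQ) S h1 hS N hN A hA (HB_class A lam hlam)).trans ?_
    exact Nat.mul_le_mul (le_max_left _ _) (Nat.pow_le_pow_left (hmono (le_max_left _ _)) _)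
  · refine (h₂ F ((le_max_right _ _).trans hQ) S h1 hS N hN _ Set.inter_subset_left
      (HB_torus_singular hP hij _ fun x hx => hx.2)).trans ?_
    exact Nat.mul_le_mul (le_max_right _ _) (Nat.pow_le_pow_left (hmono (le_max_right _ _)) _)

end LarsenPink

section Torus

variable {n : ℕ} {F : Type*} [Field F] {K : Type*} [Field K] [Algebra F K]

theorem inv_mem_pow {G : Type*} [Group G] {S : Set G} (hS : S⁻¹ = S) {x : G} {N : ℕ}
    (hx : x ∈ S ^ N) : x⁻¹ ∈ S ^ N := by
  have h : (S ^ N)⁻¹ = S ^ N := by rw [← inv_pow, hS]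
  rw [← h]
  exact Set.inv_mem_inv.2 hx

theorem card_pow_le_class_mul_torus [Finite F] {S : Set SL(n, F)} (hS : S⁻¹ = S)
    {P : Matrix (Fin n) (Fin n) K} (hP : P.det ≠ 0) {t : SL(n, F)} (ht : t ∈ regular F P) (N : ℕ) :
    Nat.card ↥(S ^ N) ≤ Nat.card ↥((fun x => x * t * x⁻¹) '' S ^ N) *
      Nat.card ↥(S ^ (2 * N) ∩ torus F P) := by
  obtain ⟨lam, hl, ht⟩ := ht
  refine card_le_mul_of_fiber (fun x : ↥(S ^ N) =>
    (⟨x.1 * t * x.1⁻¹, x.1, x.2, rfl⟩ : ↥((fun x => x * t * x⁻¹) '' S ^ N))) fun x => ?_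
  refine Nat.card_le_card_of_injective (fun y => ⟨x.1⁻¹ * y.1.1, ?_, ?_⟩) ?_
  · rw [two_mul, pow_add]
    exact Set.mul_mem_mul (inv_mem_pow hS x.2) y.1.2
  · have hy : y.1.1 * t * y.1.1⁻¹ = x.1 * t * x.1⁻¹ := congrArg Subtype.val y.2
    refine Diag.mem_torus_of_commute hP hl ht ?_
    have h1 := eq_mul_of_mul_inv_eq hy
    rw [mul_assoc, h1]
    group
  · intro y z h
    have : x.1⁻¹ * y.1.1 = x.1⁻¹ * z.1.1 := congrArg Subtype.val h
    exact Subtype.ext (Subtype.ext (mul_left_cancel this))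

theorem card_conj_mem_torus_le [Finite F] (hn : 0 < n) {P P' : Matrix (Fin n) (Fin n) K}
    (hP : P.det ≠ 0) (hP' : P'.det ≠ 0) {x : SL(n, F)} (hx : x ∈ regular F P') :
    Nat.card {g : SL(n, F) // g⁻¹ * x * g ∈ torus F P} ≤
      n ^ n * (n ^ n * (n * n) ^ (n - 1) * Nat.card F ^ (n - 1)) := by
  obtain ⟨lam, hl, hx⟩ := hx
  have h1 : ∀ g : {g : SL(n, F) // g⁻¹ * x * g ∈ torus F P}, ∃ s : Fin n → Fin n,
      Diag P (fun i => lam (s i)) (g.1⁻¹ * x * g.1) := by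
    rintro ⟨g, ν, hg⟩
    have h2 := hg.conj g
    have h3 : g * (g⁻¹ * x * g) * g⁻¹ = x := by group
    rw [h3] at h2
    have hu : IsUnit P'.det := hP'.isUnit
    set A := P'⁻¹ * (bc K g * P) with hA
    have hPA : P' * A = bc K g * P := by rw [hA, Matrix.mul_nonsing_inv_cancel_left _ _ hu]
    have hAdet : A.det ≠ 0 := by
      have := congrArg Matrix.det hPA
      rw [Matrix.det_mul, det_bc_mul] at this
      exact right_ne_zero_of_mul (this ▸ hP)
    have h4 : Matrix.diagonal lam * A = A * Matrix.diagonal ν := by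
      have h5 : P' * (Matrix.diagonal lam * A) = P' * (A * Matrix.diagonal ν) := by
        unfold Diag at hx h2
        rw [← mul_assoc, ← hx, mul_assoc, hPA, h2, ← hPA, mul_assoc]
      have h6 := congrArg (P'⁻¹ * ·) h5
      simpa only [Matrix.nonsing_inv_mul_cancel_left _ _ hu] using h6
    choose s hs using exists_entry_ne_zero hAdet
    refine ⟨s, ?_⟩
    have : (fun i => lam (s i)) = ν := by
      ext i
      have h5 := congrFun (congrFun h4 (s i)) i
      rw [Matrix.diagonal_mul, Matrix.mul_diagonal, mul_comm] at h5
      exact mul_left_cancel₀ (hs i) h5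
    rw [this]
    exact hg
  choose s hs using h1
  have hcard : Nat.card (Fin n → Fin n) = n ^ n := by simp
  have := card_le_mul_of_fiber s (k := n ^ n * (n * n) ^ (n - 1) * Nat.card F ^ (n - 1))
    fun g => ?_
  · rwa [hcard] at this
  refine le_trans ?_ (card_le_of_HB (torus F P') hn (HB_torus hn hP'))
  refine Nat.card_le_card_of_injective (fun h => ⟨h.1.1 * g.1⁻¹, ?_⟩) ?_
  · refine Diag.mem_torus_of_commute hP' hl hx ?_
    have h2 : h.1.1⁻¹ * x * h.1.1 = g.1⁻¹ * x * g.1 := by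
      have h3 := hs h.1
      rw [h.2] at h3
      exact h3.eq hP (hs g)
    have h4 : x * h.1.1 = h.1.1 * (g.1⁻¹ * x * g.1) := by rw [← h2]; group
    rw [← mul_assoc, h4]
    group
  · intro y z h
    have : y.1.1 * g.1⁻¹ = z.1.1 * g.1⁻¹ := congrArg Subtype.val h
    exact Subtype.ext (Subtype.ext (mul_right_cancel this))

theorem card_inter_torus_le [Finite F] (hn : 0 < n) (P : Matrix (Fin n) (Fin n) K) (A : Set SL(n, F)) {s : ℕ}
    (hs : ∀ i j, i ≠ j → 2 * (n * n) * Nat.card ↥(A ∩ singular F P i j) ≤ s)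
    (hA : s ≤ Nat.card ↥(A ∩ torus F P)) :
    s ≤ 2 * Nat.card ↥(A ∩ regular F P) := by
  classical
  have h1 : Nat.card ↥(A ∩ torus F P) ≤ Nat.card (↥(A ∩ regular F P) ⊕
      Σ p : {p : Fin n × Fin n // p.1 ≠ p.2}, ↥(A ∩ singular F P p.1.1 p.1.2)) := by
    refine Nat.card_le_card_of_injective (β := ↥(A ∩ regular F P) ⊕
      Σ p : {p : Fin n × Fin n // p.1 ≠ p.2}, ↥(A ∩ singular F P p.1.1 p.1.2)) (fun x =>
      if h : x.1 ∈ regular F P then Sum.inl ⟨x.1, x.2.1, h⟩ else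
      have h' : ∃ p : {p : Fin n × Fin n // p.1 ≠ p.2}, x.1 ∈ singular F P p.1.1 p.1.2 := by
        obtain ⟨ν, hν⟩ := x.2.2
        have h2 : ¬ Function.Injective ν := fun hi => h ⟨ν, hi, hν⟩
        rw [Function.not_injective_iff] at h2
        obtain ⟨i, j, hij, hne⟩ := h2
        exact ⟨⟨(i, j), hne⟩, ν, hν, hij⟩
      Sum.inr ⟨h'.choose, x.1, x.2.1, h'.choose_spec⟩) ?_
    intro x y hxy
    have h3 := congrArg (Sum.elim (fun z => z.1) fun z => z.2.1) hxy
    refine Subtype.ext ?_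
    dsimp only at h3
    split_ifs at h3 <;> exact h3
  rw [Nat.card_sum, Nat.card_sigma] at h1
  have h2 : 2 * (n * n) * ∑ p : {p : Fin n × Fin n // p.1 ≠ p.2},
      Nat.card ↥(A ∩ singular F P p.1.1 p.1.2) ≤ (n * n) * s := by
    rw [Finset.mul_sum]
    refine (Finset.sum_le_card_nsmul _ _ s fun p _ => hs _ _ p.2).trans ?_
    rw [smul_eq_mul]
    refine Nat.mul_le_mul_right _ ?_
    rw [Finset.card_univ]
    refine (Fintype.card_subtype_le _).trans ?_
    simp
  have h3 : 0 < n * n := Nat.mul_pos hn hn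
  have h4 : 2 * ∑ p : {p : Fin n × Fin n // p.1 ≠ p.2},
      Nat.card ↥(A ∩ singular F P p.1.1 p.1.2) ≤ s := by
    refine Nat.le_of_mul_le_mul_left (le_trans (le_of_eq ?_) h2) h3
    ring
  omega

end Torus

section Pivot

variable {n : ℕ} {F : Type*} [Field F] {K : Type*} [Field K] [Algebra F K]

theorem conj_mem_regular {P : Matrix (Fin n) (Fin n) K} {x : SL(n, F)} (hx : x ∈ regular F P)
    (g : SL(n, F)) : g * x * g⁻¹ ∈ regular F (bc K g * P) := by
  obtain ⟨ν, hν, h⟩ := hx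
  exact ⟨ν, hν, h.conj g⟩

theorem inv_conj_mem_torus {P : Matrix (Fin n) (Fin n) K} {x g : SL(n, F)}
    (hx : x ∈ regular F (bc K g * P)) : g⁻¹ * x * g ∈ torus F P := by
  obtain ⟨ν, -, h⟩ := hx
  have h1 := h.conj g⁻¹
  rw [← mul_assoc, ← bc_mul, inv_mul_cancel, bc_one (K := K) (F := F), one_mul,
    inv_inv] at h1
  exact ⟨ν, h1⟩

theorem card_mul_le_of_regular [Finite F] (hn : 0 < n) {P : Matrix (Fin n) (Fin n) K}
    (hP : P.det ≠ 0) (A : Set SL(n, F)) {ρ : ℕ}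
    (hρ : ∀ g : SL(n, F), ρ ≤ Nat.card ↥(A ∩ regular F (bc K g * P))) :
    Nat.card SL(n, F) * ρ ≤
      Nat.card A * (n ^ n * (n ^ n * (n * n) ^ (n - 1)) * Nat.card F ^ (n - 1)) := by
  classical
  have := Fintype.ofFinite SL(n, F)
  have := Fintype.ofFinite A
  have h1 : Nat.card (Σ g : SL(n, F), ↥(A ∩ regular F (bc K g * P))) ≤
      Nat.card (Σ x : A, {g : SL(n, F) // g⁻¹ * x.1 * g ∈ torus F P ∧
        ∃ g' : SL(n, F), x.1 ∈ regular F (bc K g' * P)}) := by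
    refine Nat.card_le_card_of_injective (fun p => ⟨⟨p.2.1, p.2.2.1⟩, p.1,
      inv_conj_mem_torus p.2.2.2, p.1, p.2.2.2⟩) ?_
    rintro ⟨g, x, hx⟩ ⟨g', x', hx'⟩ h
    have h2 : x = x' := congrArg (fun p => p.1.1) h
    have h3 : g = g' := congrArg (fun p => p.2.1) h
    subst h2 h3
    rfl
  rw [Nat.card_sigma, Nat.card_sigma] at h1
  rw [Nat.card_eq_fintype_card (α := SL(n, F)), Nat.card_eq_fintype_card (α := A),
    ← Finset.card_univ, ← Finset.card_univ, ← smul_eq_mul, ← smul_eq_mul (a := Finset.card _)]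
  refine (Finset.card_nsmul_le_sum _ _ _ fun g _ => hρ g).trans (h1.trans ?_)
  refine Finset.sum_le_card_nsmul _ _ _ fun x _ => ?_
  by_cases hx : ∃ g' : SL(n, F), x.1 ∈ regular F (bc K g' * P)
  · obtain ⟨g', hg'⟩ := hx
    have h2 := card_conj_mem_torus_le hn hP (by rwa [det_bc_mul]) hg'
    rw [← mul_assoc] at h2
    exact (Nat.card_le_card_of_injective (fun g => ⟨g.1, g.2.1⟩) fun a b h =>
      Subtype.ext (by simpa using h)).trans h2
  · have : IsEmpty {g : SL(n, F) // g⁻¹ * x.1 * g ∈ torus F P ∧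
        ∃ g' : SL(n, F), x.1 ∈ regular F (bc K g' * P)} := ⟨fun g => hx g.2.2⟩
    simp

theorem card_regular_of_mem [Finite F] (hn : 2 ≤ n) {S : Set SL(n, F)} (hS : S⁻¹ = S)
    {P : Matrix (Fin n) (Fin n) K} (hP : P.det ≠ 0) {N B C R : ℕ}
    (hclass : ∀ A ⊆ S ^ (6 * N), ∀ lam, (∀ x ∈ A, ∃ P : Matrix (Fin n) (Fin n) K,
      P.det ≠ 0 ∧ Diag P lam x) → Nat.card A ^ (n * n - 1) ≤ C * B ^ (n * (n - 1)))
    (hsing : ∀ i j, i ≠ j →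
      Nat.card ↥(S ^ (2 * N) ∩ singular F P i j) ^ (n * n - 1) ≤ C * B ^ (n - 2))
    (hR : 2 * (n * n - 1) ≤ R) (hB : B ^ R ≤ Nat.card ↥(S ^ N) ^ (R + 1))
    (ha : ((2 * (n * n)) ^ (n * n - 1) * C * C) ^ 2 < Nat.card ↥(S ^ N))
    {t : SL(n, F)} (ht : t ∈ S ^ (4 * N)) (htP : t ∈ regular F P) :
    Nat.card ↥(S ^ N) ^ (n * n - 1) ≤ 2 ^ (n * n - 1) * (C * B ^ (n * (n - 1))) *
      Nat.card ↥(S ^ (2 * N) ∩ regular F P) ^ (n * n - 1) := by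
  have h1 := card_pow_le_class_mul_torus hS hP htP N
  set κ := Nat.card ↥((fun x => x * t * x⁻¹) '' S ^ N)
  set τ := Nat.card ↥(S ^ (2 * N) ∩ torus F P) with hτ
  set a := Nat.card ↥(S ^ N)
  have hd : n * n - 1 = n * (n - 1) + (n - 2) + 1 := by
    obtain ⟨m, rfl⟩ : ∃ m, n = m + 2 := ⟨n - 2, by omega⟩
    simp only [Nat.add_sub_cancel, show m + 2 - 1 = m + 1 by omega]
    have : (m + 2) * (m + 2) = (m + 2) * (m + 1) + m + 1 + 1 := by ring
    omega
  have hκ : κ ^ (n * n - 1) ≤ C * B ^ (n * (n - 1)) := by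
    obtain ⟨lam, hl, htl⟩ := htP
    refine hclass _ ?_ lam ?_
    · rintro _ ⟨x, hx, rfl⟩
      have : 6 * N = N + 4 * N + N := by ring
      rw [this, pow_add, pow_add]
      exact Set.mul_mem_mul (Set.mul_mem_mul hx ht) (inv_mem_pow hS hx)
    · rintro _ ⟨x, hx, rfl⟩
      exact ⟨bc K x * P, by rwa [det_bc_mul], htl.conj x⟩
  have h2 : ∀ i j, i ≠ j →
      2 * (n * n) * Nat.card ↥(S ^ (2 * N) ∩ singular F P i j) ≤ τ := by
    intro i j hij
    by_contra hcon
    push Not at hcon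
    refine absurd (le_sq_of_pow_le (a := a) (B := B) (R := R) (d := n * n - 1) (by omega)
      (by omega) hR hB ?_) (not_le.2 ha)
    set s := Nat.card ↥(S ^ (2 * N) ∩ singular F P i j)
    calc a ^ (n * n - 1) ≤ (κ * (2 * (n * n) * s)) ^ (n * n - 1) :=
          Nat.pow_le_pow_left (h1.trans (Nat.mul_le_mul_left _ hcon.le)) _
      _ = (2 * (n * n)) ^ (n * n - 1) * κ ^ (n * n - 1) * s ^ (n * n - 1) := by ring
      _ ≤ (2 * (n * n)) ^ (n * n - 1) * (C * B ^ (n * (n - 1))) * (C * B ^ (n - 2)) := by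
          gcongr
          exact hsing i j hij
      _ = (2 * (n * n)) ^ (n * n - 1) * C * C * B ^ (n * (n - 1) + (n - 2)) := by ring
      _ = _ := by
          have : n * n - 1 - 1 = n * (n - 1) + (n - 2) := by omega
          rw [this]
  have h3 := card_inter_torus_le (by omega) P (S ^ (2 * N)) h2 le_rfl
  set ρ := Nat.card ↥(S ^ (2 * N) ∩ regular F P)
  calc a ^ (n * n - 1) ≤ (κ * (2 * ρ)) ^ (n * n - 1) :=
        Nat.pow_le_pow_left (h1.trans (Nat.mul_le_mul_left _ h3)) _
    _ = 2 ^ (n * n - 1) * κ ^ (n * n - 1) * ρ ^ (n * n - 1) := by ring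
    _ ≤ _ := by gcongr

/-- A power of a generating set which does not grow has nearly full size. -/
theorem card_pow_large (hn : 2 ≤ n) : ∃ c R Q : ℕ, 2 ≤ c ∧ 1 ≤ R ∧ ∀ (F : Type) [Field F]
    [Finite F], Q ≤ Nat.card F → ∀ S : Set SL(n, F), S⁻¹ = S → 1 ∈ S → Subgroup.closure S = ⊤ →
      ∀ N, Q ≤ N → Q ≤ Nat.card ↥(S ^ N) →
        Nat.card ↥(S ^ (c * N)) ^ R ≤ Nat.card ↥(S ^ N) ^ (R + 1) →
        Nat.card F ^ (4 * (n * n - 1) - 1) ≤ Nat.card ↥(S ^ N) ^ 4 := by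
  have hn0 : 0 < n := by omega
  obtain ⟨C, Q₁, hLP⟩ := larsen_pink_class_singular hn0
  obtain ⟨M, hM⟩ := exists_regular.{0, 0} hn0
  set d := n * n - 1 with hd
  set e := n * (n - 1) with he
  have hde : d = e + (n - 1) := by
    obtain ⟨m, rfl⟩ : ∃ m, n = m + 2 := ⟨n - 2, by omega⟩
    simp only [hd, he, show m + 2 - 1 = m + 1 by omega]
    have : (m + 2) * (m + 2) = (m + 2) * (m + 1) + (m + 1) + 1 := by ring
    omega
  have he0 : 0 < e := Nat.mul_pos hn0 (by omega)
  have hd0 : 0 < d := by omega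
  set R := 8 * d * (e + d) with hR
  have hR2 : 2 * d ≤ R := by
    rw [hR]
    calc 2 * d ≤ 8 * d * 1 := by omega
      _ ≤ _ := Nat.mul_le_mul_left _ (by omega)
  set C₁ := n ^ n * (n ^ n * (n * n) ^ (n - 1)) with hC₁
  set Z := ((2 ^ (n * d + d) * C * C₁ ^ d) ^ R * 2 ^ (e + d)) ^ 8 with hZ
  refine ⟨6 * C + 2, R, Q₁ + M + n * n + 2 + ((2 * (n * n)) ^ d * C * C) ^ 2 + Z, by omega,
    by omega, ?_⟩
  intro F _ _ hq S hS h1 hgen N hN ha hB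
  set B := Nat.card ↥(S ^ ((6 * C + 2) * N)) with hBdef
  set a := Nat.card ↥(S ^ N) with hadef
  have ha0 : 0 < a := by omega
  have hmono : ∀ {k}, k ≤ (6 * C + 2) * N → Nat.card ↥(S ^ k) ≤ B := fun {k} hk =>
    Nat.card_mono (Set.toFinite _) (pow_mono_of_one_mem h1 hk)
  have hC6 : C * (6 * N) ≤ (6 * C + 2) * N := by nlinarith
  have hC2 : C * (2 * N) ≤ (6 * C + 2) * N := by nlinarith
  have h2N : 2 * N ≤ (6 * C + 2) * N := by nlinarith
  have hclass := (hLP F (by omega) S h1 hgen (6 * N) (by omega)).1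
  have hsing := (hLP F (by omega) S h1 hgen (2 * N) (by omega)).2
  obtain ⟨t₀, ht₀, P, lam, hP, hlam, htlam⟩ :=
    hM F (AlgebraicClosure F) (by omega) S h1 hgen
  have key : ∀ Q : Matrix (Fin n) (Fin n) (AlgebraicClosure F), Q.det ≠ 0 →
      (∃ t ∈ S ^ (4 * N), t ∈ regular F Q) → a ^ d ≤ 2 ^ d * (C * B ^ e) *
        Nat.card ↥(S ^ (2 * N) ∩ regular F Q) ^ d := by
    rintro Q hQ ⟨t, ht, htQ⟩
    refine card_regular_of_mem hn hS hQ (fun A hA lam hx => (hclass A hA lam hx).trans ?_)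
      (fun i j hij => (hsing Q hQ i j hij).trans ?_) hR2 hB
      (show ((2 * (n * n)) ^ d * C * C) ^ 2 < a by omega) ht htQ
    · exact Nat.mul_le_mul_left _ (Nat.pow_le_pow_left (hmono hC6) _)
    · exact Nat.mul_le_mul_left _ (Nat.pow_le_pow_left (hmono hC2) _)
  have hall : ∀ j, ∀ g ∈ S ^ j, ∃ t ∈ S ^ (4 * N), t ∈ regular F (bc (AlgebraicClosure F) g * P) := by
    intro j
    induction j with
    | zero =>
      intro g hg
      rw [pow_zero, Set.mem_one] at hg
      subst hg
      refine ⟨t₀, pow_mono_of_one_mem h1 (by omega) ht₀, lam, hlam, ?_⟩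
      rwa [bc_one (K := AlgebraicClosure F) (F := F), one_mul]
    | succ j ih =>
      intro g hg
      rw [pow_succ'] at hg
      obtain ⟨s, hs, g', hg', rfl⟩ := hg
      have h2 := key _ (by rwa [det_bc_mul]) (ih g' hg')
      have h3 : 0 < Nat.card ↥(S ^ (2 * N) ∩ regular F (bc (AlgebraicClosure F) g' * P)) := by
        by_contra h0
        rw [Nat.eq_zero_of_not_pos h0, zero_pow hd0.ne', mul_zero] at h2
        exact absurd (pow_pos ha0 d) (by omega)
      obtain ⟨⟨t, ht, htr⟩⟩ := (Nat.card_pos_iff.1 h3).1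
      refine ⟨s * t * s⁻¹, ?_, ?_⟩
      · refine pow_mono_of_one_mem h1 (show 1 + 2 * N + 1 ≤ 4 * N by omega) ?_
        rw [pow_add, pow_add, pow_one]
        refine Set.mul_mem_mul (Set.mul_mem_mul hs ht) ?_
        simpa using inv_mem_pow hS (N := 1) (by simpa using hs)
      · have h4 := conj_mem_regular htr s
        rwa [← mul_assoc, ← bc_mul] at h4
  obtain ⟨g₀, hg₀⟩ := Finite.exists_min fun g : SL(n, F) =>
    Nat.card ↥(S ^ (2 * N) ∩ regular F (bc (AlgebraicClosure F) g * P))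
  have h5 := card_mul_le_of_regular hn0 hP (S ^ (2 * N)) hg₀
  obtain ⟨j, hj⟩ := mem_pow_of_closure_eq_top hgen g₀
  have h6 := key _ (by rwa [det_bc_mul]) (hall j g₀ hj)
  exact pow_le_of_pivot he0 hde ha0 hR hB (Nat.card_le_card_of_injective _ Subtype.val_injective)
    (card_SL_le hn0) (le_card_SL hn0)
    (h5.trans (Nat.mul_le_mul_right _ (hmono h2N))) h6
    (show Z ≤ Nat.card F by omega) (by omega)

end Pivot

section SumProduct

theorem card_sq_le_card_image_mul {α β : Type*} [DecidableEq α] [DecidableEq β] (P : Finset α)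
    (f : α → β) : P.card ^ 2 ≤
      (P.image f).card * ((P ×ˢ P).filter fun p => f p.1 = f p.2).card := by
  have h1 : ((P ×ˢ P).filter fun p => f p.1 = f p.2).card =
      ∑ t ∈ P.image f, (P.filter fun p => f p = t).card ^ 2 := by
    rw [Finset.card_eq_sum_card_fiberwise (f := fun p => f p.1) (t := P.image f)]
    · refine Finset.sum_congr rfl fun t _ => ?_
      rw [sq, ← Finset.card_product]
      congr 1
      ext p
      simp only [Finset.mem_filter, Finset.mem_product]
      grind
    · intro p hp
      simp only [Finset.coe_filter, Finset.mem_product, Set.mem_ofPred_eq] at hp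
      exact Finset.mem_coe.2 (Finset.mem_image_of_mem f hp.1.1)
  rw [h1, Finset.card_eq_sum_card_image f P]
  exact sq_sum_le_card_mul_sum_sq

variable {F : Type*} [Field F] [Fintype F] [DecidableEq F]

theorem sum_energy_le (P : Finset (F × F)) :
    ∑ x : F, ((P ×ˢ P).filter fun p => p.1.1 + x * p.1.2 = p.2.1 + x * p.2.2).card ≤
      Fintype.card F * P.card + P.card ^ 2 := by
  simp only [Finset.card_filter]
  rw [Finset.sum_comm]
  have h1 : ∀ p ∈ P ×ˢ P,
      (∑ x : F, if p.1.1 + x * p.1.2 = p.2.1 + x * p.2.2 then 1 else 0) ≤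
        (if p.1 = p.2 then Fintype.card F else 0) + 1 := by
    intro p _
    rw [← Finset.card_filter]
    split_ifs with h
    · exact (Finset.card_le_univ _).trans (Nat.le_succ _)
    · rw [zero_add, Finset.card_le_one]
      intro a ha b hb
      rw [Finset.mem_filter] at ha hb
      have h2 : (a - b) * (p.1.2 - p.2.2) = 0 := by linear_combination ha.2 - hb.2
      rcases mul_eq_zero.1 h2 with h3 | h3
      · exact sub_eq_zero.1 h3
      · refine absurd (Prod.ext ?_ (sub_eq_zero.1 h3)) h
        linear_combination ha.2 - a * h3
  refine (Finset.sum_le_sum h1).trans (le_of_eq ?_)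
  rw [Finset.sum_add_distrib, Finset.sum_const, Finset.card_product, smul_eq_mul, mul_one, sq,
    Finset.sum_ite, Finset.sum_const_zero, add_zero, Finset.sum_const, smul_eq_mul, mul_comm]
  congr 2
  refine Finset.card_bij' (fun p _ => p.1) (fun p _ => (p, p)) ?_ ?_ ?_ ?_ <;>
    simp +contextual [Finset.mem_filter]

theorem exists_add_mul_surjective (X Y Z : Finset F)
    (h : Fintype.card F ^ 2 < X.card * (Y.card * Z.card)) :
    ∃ x ∈ X, ∀ t : F, ∃ y ∈ Y, ∃ z ∈ Z, ∃ y' ∈ Y, ∃ z' ∈ Z, t = (y + x * z) + (y' + x * z') := by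
  set q := Fintype.card F
  set P := Y ×ˢ Z with hP
  rw [← Finset.card_product, ← hP] at h
  set E : F → ℕ := fun x =>
    ((P ×ˢ P).filter fun p => p.1.1 + x * p.1.2 = p.2.1 + x * p.2.2).card with hE
  have hcs : ∀ x, P.card ^ 2 ≤ (P.image fun p => p.1 + x * p.2).card * E x := fun x =>
    card_sq_le_card_image_mul P fun p => p.1 + x * p.2
  have hcs' : ∀ x, P.card ^ 2 ≤ q * E x := fun x =>
    (hcs x).trans (Nat.mul_le_mul_right _ (Finset.card_le_univ _))
  have hP0 : 0 < P.card := Nat.pos_of_ne_zero fun h0 => by simp [h0] at h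
  have hex : ∃ x ∈ X, q * E x < 2 * P.card ^ 2 := by
    by_contra hcon
    push Not at hcon
    have h1 : ∑ x : F, (P.card ^ 2 + if x ∈ X then P.card ^ 2 else 0) ≤ ∑ x : F, q * E x := by
      refine Finset.sum_le_sum fun x _ => ?_
      split_ifs with hx
      · have := hcon x hx; omega
      · exact hcs' x
    rw [← Finset.mul_sum, Finset.sum_add_distrib, Finset.sum_const, Finset.sum_ite,
      Finset.sum_const, Finset.sum_const_zero, Finset.filter_mem_eq_inter, Finset.univ_inter,
      smul_eq_mul, smul_eq_mul, Finset.card_univ] at h1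
    have h2 := h1.trans (Nat.mul_le_mul_left q (sum_energy_le P))
    have h3 : X.card * P.card * P.card ≤ q ^ 2 * P.card := by
      have : q * P.card ^ 2 + (X.card * P.card ^ 2 + 0) ≤ q * (q * P.card + P.card ^ 2) := h2
      nlinarith
    exact absurd (Nat.le_of_mul_le_mul_right h3 hP0) (not_le.2 h)
  obtain ⟨x, hx, hlt⟩ := hex
  refine ⟨x, hx, fun t => ?_⟩
  set I := P.image fun p => p.1 + x * p.2 with hI
  have hIq : q < 2 * I.card := by
    have h1 : q * P.card ^ 2 ≤ I.card * (q * E x) := by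
      calc q * P.card ^ 2 ≤ q * (I.card * E x) := Nat.mul_le_mul_left _ (hcs x)
        _ = _ := by ring
    have hI0 : 0 < I.card := by
      refine Nat.pos_of_ne_zero fun h0 => ?_
      have := hcs x
      rw [← hI, h0, zero_mul] at this
      exact absurd (pow_pos hP0 2) (by omega)
    have h2 : q * P.card ^ 2 < 2 * I.card * P.card ^ 2 := by
      calc q * P.card ^ 2 ≤ I.card * (q * E x) := h1
        _ < I.card * (2 * P.card ^ 2) := Nat.mul_lt_mul_of_pos_left hlt hI0
        _ = _ := by ring
    exact lt_of_mul_lt_mul_right h2 (Nat.zero_le _)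
  have hne : (I ∩ I.image fun s => t - s).Nonempty := by
    rw [← Finset.card_pos]
    have h1 := Finset.card_union_add_card_inter I (I.image fun s => t - s)
    rw [Finset.card_image_of_injective _ (sub_right_injective)] at h1
    have h2 : (I ∪ I.image fun s => t - s).card ≤ q := Finset.card_le_univ _
    omega
  obtain ⟨s, hs⟩ := hne
  obtain ⟨hs1, hs2⟩ := Finset.mem_inter.1 hs
  obtain ⟨s', hs', rfl⟩ := Finset.mem_image.1 hs2
  obtain ⟨⟨y, z⟩, hyz, hyz'⟩ := Finset.mem_image.1 hs1
  obtain ⟨⟨y', z'⟩, hyz₁, hyz₁'⟩ := Finset.mem_image.1 hs'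
  rw [hP, Finset.mem_product] at hyz hyz₁
  refine ⟨y, hyz.1, z, hyz.2, y', hyz₁.1, z', hyz₁.2, ?_⟩
  dsimp only at hyz' hyz₁'
  rw [hyz', hyz₁', sub_add_cancel]

end SumProduct

section Full

open Matrix.SpecialLinearGroup

theorem card_mul_card_le_of_monoidHom {G H : Type*} [Group G] [Group H] [Finite G] [Finite H]
    (φ : H →* G) (A : Set G) :
    Nat.card A * Nat.card H ≤ Nat.card G * Nat.card ({h | φ h ∈ A⁻¹ * A} : Set H) := by
  rw [← Nat.card_prod]
  refine card_le_mul_of_fiber (fun p : A × H => p.1.1 * φ p.2) fun p₀ => ?_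
  have key : ∀ p : A × H, p.1.1 * φ p.2 = p₀.1.1 * φ p₀.2 →
      φ (p.2 * p₀.2⁻¹) = p.1.1⁻¹ * p₀.1.1 := by
    intro p hp
    rw [map_mul, map_inv, mul_inv_eq_iff_eq_mul, mul_assoc, ← hp, inv_mul_cancel_left]
  refine Nat.card_le_card_of_injective (fun p => (⟨p.1.2 * p₀.2⁻¹, ?_⟩ :
    ({h | φ h ∈ A⁻¹ * A} : Set H))) ?_
  · change φ (p.1.2 * p₀.2⁻¹) ∈ A⁻¹ * A
    rw [key p.1 p.2]
    exact Set.mul_mem_mul (Set.inv_mem_inv.2 p.1.1.2) p₀.1.2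
  · rintro ⟨⟨⟨x, hx⟩, h⟩, hp⟩ ⟨⟨⟨x', hx'⟩, h'⟩, hp'⟩ heq
    have h1 : h = h' := mul_right_cancel (congrArg Subtype.val heq)
    subst h1
    have h2 : x = x' := mul_right_cancel (hp.trans hp'.symm)
    subst h2
    rfl

variable {n : ℕ} {F : Type*} [Field F]

/-- The root subgroup of transvections at position `(i, j)`. -/
def transvectionHom {i j : Fin n} (hij : i ≠ j) : Multiplicative F →* SL(n, F) where
  toFun b := transvection hij b.toAdd
  map_one' := transvection_coeff_zero hij
  map_mul' a b := transvection_add hij a.toAdd b.toAdd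

/-- The one-parameter diagonal subgroup at positions `i` and `j`. -/
noncomputable def diagHom {i j : Fin n} (hij : i ≠ j) : Fˣ →* SL(n, F) where
  toFun a := diag2n hij a.1 a.ne_zero
  map_one' := by
    ext r s
    simp [diag2n_coe, Matrix.one_apply, Matrix.diagonal_apply]
  map_mul' a b := by
    ext r s
    rw [coe_mul, diag2n_coe, diag2n_coe, diag2n_coe, Matrix.diagonal_mul_diagonal]
    congr 2
    ext k
    split_ifs <;> simp [mul_comm]

theorem card_le_two_mul_card_sq [Finite F] (T : Set Fˣ) :
    Nat.card T ≤ Nat.card ↥((fun a : Fˣ => (a : F) ^ 2) '' T) * 2 := by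
  classical
  refine card_le_mul_of_fiber (fun a : T => (⟨(a.1 : F) ^ 2, a.1, a.2, rfl⟩ :
    ↥((fun a : Fˣ => (a : F) ^ 2) '' T))) fun a => ?_
  have : Nat.card ({(a.1 : F), -(a.1 : F)} : Finset F) ≤ 2 := by
    rw [Nat.card_eq_fintype_card, Fintype.card_coe]; exact Finset.card_le_two
  refine (Nat.card_le_card_of_injective (fun b => (⟨(b.1.1 : F), ?_⟩ :
    ({(a.1 : F), -(a.1 : F)} : Finset F))) ?_).trans this
  · have h1 := congrArg Subtype.val b.2
    simpa using sq_eq_sq_iff_eq_or_eq_neg.1 h1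
  · intro b c h
    have h1 : (b.1.1 : F) = c.1.1 := congrArg Subtype.val h
    exact Subtype.ext (Subtype.ext (Units.ext h1))

theorem pow_eq_univ_of_large [Finite F] (hn : 2 ≤ n) (hq : 2 ^ 20 < Nat.card F)
    {S : Set SL(n, F)} (hS : S⁻¹ = S) (h1 : 1 ∈ S) {N : ℕ}
    (hN : Nat.card F ^ (4 * (n * n - 1) - 1) ≤ Nat.card ↥(S ^ N) ^ 4) :
    S ^ (16 * N * ((n + 2) * n)) = Set.univ := by
  classical
  have := Fintype.ofFinite F
  set q := Nat.card F with hqdef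
  have hq0 : 0 < q := by omega
  set a := Nat.card ↥(S ^ N)
  have hinv : (S ^ N)⁻¹ * S ^ N = S ^ (2 * N) := by
    rw [← inv_pow, hS, ← pow_add, two_mul]
  obtain ⟨d, hd⟩ : ∃ d, n * n - 1 = d + 1 := ⟨n * n - 2, by
    have := Nat.mul_le_mul hn hn; omega⟩
  have hG := card_SL_le (F := F) (n := n) (by omega)
  rw [hd] at hN hG
  have hexp : 4 * (d + 1) - 1 = 4 * d + 3 := by omega
  rw [hexp] at hN
  suffices helem : elems n F ⊆ S ^ (16 * N) by
    rw [pow_mul]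
    rw [← Set.univ_subset_iff, ← elems_pow_eq_univ (n := n) (F := F)]
    exact Set.pow_subset_pow_left helem
  rintro g (rfl | ⟨i, j, hij, t, rfl⟩)
  · exact Set.one_mem_pow h1
  have hY := card_mul_card_le_of_monoidHom (transvectionHom (F := F) hij) (S ^ N)
  have hT := card_mul_card_le_of_monoidHom (diagHom (F := F) hij) (S ^ N)
  rw [hinv] at hY hT
  have hX := card_le_two_mul_card_sq {h : Fˣ | diagHom hij h ∈ S ^ (2 * N)}
  set T := {h : Fˣ | diagHom hij h ∈ S ^ (2 * N)}
  let Y : Finset F := Finset.univ.filter fun b => transvection hij b ∈ S ^ (2 * N)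
  let X : Finset F := ((fun a : Fˣ => (a : F) ^ 2) '' T).toFinset
  have hYc : Nat.card ({h | transvectionHom hij h ∈ S ^ (2 * N)} : Set (Multiplicative F)) = Y.card := by
    rw [← Fintype.card_coe, ← Nat.card_eq_fintype_card]
    refine Nat.card_congr (Multiplicative.toAdd.subtypeEquiv fun b => ?_)
    simp [Y, transvectionHom]
  have hXc : Nat.card ↥((fun a : Fˣ => (a : F) ^ 2) '' T) = X.card := by
    rw [Set.toFinset_card, Nat.card_eq_fintype_card]
  have hFu : Nat.card Fˣ + 1 = q := by
    rw [hqdef, Nat.card_units]; omega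
  rw [hYc] at hY
  rw [hXc] at hX
  have hq' : Nat.card (Multiplicative F) = q := rfl
  rw [hq'] at hY
  have hY4 : q ^ 3 ≤ 16 * Y.card ^ 4 := by
    have h2 : a * q ≤ 2 * q ^ (d + 1) * Y.card := hY.trans (Nat.mul_le_mul_right _ hG)
    have h3 := Nat.pow_le_pow_left h2 4
    refine Nat.le_of_mul_le_mul_left (c := q ^ (4 * d + 4)) ?_ (pow_pos hq0 _)
    calc q ^ (4 * d + 4) * q ^ 3 = q ^ (4 * d + 3) * q ^ 4 := by ring
      _ ≤ a ^ 4 * q ^ 4 := Nat.mul_le_mul_right _ hN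
      _ = (a * q) ^ 4 := by ring
      _ ≤ _ := h3
      _ = _ := by ring
  have hX4 : q ^ 3 ≤ 4096 * X.card ^ 4 := by
    have h2 : a * Nat.card Fˣ ≤ 2 * q ^ (d + 1) * (X.card * 2) :=
      hT.trans (Nat.mul_le_mul hG hX)
    have h2' : a * q ≤ 8 * q ^ (d + 1) * X.card := by
      calc a * q ≤ a * (2 * Nat.card Fˣ) := Nat.mul_le_mul_left _ (by omega)
        _ = 2 * (a * Nat.card Fˣ) := by ring
        _ ≤ 2 * _ := Nat.mul_le_mul_left _ h2
        _ = _ := by ring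
    have h3 := Nat.pow_le_pow_left h2' 4
    refine Nat.le_of_mul_le_mul_left (c := q ^ (4 * d + 4)) ?_ (pow_pos hq0 _)
    calc q ^ (4 * d + 4) * q ^ 3 = q ^ (4 * d + 3) * q ^ 4 := by ring
      _ ≤ a ^ 4 * q ^ 4 := Nat.mul_le_mul_right _ hN
      _ = (a * q) ^ 4 := by ring
      _ ≤ _ := h3
      _ = _ := by ring
  have hXYZ : Fintype.card F ^ 2 < X.card * (Y.card * Y.card) := by
    rw [← Nat.card_eq_fintype_card]
    refine lt_of_pow_lt_pow_left₀ 4 (Nat.zero_le _) ?_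
    refine lt_of_mul_lt_mul_left (a := 2 ^ 20) ?_ (Nat.zero_le _)
    calc 2 ^ 20 * (q ^ 2) ^ 4 < q * (q ^ 2) ^ 4 :=
          Nat.mul_lt_mul_of_pos_right hq (by positivity)
      _ = q ^ 3 * (q ^ 3 * q ^ 3) := by ring
      _ ≤ (4096 * X.card ^ 4) * ((16 * Y.card ^ 4) * (16 * Y.card ^ 4)) := by gcongr
      _ = _ := by ring
  obtain ⟨x, hx, hsurj⟩ := exists_add_mul_surjective X Y Y hXYZ
  rw [Set.mem_toFinset] at hx
  obtain ⟨u, hu, rfl⟩ := hx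
  have hYm : ∀ {b}, b ∈ Y → transvection hij b ∈ S ^ (2 * N) := fun {b} hb =>
    (Finset.mem_filter.1 hb).2
  have hone : ∀ y ∈ Y, ∀ z ∈ Y, transvection hij (y + (u : F) ^ 2 * z) ∈ S ^ (8 * N) := by
    intro y hy z hz
    rw [transvection_add, ← diag2n_mul_transvection hij u.1 u.ne_zero,
      show 8 * N = 2 * N + (2 * N + 2 * N + 2 * N) by ring, pow_add, pow_add, pow_add]
    exact Set.mul_mem_mul (hYm hy) (Set.mul_mem_mul (Set.mul_mem_mul hu (hYm hz))
      (inv_mem_pow hS hu))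
  obtain ⟨y, hy, z, hz, y', hy', z', hz', rfl⟩ := hsurj t
  rw [transvection_add, show 16 * N = 8 * N + 8 * N by ring, pow_add]
  exact Set.mul_mem_mul (hone y hy z hz) (hone y' hy' z' hz')

end Full

section Iteration

variable {G : Type*} [Group G]

theorem pow_eq_univ_or_lt_card [Finite G] {S : Set G} (h1 : 1 ∈ S) (hS : Subgroup.closure S = ⊤)
    (k : ℕ) : S ^ k = Set.univ ∨ k < Nat.card ↥(S ^ k) := by
  induction k with
  | zero =>
    right
    have : Nonempty ↥(S ^ 0) := ⟨⟨1, Set.one_mem_pow h1⟩⟩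
    exact Nat.card_pos
  | succ k ih =>
    have hsub : S ^ k ⊆ S ^ (k + 1) := pow_mono_of_one_mem h1 (Nat.le_succ k)
    rcases ih with h | h
    · exact Or.inl (Set.eq_univ_of_univ_subset (h ▸ hsub))
    by_cases heq : S ^ (k + 1) = S ^ k
    · left
      have hst : ∀ j, S ^ (k + j) = S ^ k := by
        intro j
        induction j with
        | zero => rfl
        | succ j ih => rw [← add_assoc, pow_succ, ih, ← pow_succ, heq]
      refine Set.eq_univ_of_forall fun x => ?_
      obtain ⟨j, hj⟩ := mem_pow_of_closure_eq_top hS x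
      rw [heq, ← hst j]
      exact pow_mono_of_one_mem h1 (Nat.le_add_left _ _) hj
    · right
      have := Set.ncard_lt_ncard (hsub.ssubset_of_ne (Ne.symm heq)) (Set.toFinite _)
      rw [← Nat.card_coe_set_eq, ← Nat.card_coe_set_eq] at this
      omega

theorem exists_pow_eq_univ_of_growth [Finite G] {S : Set G} (h1 : 1 ∈ S)
    (hS : Subgroup.closure S = ⊤) {c R Q C : ℕ} (hc : 2 ≤ c) (hR : 1 ≤ R) (hQ : 3 ≤ Q) (hC : 1 ≤ C)
    (hg : ∀ N, Q ≤ N → Q ≤ Nat.card ↥(S ^ N) →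
      Nat.card ↥(S ^ (c * N)) ^ R ≤ Nat.card ↥(S ^ N) ^ (R + 1) → S ^ (C * N) = Set.univ) :
    ∃ k : ℕ, S ^ k = Set.univ ∧ (k : ℝ) ≤ C * Q *
      (max 1 (Real.log (Nat.card G))) ^ (Real.log c / Real.log ((R + 1) / R : ℝ)) := by
  set M := max 1 (Real.log (Nat.card G))
  set r : ℝ := (R + 1) / R with hr
  have hR0 : (0 : ℝ) < R := by exact_mod_cast hR
  have hr1 : 1 < r := by rw [hr, lt_div_iff₀ hR0]; linarith
  have hlr : 0 < Real.log r := Real.log_pos hr1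
  have hc1 : (1 : ℝ) < c := by exact_mod_cast hc
  have hlc : 0 < Real.log c := Real.log_pos hc1
  have hM1 : 1 ≤ M := le_max_left _ _
  have hκ : 0 ≤ Real.log c / Real.log r := by positivity
  have hMκ : 1 ≤ M ^ (Real.log c / Real.log r) := Real.one_le_rpow hM1 hκ
  have hC1 : (1 : ℝ) ≤ C := by exact_mod_cast hC
  have hQ0 : (0 : ℝ) ≤ Q := Nat.cast_nonneg _
  rcases pow_eq_univ_or_lt_card h1 hS Q with hfull | hlt
  · refine ⟨Q, hfull, ?_⟩
    calc (Q : ℝ) = 1 * Q * 1 := by ring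
      _ ≤ _ := by gcongr
  set a : ℕ → ℕ := fun i => Nat.card ↥(S ^ (c ^ i * Q)) with ha
  have hNQ : ∀ i, Q ≤ c ^ i * Q := fun i => Nat.le_mul_of_pos_left _ (pow_pos (by omega) _)
  have haQ : ∀ i, Q ≤ a i := fun i => hlt.le.trans
    (Nat.card_mono (Set.toFinite _) (pow_mono_of_one_mem h1 (hNQ i)))
  have ha0 : ∀ i, (0 : ℝ) < a i := fun i => by
    have := haQ i
    exact_mod_cast (show 0 < a i by omega)
  have haG : ∀ i, Real.log (a i) ≤ Real.log (Nat.card G) := fun i =>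
    Real.log_le_log (ha0 i)
      (by exact_mod_cast Nat.card_le_card_of_injective _ Subtype.val_injective)
  have hlog : ∀ i, (∀ j < i, a j ^ (R + 1) < a (j + 1) ^ R) → r ^ i ≤ Real.log (a i) := by
    intro i
    induction i with
    | zero =>
      intro _
      rw [pow_zero, Real.le_log_iff_exp_le (ha0 0)]
      have h3 : (3 : ℝ) ≤ a 0 := by exact_mod_cast hQ.trans (haQ 0)
      linarith [Real.exp_one_lt_d9]
    | succ i ih =>
      intro h
      have h2 := ih fun j hj => h j (Nat.lt_succ_of_lt hj)
      have h3 : ((a i : ℝ)) ^ (R + 1) ≤ (a (i + 1) : ℝ) ^ R := by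
        exact_mod_cast (h i (Nat.lt_succ_self i)).le
      have h4 := Real.log_le_log (pow_pos (ha0 i) _) h3
      rw [Real.log_pow, Real.log_pow] at h4
      push_cast at h4
      have h5 : r * Real.log (a i) ≤ Real.log (a (i + 1)) := by
        rw [hr, div_mul_eq_mul_div, div_le_iff₀ hR0]
        linarith
      rw [pow_succ']
      exact (mul_le_mul_of_nonneg_left h2 (by linarith)).trans h5
  have hex : ∃ i, a (i + 1) ^ R ≤ a i ^ (R + 1) := by
    by_contra hcon
    push Not at hcon
    obtain ⟨i, hi⟩ := pow_unbounded_of_one_lt (Real.log (Nat.card G)) hr1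
    exact absurd ((hlog i fun j _ => hcon j).trans (haG i)) (not_le.2 hi)
  classical
  set i := Nat.find hex
  have hi := Nat.find_spec hex
  have hri : r ^ i ≤ M :=
    ((hlog i fun j hj => not_le.1 (Nat.find_min hex hj)).trans (haG i)).trans (le_max_right _ _)
  refine ⟨C * (c ^ i * Q), hg _ (hNQ i) (haQ i) ?_, ?_⟩
  · have : c * (c ^ i * Q) = c ^ (i + 1) * Q := by ring
    rw [this]
    exact hi
  · have hci : (c : ℝ) ^ i = (r ^ i) ^ (Real.log c / Real.log r) := by
      rw [← Real.rpow_natCast, ← Real.rpow_natCast, ← Real.rpow_mul (by linarith),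
        Real.rpow_def_of_pos (by linarith), Real.rpow_def_of_pos (by linarith)]
      congr 1
      field_simp
    have hle : (c : ℝ) ^ i ≤ M ^ (Real.log c / Real.log r) := by
      rw [hci]
      exact Real.rpow_le_rpow (by positivity) hri hκ
    push_cast
    calc (C : ℝ) * (c ^ i * Q) = C * Q * c ^ i := by ring
      _ ≤ _ := by gcongr

theorem exists_mem_pow_of_mem_insert_one_pow {S : Set G} {k : ℕ} {x : G}
    (hx : x ∈ (insert 1 S) ^ k) : ∃ j ≤ k, x ∈ S ^ j := by
  induction k generalizing x with
  | zero => exact ⟨0, le_rfl, by simpa using hx⟩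
  | succ k ih =>
    rw [pow_succ] at hx
    obtain ⟨y, hy, s, hs, rfl⟩ := hx
    obtain ⟨j, hj, hyj⟩ := ih hy
    rcases hs with rfl | hs
    · exact ⟨j, by omega, by simpa using hyj⟩
    · exact ⟨j + 1, by omega, by rw [pow_succ]; exact Set.mul_mem_mul hyj hs⟩

theorem closure_preimage_insert_one {H : Type*} [Group H] {π : G →* H}
    (hπ : Function.Surjective π) {S : Set H} (hS : Subgroup.closure S = ⊤) :
    Subgroup.closure (π ⁻¹' insert 1 S) = ⊤ := by
  have hker : π.ker ≤ Subgroup.closure (π ⁻¹' insert 1 S) := fun g hg =>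
    Subgroup.subset_closure (Or.inl (MonoidHom.mem_ker.1 hg))
  rw [← Subgroup.comap_map_eq_self hker, MonoidHom.map_closure, Set.image_preimage_eq _ hπ,
    Subgroup.closure_insert_one, hS, Subgroup.comap_top]

end Iteration

/-- Polylogarithmic diameter bound for `SL(n, F)` with respect to symmetric generating sets
containing the identity. -/
theorem exists_pow_eq_univ_SL {n : ℕ} (hn : 2 ≤ n) : ∃ D > (0 : ℝ), ∃ κ > (0 : ℝ),
    ∀ (F : Type) [Field F] [Finite F], ∀ S : Set SL(n, F), S⁻¹ = S → 1 ∈ S →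
      Subgroup.closure S = ⊤ → ∃ k : ℕ, S ^ k = Set.univ ∧
        (k : ℝ) ≤ D * (max 1 (Real.log (Nat.card SL(n, F)))) ^ κ := by
  obtain ⟨c, R, Q, hc, hR, hlarge⟩ := card_pow_large hn
  obtain ⟨Q', hQ', hQ'3, hQ'q⟩ : ∃ Q', Q ≤ Q' ∧ 3 ≤ Q' ∧ ∀ q, Q' ≤ q → 2 ^ 20 < q :=
    ⟨Q + 2 ^ 20 + 1, by omega, by omega, fun q hq => by omega⟩
  set C := 16 * ((n + 2) * n) with hC
  have hC1 : 1 ≤ C := by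
    have : 0 < (n + 2) * n := Nat.mul_pos (by omega) (by omega)
    omega
  set D : ℕ := C * Q' + 2 * Q' ^ (n * n - 1) with hD
  have hR0 : (0 : ℝ) < R := by exact_mod_cast hR
  have hκ : 0 < Real.log c / Real.log ((R + 1) / R : ℝ) := by
    refine div_pos (Real.log_pos (by exact_mod_cast hc)) (Real.log_pos ?_)
    rw [lt_div_iff₀ hR0]; linarith
  have hD0 : 0 < D := by
    have := Nat.mul_pos hC1 (show 0 < Q' by omega)
    omega
  refine ⟨D, by exact_mod_cast hD0, _, hκ, fun F _ _ S hS h1 hgen => ?_⟩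
  have hM : 1 ≤ (max 1 (Real.log (Nat.card SL(n, F)))) ^
      (Real.log c / Real.log ((R + 1) / R : ℝ)) := Real.one_le_rpow (le_max_left _ _) hκ.le
  by_cases hq : Q' ≤ Nat.card F
  · obtain ⟨k, hk, hkl⟩ := exists_pow_eq_univ_of_growth (Q := Q') (C := C) h1 hgen hc hR
      (by omega) hC1 fun N hN hcard hno => by
        have h2 := pow_eq_univ_of_large hn (hQ'q _ hq) hS h1
          (hlarge F (by omega) S hS h1 hgen N (by omega) (by omega) hno)
        rwa [show 16 * N * ((n + 2) * n) = C * N by rw [hC]; ring] at h2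
    refine ⟨k, hk, hkl.trans (mul_le_mul_of_nonneg_right ?_ (by linarith))⟩
    exact_mod_cast Nat.le_add_right _ _
  · refine ⟨Nat.card SL(n, F), ?_, ?_⟩
    · refine (pow_eq_univ_or_lt_card h1 hgen _).resolve_right (not_lt.2 ?_)
      exact Nat.card_le_card_of_injective _ Subtype.val_injective
    · have h2 : Nat.card SL(n, F) ≤ D := by
        refine (card_SL_le (by omega)).trans ?_
        refine (Nat.mul_le_mul_left 2 (Nat.pow_le_pow_left (not_le.1 hq).le _)).trans ?_
        exact Nat.le_add_left _ _
      calc (Nat.card SL(n, F) : ℝ) ≤ D * 1 := by rw [mul_one]; exact_mod_cast h2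
        _ ≤ _ := mul_le_mul_of_nonneg_left hM (Nat.cast_nonneg _)

theorem card_SL_le_card_PSL {n : ℕ} (hn : 0 < n) (F : Type*) [Field F] [Finite F] :
    Nat.card SL(n, F) ≤ n * Nat.card (Matrix.ProjectiveSpecialLinearGroup (Fin n) F) := by
  rw [Subgroup.card_eq_card_quotient_mul_card_subgroup (Subgroup.center SL(n, F)), mul_comm]
  exact Nat.mul_le_mul_right _ (card_center_le hn)

theorem max_one_log_card_SL_le {n : ℕ} (hn : 2 ≤ n) (F : Type*) [Field F] [Finite F] :
    max 1 (Real.log (Nat.card SL(n, F))) ≤ (2 * Real.log n + 2) *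
      Real.log (Nat.card (Matrix.ProjectiveSpecialLinearGroup (Fin n) F)) := by
  have : Nontrivial (Fin n) := Fin.nontrivial_iff_two_le.2 hn
  have : Finite (Matrix.ProjectiveSpecialLinearGroup (Fin n) F) :=
    Finite.of_surjective _ (QuotientGroup.mk'_surjective (Subgroup.center SL(n, F)))
  have h2 : 2 ≤ Nat.card (Matrix.ProjectiveSpecialLinearGroup (Fin n) F) :=
    Finite.one_lt_card
  set L := Nat.card (Matrix.ProjectiveSpecialLinearGroup (Fin n) F)
  have hL2 : (2 : ℝ) ≤ L := by exact_mod_cast h2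
  have hlog2 := Real.log_two_gt_d9
  have hL : Real.log 2 ≤ Real.log L := Real.log_le_log (by norm_num) hL2
  have hn1 : (1 : ℝ) ≤ n := by exact_mod_cast (show 1 ≤ n by omega)
  have hlogn : 0 ≤ Real.log n := Real.log_nonneg hn1
  refine max_le (by nlinarith) ?_
  have h3 : (Nat.card SL(n, F) : ℝ) ≤ n * L := by
    exact_mod_cast card_SL_le_card_PSL (by omega) F
  have h4 : (0 : ℝ) < Nat.card SL(n, F) := by exact_mod_cast Nat.card_pos
  have h5 := Real.log_le_log h4 h3
  rw [Real.log_mul (by linarith) (by linarith)] at h5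
  nlinarith

end BabaiPSL

/-- **Babai's conjecture for `PSL(n,q)`**: for every `n ≥ 2` there are `C, c > 0`
depending only on `n` such that for every finite field `F` and every symmetric
generating set `S` of `L = PSL(n,q)`, every element of `L` is a product of at most
`C·(log |L|)^c` elements of `S`. -/
theorem babai_conjecture_PSL (n : ℕ) (hn : 2 ≤ n) :
    ∃ C > (0 : ℝ), ∃ c > (0 : ℝ),
      ∀ (F : Type) [Field F] [Fintype F],
        ∀ S : Set (Matrix.ProjectiveSpecialLinearGroup (Fin n) F),
          S = S⁻¹ → Subgroup.closure S = ⊤ →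
            ∀ x : Matrix.ProjectiveSpecialLinearGroup (Fin n) F,
              ∃ k : ℕ,
                (k : ℝ) ≤
                  C * (Real.log (Nat.card (Matrix.ProjectiveSpecialLinearGroup (Fin n) F))) ^ c ∧
                x ∈ S ^ k := by
  obtain ⟨D, hD, κ, hκ, hdiam⟩ := BabaiPSL.exists_pow_eq_univ_SL hn
  have hlogn : 0 ≤ Real.log n := Real.log_nonneg (by exact_mod_cast (show 1 ≤ n by omega))
  refine ⟨D * (2 * Real.log n + 2) ^ κ, by positivity, κ, hκ, fun F _ _ S hS hgen x => ?_⟩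
  let π : SL(n, F) →* Matrix.ProjectiveSpecialLinearGroup (Fin n) F :=
    QuotientGroup.mk' (Subgroup.center SL(n, F))
  have hπ : Function.Surjective π := QuotientGroup.mk'_surjective _
  have hinv : (π ⁻¹' insert 1 S)⁻¹ = π ⁻¹' insert 1 S := by
    ext g
    rw [Set.mem_inv, Set.mem_preimage, Set.mem_preimage, map_inv, Set.mem_insert_iff,
      Set.mem_insert_iff, inv_eq_one, ← Set.mem_inv, ← hS]
  obtain ⟨k, hk, hkl⟩ := hdiam F (π ⁻¹' insert 1 S) hinv (Or.inl (map_one π))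
    (BabaiPSL.closure_preimage_insert_one hπ hgen)
  have hx : x ∈ (insert 1 S) ^ k := by
    obtain ⟨g, rfl⟩ := hπ x
    rw [← Set.image_preimage_eq (insert 1 S) hπ, ← Set.image_pow, hk]
    exact Set.mem_image_of_mem _ (Set.mem_univ g)
  obtain ⟨j, hj, hxj⟩ := BabaiPSL.exists_mem_pow_of_mem_insert_one_pow hx
  refine ⟨j, ?_, hxj⟩
  calc (j : ℝ) ≤ k := by exact_mod_cast hj
    _ ≤ _ := hkl
    _ ≤ D * ((2 * Real.log n + 2) *
          Real.log (Nat.card (Matrix.ProjectiveSpecialLinearGroup (Fin n) F))) ^ κ := by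
        gcongr
        exact BabaiPSL.max_one_log_card_SL_le hn F
    _ = _ := by
        rw [Real.mul_rpow (by positivity) (Real.log_natCast_nonneg _), mul_assoc]
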